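/- Let M be a connected manifold of odd dimension with finite-dimensional total rational cohomology. Then M has the strong stability property for its unordered configuration spaces if and only if M has odd cohomology (i.e. β_{2i}(M)=0 for all i≥1). Moreover, in that case H^*(C_k(M);ℚ) ≅ H^*(C_{k+1}(M);ℚ) for every k ≥ max(1, β(M)−1), where β(M)=Σ_i β_i(M) is the total Betti number. -/

import Mathlib

open CategoryTheory

/-- The singular chain complex of a topological space with rational coefficients:
the alternating face map complex of the free simplicial `ℚ`-module on the singular
simplicial set. -/
noncomputable def singularChainComplexQ (X : Type) [TopologicalSpace X] :
    ChainComplex (ModuleCat ℚ) ℕ :=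
  (AlgebraicTopology.alternatingFaceMapComplex (ModuleCat ℚ)).obj
    (((CategoryTheory.SimplicialObject.whiskering _ _).obj (ModuleCat.free ℚ)).obj
      (TopCat.toSSet.obj (TopCat.of X)))

/-- Singular homology with rational coefficients. -/
noncomputable def singularHomologyQ (X : Type) [TopologicalSpace X] (n : ℕ) : ModuleCat ℚ :=
  (singularChainComplexQ X).homology n

/-- Singular cohomology with rational coefficients.  Since `ℚ` is a field, by the universal
coefficient theorem `H^n(X;ℚ)` is naturally isomorphic to the linear dual of `H_n(X;ℚ)`,
which we take as the definition. -/
noncomputable def singularCohomologyQ (X : Type) [TopologicalSpace X] (n : ℕ) : Type :=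
  Module.Dual ℚ (singularHomologyQ X n)

noncomputable instance (X : Type) [TopologicalSpace X] (n : ℕ) :
    AddCommGroup (singularCohomologyQ X n) :=
  inferInstanceAs (AddCommGroup (Module.Dual ℚ (singularHomologyQ X n)))

noncomputable instance (X : Type) [TopologicalSpace X] (n : ℕ) :
    Module ℚ (singularCohomologyQ X n) :=
  inferInstanceAs (Module ℚ (Module.Dual ℚ (singularHomologyQ X n)))

/-- The `i`-th rational Betti number `β_i(X) = dim_ℚ H^i(X;ℚ)`. -/
noncomputable def bettiQ (X : Type) [TopologicalSpace X] (i : ℕ) : ℕ :=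
  Module.finrank ℚ (singularCohomologyQ X i)

/-- The ordered configuration space `F_k(X)` of `k` distinct points of `X`,
with the subspace topology from `X^k`. -/
def orderedConfig (X : Type) [TopologicalSpace X] (k : ℕ) : Type :=
  {f : Fin k → X // Function.Injective f}

instance (X : Type) [TopologicalSpace X] (k : ℕ) : TopologicalSpace (orderedConfig X k) :=
  inferInstanceAs (TopologicalSpace {f : Fin k → X // Function.Injective f})

/-- The unordered configuration space `C_k(X) = F_k(X)/S_k`, the quotient of the ordered
configuration space by the permutation action of the symmetric group, with the quotient
topology. -/
def unorderedConfig (X : Type) [TopologicalSpace X] (k : ℕ) : Type :=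
  Quot (fun f g : orderedConfig X k => ∃ σ : Equiv.Perm (Fin k), g.1 = f.1 ∘ σ)

instance (X : Type) [TopologicalSpace X] (k : ℕ) : TopologicalSpace (unorderedConfig X k) :=
  inferInstanceAs (TopologicalSpace (Quot _))

/-- `M` has the strong stability property with range `r`:
`H^i(C_k(M);ℚ) ≅ H^i(C_{k+1}(M);ℚ)` for all `i ≥ 0` and all `k ≥ r`. -/
def StrongStabilityRange (M : Type) [TopologicalSpace M] (r : ℕ) : Prop :=
  ∀ k : ℕ, r ≤ k → ∀ i : ℕ,
    Nonempty (singularCohomologyQ (unorderedConfig M k) i ≃ₗ[ℚ]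
      singularCohomologyQ (unorderedConfig M (k + 1)) i)

/-- `M` has the strong stability property: for some `r ≥ 1`, the rational cohomology of its
unordered configuration spaces is constant from `C_r(M)` on. -/
def StrongStability (M : Type) [TopologicalSpace M] : Prop :=
  ∃ r : ℕ, 1 ≤ r ∧ StrongStabilityRange M r

/-- `X` has finite-dimensional total rational cohomology: each `H^i(X;ℚ)` is
finite-dimensional and all but finitely many vanish. -/
def FiniteTotalCohomologyQ (X : Type) [TopologicalSpace X] : Prop :=
  (∀ i : ℕ, FiniteDimensional ℚ (singularCohomologyQ X i)) ∧
  ∃ N : ℕ, ∀ i : ℕ, N ≤ i → Subsingleton (singularCohomologyQ X i)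

/-- `M` is a rational homology `n`-sphere: `H^*(M;ℚ) ≅ H^*(S^n;ℚ)`, i.e.
`H^i(M;ℚ)` is one-dimensional for `i ∈ {0, n}` and vanishes otherwise (`n ≥ 1`). -/
def RatHomologySphere (M : Type) [TopologicalSpace M] (n : ℕ) : Prop :=
  ∀ i : ℕ, Module.rank ℚ (singularCohomologyQ M i) = if i = 0 ∨ i = n then 1 else 0

/-- `M` (of dimension `4m`) is a homology projective plane:
`β_0 = β_{2m} = β_{4m} = 1` and all other Betti numbers vanish. -/
def HomologyProjPlane (M : Type) [TopologicalSpace M] (m : ℕ) : Prop :=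
  ∀ i : ℕ, bettiQ M i = if i = 0 ∨ i = 2 * m ∨ i = 4 * m then 1 else 0

/-- The rational cohomological dimension: the largest `i` with `H^i(X;ℚ) ≠ 0`. -/
noncomputable def cohomDimQ (X : Type) [TopologicalSpace X] : ℕ :=
  sSup {i : ℕ | bettiQ X i ≠ 0}

/-- The `q`-truncated Poincaré polynomial
`P^{[q]}_X(t) = β_{τ-q+1} t^{τ-q+1} + ⋯ + β_τ t^τ` where `τ = cd(X)`. -/
noncomputable def truncPoincareQ (X : Type) [TopologicalSpace X] (q : ℕ) : Polynomial ℕ :=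
  ∑ j ∈ Finset.range q,
    if j ≤ cohomDimQ X then
      Polynomial.monomial (cohomDimQ X - j) (bettiQ X (cohomDimQ X - j))
    else 0

/-- The Poincaré polynomial `P_X(t) = ∑ᵢ β_i(X) tⁱ` (of a space with finite-dimensional
total cohomology). -/
noncomputable def poincarePolyQ (X : Type) [TopologicalSpace X] : Polynomial ℕ :=
  ∑ i ∈ Finset.range (cohomDimQ X + 1), Polynomial.monomial i (bettiQ X i)

/-- `M` satisfies the shifted stability condition with range `r`, shift `σ` and length `q`:
`P^{[q]}_{C_{k+1}(M)}(t) = t^σ P^{[q]}_{C_k(M)}(t)` for all `k ≥ r`. -/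
def ShiftedStabilityQ (M : Type) [TopologicalSpace M] (r σ q : ℕ) : Prop :=
  ∀ k : ℕ, r ≤ k →
    truncPoincareQ (unorderedConfig M (k + 1)) q =
      Polynomial.X ^ σ * truncPoincareQ (unorderedConfig M k) q

/-- `M` satisfies the Poincaré-polynomial shifted stability condition with range `r`,
shift `σ` and ratio `R`:  `P_{C_{k+1}(M)}(t) = P_{C_k(M)}(t) + t^{(k+1-r)σ} R(t)` for all
`k ≥ r`. -/
def PoincarePolyShiftedStability (M : Type) [TopologicalSpace M] (r σ : ℕ)
    (R : Polynomial ℕ) : Prop :=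
  ∀ k : ℕ, r ≤ k →
    poincarePolyQ (unorderedConfig M (k + 1)) =
      poincarePolyQ (unorderedConfig M k) + Polynomial.X ^ ((k + 1 - r) * σ) * R

/-- `M` satisfies the extended shifted stability condition with range `r` and shift `σ`:
`P^{[(k-r+1)σ]}_{C_{k+1}(M)}(t) = t^σ P^{[(k-r+1)σ]}_{C_k(M)}(t)` for all `k ≥ r`. -/
def ExtendedShiftedStability (M : Type) [TopologicalSpace M] (r σ : ℕ) : Prop :=
  ∀ k : ℕ, r ≤ k →
    truncPoincareQ (unorderedConfig M (k + 1)) ((k - r + 1) * σ) =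
      Polynomial.X ^ σ * truncPoincareQ (unorderedConfig M k) ((k - r + 1) * σ)

namespace TotalChains

section Affine

variable {K K' : Type}

/-- Formal chains of (possibly empty) tuples of points. -/
abbrev AffCh (K : Type) := (Σ n : ℕ, Fin n → K) →₀ ℚ

/-- The alternating sum of the faces of a tuple. -/
noncomputable def affFaces : (Σ n : ℕ, Fin n → K) → AffCh K
  | ⟨0, _⟩ => 0
  | ⟨n + 1, v⟩ => ∑ i : Fin (n + 1), (-1 : ℚ) ^ (i : ℕ) • Finsupp.single ⟨n, v ∘ i.succAbove⟩ 1

noncomputable def affBdy : AffCh K →ₗ[ℚ] AffCh K := Finsupp.linearCombination ℚ affFaces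

/-- Adding a first vertex. -/
noncomputable def affCone (b : K) : AffCh K →ₗ[ℚ] AffCh K :=
  Finsupp.lmapDomain ℚ ℚ fun s => ⟨s.1 + 1, Fin.cons b s.2⟩

noncomputable def affMap (g : K → K') : AffCh K →ₗ[ℚ] AffCh K' :=
  Finsupp.lmapDomain ℚ ℚ fun s => ⟨s.1, g ∘ s.2⟩

/-- The generator given by a tuple. -/
noncomputable def affGen {n : ℕ} (v : Fin n → K) : AffCh K := Finsupp.single ⟨n, v⟩ 1

lemma affBdy_gen_zero (v : Fin 0 → K) : affBdy (affGen v) = 0 := by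
  simp [affBdy, affGen, affFaces]

lemma affBdy_gen_succ {n : ℕ} (v : Fin (n + 1) → K) :
    affBdy (affGen v) = ∑ i : Fin (n + 1), (-1 : ℚ) ^ (i : ℕ) • affGen (v ∘ i.succAbove) := by
  simp [affBdy, affGen, affFaces]

lemma affCone_gen (b : K) {n : ℕ} (v : Fin n → K) :
    affCone b (affGen v) = affGen (Fin.cons b v : Fin (n + 1) → K) := by
  simp [affCone, affGen, Finsupp.lmapDomain_apply, Finsupp.mapDomain_single]

lemma affMap_gen (g : K → K') {n : ℕ} (v : Fin n → K) :
    affMap g (affGen v) = affGen (g ∘ v) := by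
  simp [affMap, affGen, Finsupp.lmapDomain_apply, Finsupp.mapDomain_single]

lemma affCh_hom_ext {V : Type} [AddCommGroup V] [Module ℚ V] {f g : AffCh K →ₗ[ℚ] V}
    (h : ∀ n (v : Fin n → K), f (affGen v) = g (affGen v)) : f = g := by
  apply Finsupp.lhom_ext'
  rintro ⟨n, v⟩
  apply LinearMap.ext_ring
  exact h n v

lemma affBdy_cone (b : K) (c : AffCh K) : affBdy (affCone b c) = c - affCone b (affBdy c) := by
  suffices h : affBdy ∘ₗ affCone b = LinearMap.id - affCone b ∘ₗ affBdy from
    LinearMap.congr_fun h c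
  apply affCh_hom_ext
  intro n v
  simp only [LinearMap.comp_apply, LinearMap.sub_apply, LinearMap.id_apply, affCone_gen]
  rw [affBdy_gen_succ, Fin.sum_univ_succ]
  have h0 : (Fin.cons b v : Fin (n + 1) → K) ∘ (0 : Fin (n + 1)).succAbove = v := by
    funext j; simp
  rw [h0]
  cases n with
  | zero => simp [affBdy_gen_zero]
  | succ n =>
    rw [affBdy_gen_succ, map_sum, sub_eq_add_neg, ← Finset.sum_neg_distrib]
    simp only [Fin.val_zero, pow_zero, one_smul, Fin.val_succ, add_right_inj]
    refine Finset.sum_congr rfl fun i _ => ?_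
    rw [map_smul, affCone_gen, pow_succ, mul_neg_one, neg_smul]
    congr 3
    funext j
    refine Fin.cases ?_ (fun j => ?_) j
    · simp
    · simp [Fin.succ_succAbove_succ]

lemma affBdy_affBdy (c : AffCh K) : affBdy (affBdy c) = 0 := by
  suffices h : (affBdy ∘ₗ affBdy : AffCh K →ₗ[ℚ] AffCh K) = 0 from LinearMap.congr_fun h c
  apply affCh_hom_ext
  intro n
  induction n with
  | zero => intro v; simp [affBdy_gen_zero]
  | succ n ih =>
    intro v
    have hv : affGen v = affCone (v 0) (affGen (Fin.tail v)) := by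
      rw [affCone_gen, Fin.cons_self_tail]
    have := ih (Fin.tail v)
    simp only [LinearMap.comp_apply, LinearMap.zero_apply] at this ⊢
    rw [hv, affBdy_cone, map_sub, affBdy_cone, this]
    simp

lemma affBdy_map (g : K → K') (c : AffCh K) : affBdy (affMap g c) = affMap g (affBdy c) := by
  suffices h : affBdy ∘ₗ affMap g = affMap g ∘ₗ affBdy from LinearMap.congr_fun h c
  apply affCh_hom_ext
  intro n v
  simp only [LinearMap.comp_apply, affMap_gen]
  cases n with
  | zero => simp [affBdy_gen_zero]
  | succ n =>
    simp only [affBdy_gen_succ, map_sum, map_smul, affMap_gen]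
    rfl

lemma affMap_cone (g : K → K') (b : K) (c : AffCh K) :
    affMap g (affCone b c) = affCone (g b) (affMap g c) := by
  suffices h : affMap g ∘ₗ affCone b = affCone (g b) ∘ₗ affMap g from LinearMap.congr_fun h c
  apply affCh_hom_ext
  intro n v
  simp only [LinearMap.comp_apply, affMap_gen, affCone_gen]
  congr 1
  funext j
  refine Fin.cases ?_ (fun j => ?_) j <;> simp

/-- The recursive cone construction `R v = b_v · (φ v - R (∂ v))`. -/
noncomputable def affRecAux (b : ∀ n, (Fin (n + 1) → K) → K') (φ : AffCh K →ₗ[ℚ] AffCh K') :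
    ∀ n, (Fin n → K) → AffCh K'
  | 0, _ => 0
  | n + 1, v => affCone (b n v) (φ (affGen v) -
      ∑ i : Fin (n + 1), (-1 : ℚ) ^ (i : ℕ) • affRecAux b φ n (v ∘ i.succAbove))

noncomputable def affRec (b : ∀ n, (Fin (n + 1) → K) → K') (φ : AffCh K →ₗ[ℚ] AffCh K') :
    AffCh K →ₗ[ℚ] AffCh K' := Finsupp.linearCombination ℚ fun s => affRecAux b φ s.1 s.2

lemma affRec_gen_zero (b : ∀ n, (Fin (n + 1) → K) → K') (φ : AffCh K →ₗ[ℚ] AffCh K')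
    (v : Fin 0 → K) : affRec b φ (affGen v) = 0 := by
  simp [affRec, affGen, affRecAux]

lemma affRec_gen_succ (b : ∀ n, (Fin (n + 1) → K) → K') (φ : AffCh K →ₗ[ℚ] AffCh K')
    {n : ℕ} (v : Fin (n + 1) → K) :
    affRec b φ (affGen v) = affCone (b n v) (φ (affGen v) - affRec b φ (affBdy (affGen v))) := by
  have h : ∀ {m} (w : Fin m → K), affRec b φ (affGen w) = affRecAux b φ m w := by
    intro m w; simp [affRec, affGen]
  rw [h, affBdy_gen_succ, map_sum]
  simp only [map_smul, h]
  rfl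

/-- The defect `φ - ∂R - R∂` satisfies the cone recursion. -/
lemma affRec_defect (b : ∀ n, (Fin (n + 1) → K) → K') (φ : AffCh K →ₗ[ℚ] AffCh K')
    (hφ : ∀ c, affBdy (φ c) = φ (affBdy c)) {n : ℕ} (v : Fin (n + 1) → K) :
    φ (affGen v) - affBdy (affRec b φ (affGen v)) - affRec b φ (affBdy (affGen v)) =
      affCone (b n v) (φ (affBdy (affGen v)) - affBdy (affRec b φ (affBdy (affGen v)))) := by
  rw [affRec_gen_succ, affBdy_cone, map_sub, hφ]
  abel

lemma affRec_homotopy (b : ∀ n, (Fin (n + 1) → K) → K') (φ : AffCh K →ₗ[ℚ] AffCh K')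
    (hφ : ∀ c, affBdy (φ c) = φ (affBdy c)) (h0 : ∀ v : Fin 0 → K, φ (affGen v) = 0)
    (c : AffCh K) : affBdy (affRec b φ c) + affRec b φ (affBdy c) = φ c := by
  suffices h : φ - affBdy ∘ₗ affRec b φ - affRec b φ ∘ₗ affBdy = 0 by
    have := LinearMap.congr_fun h c
    simp only [LinearMap.sub_apply, LinearMap.comp_apply, LinearMap.zero_apply] at this
    rw [sub_sub, sub_eq_zero] at this
    exact this.symm
  apply affCh_hom_ext
  intro n
  induction n with
  | zero => intro v; simp [affRec_gen_zero, affBdy_gen_zero, h0]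
  | succ n ih =>
    intro v
    simp only [LinearMap.sub_apply, LinearMap.comp_apply, LinearMap.zero_apply] at ih ⊢
    rw [affRec_defect b φ hφ]
    have : φ (affBdy (affGen v)) - affBdy (affRec b φ (affBdy (affGen v))) = 0 := by
      have hz : ∀ w : Fin n → K, φ (affGen w) - affBdy (affRec b φ (affGen w)) =
          affRec b φ (affBdy (affGen w)) := fun w => sub_eq_zero.1 (ih w)
      have h2 : affRec b φ (affBdy (affBdy (affGen v))) = 0 := by rw [affBdy_affBdy, map_zero]
      rw [← h2, affBdy_gen_succ]
      simp only [map_sum, map_smul, ← hz, smul_sub, Finset.sum_sub_distrib]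
    rw [this, map_zero]

lemma affRec_natural {L L' : Type} (b : ∀ n, (Fin (n + 1) → K) → K')
    (φ : AffCh K →ₗ[ℚ] AffCh K') (b' : ∀ n, (Fin (n + 1) → L) → L')
    (φ' : AffCh L →ₗ[ℚ] AffCh L') (g : K → L) (g' : K' → L')
    (hb : ∀ n v, g' (b n v) = b' n (g ∘ v)) (hφ : ∀ c, affMap g' (φ c) = φ' (affMap g c))
    (c : AffCh K) : affMap g' (affRec b φ c) = affRec b' φ' (affMap g c) := by
  suffices h : affMap g' ∘ₗ affRec b φ = affRec b' φ' ∘ₗ affMap g from LinearMap.congr_fun h c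
  apply affCh_hom_ext
  intro n
  induction n with
  | zero => intro v; simp [affRec_gen_zero, affMap_gen]
  | succ n ih =>
    intro v
    simp only [LinearMap.comp_apply] at ih ⊢
    rw [affRec_gen_succ, affMap_cone, hb, affMap_gen, affRec_gen_succ, map_sub, hφ, affMap_gen,
      ← affMap_gen, affBdy_map, affBdy_gen_succ]
    simp only [map_sum, map_smul, ih]

end Affine

/-- The standard topological simplex. -/
abbrev Dl (n : ℕ) : Type := stdSimplex ℝ (Fin (n + 1))

/-- Rational singular chains of all degrees. -/
abbrev Ch (X : Type) [TopologicalSpace X] := (Σ n : ℕ, C(Dl n, X)) →₀ ℚ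

noncomputable def gen {X : Type} [TopologicalSpace X] {n : ℕ} (σ : C(Dl n, X)) : Ch X :=
  Finsupp.single ⟨n, σ⟩ 1

noncomputable def simplexMap {n m : ℕ} (f : Fin (n + 1) → Fin (m + 1)) : C(Dl n, Dl m) :=
  ⟨stdSimplex.map f, stdSimplex.continuous_map f⟩

section

variable {X Y Z : Type} [TopologicalSpace X] [TopologicalSpace Y] [TopologicalSpace Z]

noncomputable def push (f : C(X, Y)) : Ch X →ₗ[ℚ] Ch Y :=
  Finsupp.lmapDomain ℚ ℚ fun s => ⟨s.1, f.comp s.2⟩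

noncomputable def faces : (Σ n : ℕ, C(Dl n, X)) → Ch X
  | ⟨0, _⟩ => 0
  | ⟨n + 1, σ⟩ => ∑ i : Fin (n + 2), (-1 : ℚ) ^ (i : ℕ) •
      Finsupp.single ⟨n, σ.comp (simplexMap i.succAbove)⟩ 1

noncomputable def bdy : Ch X →ₗ[ℚ] Ch X := Finsupp.linearCombination ℚ faces

lemma bdy_gen_zero (σ : C(Dl 0, X)) : bdy (gen σ) = 0 := by
  simp [bdy, gen, faces]

lemma bdy_gen_succ {n : ℕ} (σ : C(Dl (n + 1), X)) :
    bdy (gen σ) = ∑ i : Fin (n + 2), (-1 : ℚ) ^ (i : ℕ) •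
      gen (σ.comp (simplexMap i.succAbove)) := by
  simp [bdy, gen, faces]

lemma push_gen (f : C(X, Y)) {n : ℕ} (σ : C(Dl n, X)) : push f (gen σ) = gen (f.comp σ) := by
  simp [push, gen, Finsupp.lmapDomain_apply, Finsupp.mapDomain_single]

lemma ch_hom_ext {V : Type} [AddCommGroup V] [Module ℚ V] {f g : Ch X →ₗ[ℚ] V}
    (h : ∀ n (σ : C(Dl n, X)), f (gen σ) = g (gen σ)) : f = g := by
  apply Finsupp.lhom_ext'
  rintro ⟨n, v⟩
  apply LinearMap.ext_ring
  exact h n v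

lemma push_push (g : C(Y, Z)) (f : C(X, Y)) (c : Ch X) :
    push g (push f c) = push (g.comp f) c := by
  suffices h : push g ∘ₗ push f = push (g.comp f) from LinearMap.congr_fun h c
  apply ch_hom_ext
  intro n σ
  simp [push_gen, ContinuousMap.comp_assoc]

lemma push_id (c : Ch X) : push (ContinuousMap.id X) c = c := by
  suffices h : push (ContinuousMap.id X) = LinearMap.id from LinearMap.congr_fun h c
  apply ch_hom_ext
  intro n σ
  simp [push_gen]

lemma bdy_push (f : C(X, Y)) (c : Ch X) : bdy (push f c) = push f (bdy c) := by
  suffices h : bdy ∘ₗ push f = push f ∘ₗ bdy from LinearMap.congr_fun h c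
  apply ch_hom_ext
  intro n σ
  simp only [LinearMap.comp_apply, push_gen]
  cases n with
  | zero => simp [bdy_gen_zero]
  | succ n => simp only [bdy_gen_succ, map_sum, map_smul, push_gen, ContinuousMap.comp_assoc]

end

/-- A space in which convex combinations make sense. -/
class HasComb (X : Type) [TopologicalSpace X] where
  comb : ∀ {n : ℕ}, (Fin (n + 1) → X) → C(Dl n, X)
  comb_vertex : ∀ {n : ℕ} (v : Fin (n + 1) → X) (i : Fin (n + 1)),
    comb v (stdSimplex.vertex i) = v i
  comb_map : ∀ {n m : ℕ} (v : Fin (m + 1) → X) (f : Fin (n + 1) → Fin (m + 1)) (t : Dl n),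
    comb v (simplexMap f t) = comb (v ∘ f) t

open HasComb

/-- Maps preserving convex combinations. -/
def IsAff {X Y : Type} [TopologicalSpace X] [TopologicalSpace Y] [HasComb X] [HasComb Y]
    (g : X → Y) : Prop :=
  ∀ {n : ℕ} (v : Fin (n + 1) → X) (t : Dl n), g (comb v t) = comb (g ∘ v) t

lemma sum_simplexMap {E : Type} [AddCommGroup E] [Module ℝ E] {n m : ℕ}
    (f : Fin (n + 1) → Fin (m + 1)) (t : Dl n) (v : Fin (m + 1) → E) :
    ∑ j, (simplexMap f t : Dl m) j • v j = ∑ i, t i • v (f i) := by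
  classical
  have : ∀ j, (simplexMap f t : Dl m) j = ∑ i with f i = j, t i := by
    intro j
    exact FunOnFinite.linearMap_apply_apply ..
  simp only [this, Finset.sum_smul]
  rw [← Finset.sum_fiberwise Finset.univ f (fun i => t i • v (f i))]
  refine Finset.sum_congr rfl fun j _ => Finset.sum_congr rfl fun i hi => ?_
  rw [(Finset.mem_filter.1 hi).2]

/-- Convex subsets of topological vector spaces. -/
@[reducible]
noncomputable def convComb {E : Type} [AddCommGroup E] [Module ℝ E] [TopologicalSpace E]
    [ContinuousAdd E] [ContinuousSMul ℝ E] {K : Set E} (hK : Convex ℝ K) : HasComb K where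
  comb {n} v := ⟨fun t => ⟨∑ i, t i • (v i : E), hK.sum_mem (fun i _ => t.2.1 i) t.2.2
      (fun i _ => (v i).2)⟩, by
    refine Continuous.subtype_mk (continuous_finsetSum _ fun i _ => ?_) _
    exact ((continuous_apply i).comp continuous_subtype_val).smul continuous_const⟩
  comb_vertex v i := by
    ext
    simp [Pi.single_apply]
  comb_map v f t := by
    ext
    exact sum_simplexMap f t fun j => (v j : E)

noncomputable instance (n : ℕ) : HasComb (Dl n) := convComb (convex_stdSimplex ℝ _)

noncomputable instance : HasComb unitInterval := convComb (convex_Icc 0 1)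

noncomputable instance {X Y : Type} [TopologicalSpace X] [TopologicalSpace Y] [HasComb X]
    [HasComb Y] : HasComb (X × Y) where
  comb v := (comb (Prod.fst ∘ v)).prodMk (comb (Prod.snd ∘ v))
  comb_vertex v i := by simp [comb_vertex]
  comb_map v f t := by simp [comb_map, Function.comp_assoc]

lemma comb_dl_apply {n m : ℕ} (v : Fin (n + 1) → Dl m) (t : Dl n) (j : Fin (m + 1)) :
    (comb v t : Dl m) j = ∑ i, t i * v i j := by
  change (∑ i, t i • (v i : Fin (m + 1) → ℝ)) j = _
  simp [Finset.sum_apply]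

lemma comb_vertex_eq {n : ℕ} : comb (fun i => stdSimplex.vertex i) = ContinuousMap.id (Dl n) := by
  ext t j
  rw [comb_dl_apply]
  simp [Pi.single_apply]

lemma convComb_isAff {E : Type} [AddCommGroup E] [Module ℝ E] [TopologicalSpace E]
    [ContinuousAdd E] [ContinuousSMul ℝ E] {K : Set E} (hK : Convex ℝ K) :
    letI := convComb hK; ∀ {n : ℕ} (v : Fin (n + 1) → K), IsAff (comb v) := by
  intro n v m w t
  ext
  change ∑ i, (comb w t : Dl n) i • (v i : E) = ∑ j, t j • ∑ i, (w j) i • (v i : E)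
  simp only [comb_dl_apply, Finset.sum_smul, Finset.smul_sum, mul_smul]
  exact Finset.sum_comm

section Realisation

variable {X : Type} [TopologicalSpace X] [HasComb X]

/-- Realising formal tuples by affine singular simplices. -/
noncomputable def realGen : (Σ n : ℕ, Fin n → X) → Ch X
  | ⟨0, _⟩ => 0
  | ⟨_ + 1, v⟩ => gen (comb v)

noncomputable def real : AffCh X →ₗ[ℚ] Ch X := Finsupp.linearCombination ℚ realGen

lemma real_gen_zero (v : Fin 0 → X) : real (affGen v) = 0 := by simp [real, affGen, realGen]

lemma real_gen_succ {n : ℕ} (v : Fin (n + 1) → X) : real (affGen v) = gen (comb v) := by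
  simp [real, affGen, realGen]

lemma bdy_real (c : AffCh X) : bdy (real c) = real (affBdy c) := by
  suffices h : bdy ∘ₗ real = real ∘ₗ affBdy from LinearMap.congr_fun h c
  apply affCh_hom_ext
  intro n v
  simp only [LinearMap.comp_apply]
  rcases n with _ | _ | n
  · simp [real_gen_zero, affBdy_gen_zero]
  · rw [real_gen_succ, bdy_gen_zero, affBdy_gen_succ]
    simp [real_gen_zero]
  · rw [real_gen_succ, bdy_gen_succ, affBdy_gen_succ]
    simp only [map_sum, map_smul, real_gen_succ]
    refine Finset.sum_congr rfl fun i _ => ?_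
    congr 2
    ext t
    exact comb_map v _ t

lemma push_real {Y : Type} [TopologicalSpace Y] [HasComb Y] (g : C(X, Y)) (hg : IsAff g)
    (c : AffCh X) : push g (real c) = real (affMap g c) := by
  suffices h : push g ∘ₗ real = real ∘ₗ affMap g from LinearMap.congr_fun h c
  apply affCh_hom_ext
  intro n v
  simp only [LinearMap.comp_apply, affMap_gen]
  cases n with
  | zero => simp [real_gen_zero]
  | succ n =>
    rw [real_gen_succ, real_gen_succ, push_gen]
    congr 1
    ext t
    exact hg v t

end Realisation

/-- The tautological simplex. -/
noncomputable def iota (n : ℕ) : AffCh (Dl n) := affGen (fun i : Fin (n + 1) => stdSimplex.vertex i)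

lemma real_iota (n : ℕ) : real (iota n) = gen (ContinuousMap.id (Dl n)) := by
  rw [iota, real_gen_succ, comb_vertex_eq]

lemma gen_eq_push {X : Type} [TopologicalSpace X] {n : ℕ} (σ : C(Dl n, X)) :
    gen σ = push σ (real (iota n)) := by
  rw [real_iota, push_gen, ContinuousMap.comp_id]

lemma bdy_bdy {X : Type} [TopologicalSpace X] (c : Ch X) : bdy (bdy c) = 0 := by
  suffices h : (bdy ∘ₗ bdy : Ch X →ₗ[ℚ] Ch X) = 0 from LinearMap.congr_fun h c
  apply ch_hom_ext
  intro n σ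
  rw [LinearMap.comp_apply, gen_eq_push, bdy_push, bdy_push, bdy_real, bdy_real, affBdy_affBdy]
  simp

lemma affMap_iota {K : Type} {n : ℕ} (g : Dl n → K) :
    affMap g (iota n) = affGen fun i : Fin (n + 1) => g (stdSimplex.vertex i) := by
  rw [iota, affMap_gen]; rfl

lemma dl_isAff {n m : ℕ} (v : Fin (n + 1) → Dl m) : IsAff (comb v) :=
  convComb_isAff (convex_stdSimplex ℝ _) v

/-! ### Subdivision -/

noncomputable def bary {X : Type} [TopologicalSpace X] [HasComb X] (n : ℕ) (v : Fin (n + 1) → X) :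
    X := comb v stdSimplex.barycenter

/-- The affine subdivision homotopy. -/
noncomputable def affT {X : Type} [TopologicalSpace X] [HasComb X] : AffCh X →ₗ[ℚ] AffCh X :=
  affRec bary LinearMap.id

/-- The affine subdivision operator. -/
noncomputable def affSd {X : Type} [TopologicalSpace X] [HasComb X] : AffCh X →ₗ[ℚ] AffCh X :=
  LinearMap.id - affBdy ∘ₗ affT - affT ∘ₗ affBdy

lemma affT_natural {X Y : Type} [TopologicalSpace X] [HasComb X] [TopologicalSpace Y]
    [HasComb Y] (g : X → Y) (hg : IsAff g) (c : AffCh X) :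
    affMap g (affT c) = affT (affMap g c) :=
  affRec_natural _ _ _ _ g g (fun _ v => hg v _) (fun _ => rfl) c

lemma affSd_gen_succ {X : Type} [TopologicalSpace X] [HasComb X] {n : ℕ} (v : Fin (n + 1) → X) :
    affSd (affGen v) = affCone (bary n v) (affSd (affBdy (affGen v))) := by
  have := affRec_defect (bary (X := X)) LinearMap.id (fun _ => rfl) v
  simp only [affSd, LinearMap.sub_apply, LinearMap.comp_apply, LinearMap.id_apply] at this ⊢
  rw [affBdy_affBdy, map_zero, sub_zero]
  exact this

/-- The singular subdivision homotopy. -/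
noncomputable def subT {X : Type} [TopologicalSpace X] : Ch X →ₗ[ℚ] Ch X :=
  Finsupp.linearCombination ℚ fun s => push s.2 (real (affT (iota s.1)))

/-- The singular subdivision operator. -/
noncomputable def subS {X : Type} [TopologicalSpace X] : Ch X →ₗ[ℚ] Ch X :=
  LinearMap.id - bdy ∘ₗ subT - subT ∘ₗ bdy

section

variable {X Y : Type} [TopologicalSpace X] [TopologicalSpace Y]

lemma subT_gen {n : ℕ} (σ : C(Dl n, X)) : subT (gen σ) = push σ (real (affT (iota n))) := by
  simp [subT, gen]

lemma subT_push (f : C(X, Y)) (c : Ch X) : subT (push f c) = push f (subT c) := by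
  suffices h : subT ∘ₗ push f = push f ∘ₗ subT from LinearMap.congr_fun h c
  apply ch_hom_ext
  intro n σ
  simp [push_gen, subT_gen, push_push]

lemma subS_push (f : C(X, Y)) (c : Ch X) : subS (push f c) = push f (subS c) := by
  simp [subS, subT_push, bdy_push]

lemma subT_real {m : ℕ} (c : AffCh (Dl m)) : subT (real c) = real (affT c) := by
  suffices h : subT ∘ₗ real = real ∘ₗ affT from LinearMap.congr_fun h c
  apply affCh_hom_ext
  intro n v
  simp only [LinearMap.comp_apply]
  cases n with
  | zero => simp [real_gen_zero, affT, affRec_gen_zero]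
  | succ n =>
    rw [real_gen_succ, subT_gen, push_real _ (dl_isAff v), affT_natural _ (dl_isAff v),
      affMap_iota]
    simp only [comb_vertex]

lemma subS_real {m : ℕ} (c : AffCh (Dl m)) : subS (real c) = real (affSd c) := by
  simp [subS, affSd, subT_real, bdy_real]

lemma subS_eq (c : Ch X) : bdy (subT c) + subT (bdy c) = c - subS c := by
  simp [subS]; abel

lemma bdy_subS (c : Ch X) : bdy (subS c) = subS (bdy c) := by
  simp [subS, bdy_bdy]

end

/-! ### Prisms -/

/-- The affine prism operator. -/
noncomputable def affPrism {X : Type} [TopologicalSpace X] :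
    AffCh X →ₗ[ℚ] AffCh (X × unitInterval) :=
  affRec (fun _ v => (v 0, 0)) (affMap (fun x => (x, 1)) - affMap (fun x => (x, 0)))

lemma affPrism_homotopy {X : Type} [TopologicalSpace X] (c : AffCh X) :
    affBdy (affPrism c) + affPrism (affBdy c) =
      affMap (fun x => (x, 1)) c - affMap (fun x => (x, 0)) c := by
  refine affRec_homotopy _ _ (fun c => ?_) (fun v => ?_) c
  · simp [affBdy_map]
  · simp only [LinearMap.sub_apply, affMap_gen, sub_eq_zero]
    congr 1
    funext i
    exact i.elim0

lemma affPrism_natural {X Y : Type} [TopologicalSpace X] [TopologicalSpace Y] (g : X → Y)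
    (c : AffCh X) : affMap (Prod.map g id) (affPrism c) = affPrism (affMap g c) := by
  refine affRec_natural _ _ _ _ g (Prod.map g id) (fun _ v => rfl) (fun c => ?_) c
  suffices h : affMap (Prod.map g (id : unitInterval → unitInterval)) ∘ₗ
      (affMap (fun x => (x, 1)) - affMap (fun x => (x, 0))) =
      (affMap (fun x => (x, 1)) - affMap (fun x => (x, 0))) ∘ₗ affMap g from
    LinearMap.congr_fun h c
  apply affCh_hom_ext
  intro n v
  simp only [LinearMap.comp_apply, LinearMap.sub_apply, map_sub, affMap_gen]
  rfl

section

variable {X Y : Type} [TopologicalSpace X] [TopologicalSpace Y]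

/-- The singular prism operator. -/
noncomputable def prism : Ch X →ₗ[ℚ] Ch (X × unitInterval) :=
  Finsupp.linearCombination ℚ fun s =>
    push (s.2.prodMap (ContinuousMap.id _)) (real (affPrism (iota s.1)))

lemma prism_gen {n : ℕ} (σ : C(Dl n, X)) :
    prism (gen σ) = push (σ.prodMap (ContinuousMap.id _)) (real (affPrism (iota n))) := by
  simp [prism, gen]

lemma prism_push (f : C(X, Y)) (c : Ch X) :
    prism (push f c) = push (f.prodMap (ContinuousMap.id _)) (prism c) := by
  suffices h : prism ∘ₗ push f = push (f.prodMap (ContinuousMap.id _)) ∘ₗ prism from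
    LinearMap.congr_fun h c
  apply ch_hom_ext
  intro n σ
  simp only [LinearMap.comp_apply, push_gen, prism_gen, push_push]
  rfl

lemma prism_real {m : ℕ} (c : AffCh (Dl m)) : prism (real c) = real (affPrism c) := by
  suffices h : prism ∘ₗ real = real ∘ₗ affPrism from LinearMap.congr_fun h c
  apply affCh_hom_ext
  intro n v
  simp only [LinearMap.comp_apply]
  cases n with
  | zero => simp [real_gen_zero, affPrism, affRec_gen_zero]
  | succ n =>
    have hg : IsAff ((comb v).prodMap (ContinuousMap.id unitInterval)) := by
      intro k w t
      refine Prod.ext ?_ rfl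
      exact dl_isAff v _ t
    rw [real_gen_succ, prism_gen, push_real _ hg]
    have := affPrism_natural (comb v) (iota n)
    rw [affMap_iota] at this
    simp only [comb_vertex] at this
    rw [← this]
    rfl

lemma prism_homotopy (c : Ch X) : bdy (prism c) + prism (bdy c) =
    push ((ContinuousMap.id X).prodMk (ContinuousMap.const X 1)) c -
      push ((ContinuousMap.id X).prodMk (ContinuousMap.const X 0)) c := by
  suffices h : bdy ∘ₗ prism + prism ∘ₗ bdy =
      push ((ContinuousMap.id X).prodMk (ContinuousMap.const X 1)) -
      push ((ContinuousMap.id X).prodMk (ContinuousMap.const X (0 : unitInterval))) from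
    LinearMap.congr_fun h c
  apply ch_hom_ext
  intro n σ
  simp only [LinearMap.add_apply, LinearMap.sub_apply, LinearMap.comp_apply]
  rw [gen_eq_push, bdy_push, prism_push, prism_push, bdy_push, bdy_real, prism_real, prism_real,
    bdy_real, ← map_add, ← map_add, affPrism_homotopy, map_sub, map_sub, push_push, push_push]
  have h : ∀ s : unitInterval, real (affMap (fun x => (x, s)) (iota n)) =
      push ((ContinuousMap.id (Dl n)).prodMk (ContinuousMap.const _ s)) (real (iota n)) := by
    intro s
    rw [push_real]
    · rfl
    · intro k w t
      refine Prod.ext rfl (Subtype.ext ?_)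
      change (s : ℝ) = ∑ i, t i • (s : ℝ)
      rw [← Finset.sum_smul, stdSimplex.sum_eq_one, one_smul]
  rw [h, h, push_push, push_push]
  rfl

/-- The chain homotopy attached to a homotopy. -/
noncomputable def homOp (F : C(X × unitInterval, Y)) : Ch X →ₗ[ℚ] Ch Y := push F ∘ₗ prism

lemma homOp_eq (F : C(X × unitInterval, Y)) (f g : C(X, Y)) (h0 : ∀ x, F (x, 0) = f x)
    (h1 : ∀ x, F (x, 1) = g x) (c : Ch X) :
    bdy (homOp F c) + homOp F (bdy c) = push g c - push f c := by
  simp only [homOp, LinearMap.comp_apply]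
  rw [bdy_push, ← map_add, prism_homotopy, map_sub, push_push, push_push]
  congr 3
  · ext x; exact h1 x
  · ext x; exact h0 x

end

end TotalChains

namespace TotalChains
open HasComb

section

variable {X Y : Type} [TopologicalSpace X] [TopologicalSpace Y]

/-- Chains all of whose simplices satisfy a condition. -/
abbrev spt (R : Set (Σ n : ℕ, C(Dl n, X))) : Submodule ℚ (Ch X) := Finsupp.supported ℚ ℚ R

/-- Chains contained in a subset. -/
abbrev CA (A : Set X) : Submodule ℚ (Ch X) := spt {s | Set.range s.2 ⊆ A}

/-- Chains all of whose simplices have dimension in `D`. -/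
abbrev dgs (D : Set ℕ) : Submodule ℚ (Ch X) := spt {s | s.1 ∈ D}

lemma gen_mem_spt {R : Set (Σ n : ℕ, C(Dl n, X))} {n : ℕ} {σ : C(Dl n, X)} (h : ⟨n, σ⟩ ∈ R) :
    gen σ ∈ spt R := Finsupp.single_mem_supported ℚ 1 h

lemma map_mem_of_gen {V : Type} [AddCommGroup V] [Module ℚ V]
    {R : Set (Σ n : ℕ, C(Dl n, X))} (f : Ch X →ₗ[ℚ] V)
    (N : Submodule ℚ V) (h : ∀ n (σ : C(Dl n, X)), ⟨n, σ⟩ ∈ R → f (gen σ) ∈ N) {c : Ch X}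
    (hc : c ∈ spt R) : f c ∈ N := by
  rw [spt, Finsupp.supported_eq_span_single] at hc
  have : Submodule.span ℚ ((fun i => Finsupp.single i (1 : ℚ)) '' R) ≤ N.comap f := by
    rw [Submodule.span_le]
    rintro _ ⟨⟨n, σ⟩, hs, rfl⟩
    exact h n σ hs
  exact this hc

lemma CA_mono {A B : Set X} (h : A ⊆ B) : (CA A : Submodule ℚ (Ch X)) ≤ CA B :=
  Finsupp.supported_mono fun _ hs => hs.trans h

lemma mem_CA_inter {A B : Set X} {c : Ch X} (h1 : c ∈ CA A) (h2 : c ∈ CA B) : c ∈ CA (A ∩ B) := by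
  intro s hs
  exact Set.subset_inter (h1 hs) (h2 hs)

lemma mem_CA_univ (c : Ch X) : c ∈ CA (Set.univ : Set X) := fun _ _ => Set.subset_univ _

lemma CA_empty {c : Ch X} (h : c ∈ CA (∅ : Set X)) : c = 0 := by
  rw [← Finsupp.support_eq_empty, Finset.eq_empty_iff_forall_notMem]
  intro s hs
  have h1 := h hs
  exact h1 (Set.mem_range_self (stdSimplex.vertex 0))

lemma push_mem {f : C(X, Y)} {A : Set X} {B : Set Y} (h : Set.MapsTo f A B) {c : Ch X}
    (hc : c ∈ CA A) : push f c ∈ CA B := by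
  refine map_mem_of_gen _ _ (fun n σ hσ => ?_) hc
  rw [push_gen]
  refine gen_mem_spt ?_
  rintro _ ⟨t, rfl⟩
  exact h (hσ ⟨t, rfl⟩)

lemma push_mem_range {f : C(X, Y)} {B : Set Y} (h : Set.range f ⊆ B) (c : Ch X) :
    push f c ∈ CA B :=
  push_mem (A := Set.univ) (fun x _ => h ⟨x, rfl⟩) (mem_CA_univ c)

lemma bdy_mem {A : Set X} {c : Ch X} (hc : c ∈ CA A) : bdy c ∈ CA A := by
  refine map_mem_of_gen _ _ (fun n σ hσ => ?_) hc
  rw [gen_eq_push, bdy_push]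
  exact push_mem_range hσ _

lemma subT_mem {A : Set X} {c : Ch X} (hc : c ∈ CA A) : subT c ∈ CA A := by
  refine map_mem_of_gen _ _ (fun n σ hσ => ?_) hc
  rw [subT_gen]
  exact push_mem_range hσ _

lemma subS_mem {A : Set X} {c : Ch X} (hc : c ∈ CA A) : subS c ∈ CA A := by
  simp only [subS, LinearMap.sub_apply, LinearMap.comp_apply, LinearMap.id_apply]
  exact sub_mem (sub_mem hc (bdy_mem (subT_mem hc))) (subT_mem (bdy_mem hc))

lemma homOp_mem {F : C(X × unitInterval, Y)} {A : Set X} {B : Set Y}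
    (h : ∀ x ∈ A, ∀ t, F (x, t) ∈ B) {c : Ch X} (hc : c ∈ CA A) : homOp F c ∈ CA B := by
  refine map_mem_of_gen _ _ (fun n σ hσ => ?_) hc
  rw [homOp, LinearMap.comp_apply, prism_gen, push_push]
  refine push_mem_range ?_ _
  rintro _ ⟨⟨t, s⟩, rfl⟩
  exact h _ (hσ ⟨t, rfl⟩) s

lemma bdy_dgs_succ {D D' : Set ℕ} (h : ∀ n, n + 1 ∈ D → n ∈ D') {c : Ch X} (hc : c ∈ dgs D) :
    bdy c ∈ dgs D' := by
  refine map_mem_of_gen _ _ (fun n σ hσ => ?_) hc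
  cases n with
  | zero => rw [bdy_gen_zero]; exact zero_mem _
  | succ n =>
    rw [bdy_gen_succ]
    exact sum_mem fun i _ => Submodule.smul_mem _ _ (gen_mem_spt (h n hσ))

lemma push_dgs (f : C(X, Y)) {D : Set ℕ} {c : Ch X} (hc : c ∈ dgs D) : push f c ∈ dgs D := by
  refine map_mem_of_gen _ _ (fun n σ hσ => ?_) hc
  rw [push_gen]
  exact gen_mem_spt hσ

lemma exists_split {P Q : Set (Σ n : ℕ, C(Dl n, X))} {c : Ch X} (hc : c ∈ spt (P ∪ Q)) :
    ∃ a b : Ch X, c = a + b ∧ a ∈ spt P ∧ b ∈ spt Q ∧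
      ∀ R, c ∈ spt R → a ∈ spt R ∧ b ∈ spt R := by
  classical
  refine ⟨c.filter (· ∈ P), c.filter (¬ · ∈ P), (Finsupp.filter_add_filter_not c _).symm,
    ?_, ?_, fun R hR => ⟨?_, ?_⟩⟩ <;> intro s hs <;>
    rw [Finset.mem_coe, Finsupp.support_filter, Finset.mem_filter] at hs
  · exact hs.2
  · exact (hc hs.1).resolve_left hs.2
  · exact hR hs.1
  · exact hR hs.1

end

/-! ### Subdivided simplices become small -/

section Small

variable {m : ℕ}

/-- Affine chains of tuples satisfying a condition. -/
abbrev aspt {K : Type} (R : Set (Σ n : ℕ, Fin n → K)) : Submodule ℚ (AffCh K) :=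
  Finsupp.supported ℚ ℚ R

lemma amap_mem_of_gen {K V : Type} [AddCommGroup V] [Module ℚ V]
    {R : Set (Σ n : ℕ, Fin n → K)} (f : AffCh K →ₗ[ℚ] V)
    (N : Submodule ℚ V) (h : ∀ n (v : Fin n → K), ⟨n, v⟩ ∈ R → f (affGen v) ∈ N) {c : AffCh K}
    (hc : c ∈ aspt R) : f c ∈ N := by
  rw [aspt, Finsupp.supported_eq_span_single] at hc
  have : Submodule.span ℚ ((fun i => Finsupp.single i (1 : ℚ)) '' R) ≤ N.comap f := by
    rw [Submodule.span_le]
    rintro _ ⟨⟨n, v⟩, hs, rfl⟩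
    exact h n v hs
  exact this hc

lemma dist_comb_le {n : ℕ} {v : Fin (n + 1) → Dl m} {b : Dl m} {ρ : ℝ}
    (h : ∀ i, dist (v i) b ≤ ρ) (t : Dl n) : dist (comb v t) b ≤ ρ := by
  have := (convex_closedBall (b : Fin (m + 1) → ℝ) ρ).sum_mem (t := Finset.univ) (w := t)
    (z := fun i => (v i : Fin (m + 1) → ℝ)) (fun i _ => t.2.1 i) t.2.2 (fun i _ => h i)
  exact this

lemma dist_bary_le {n : ℕ} {v : Fin (n + 1) → Dl m} {r : ℝ}
    (h : ∀ i j, dist (v i) (v j) ≤ r) (i : Fin (n + 1)) :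
    dist (v i) (bary n v) ≤ n / (n + 1) * r := by
  have hb : (bary n v).1 =
      ∑ j, ((n : ℝ) + 1)⁻¹ • (v j).1 := by
    funext k
    have := comb_dl_apply v stdSimplex.barycenter k
    refine this.trans ?_
    rw [Finset.sum_apply]
    refine Finset.sum_congr rfl fun j _ => ?_
    have h2 : (stdSimplex.barycenter : Dl n) j = ((n : ℝ) + 1)⁻¹ := by
      have := stdSimplex.barycenter_apply (𝕜 := ℝ) j
      rw [Fintype.card_fin] at this
      push_cast at this
      exact this
    rw [h2]
    rfl
  have hn : (0 : ℝ) < n + 1 := by positivity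
  rw [Subtype.dist_eq, hb, dist_eq_norm]
  have h1 : (v i).1 - ∑ j, ((n : ℝ) + 1)⁻¹ • (v j).1 =
      ∑ j, ((n : ℝ) + 1)⁻¹ • ((v i).1 - (v j).1) := by
    simp only [smul_sub, Finset.sum_sub_distrib, Finset.sum_const, Finset.card_univ,
      Fintype.card_fin]
    congr 1
    rw [← Nat.cast_smul_eq_nsmul ℝ, smul_smul]
    push_cast
    rw [mul_inv_cancel₀ hn.ne', one_smul]
  rw [h1]
  refine (norm_sum_le _ _).trans ?_
  rw [← Finset.add_sum_erase _ _ (Finset.mem_univ i), sub_self, smul_zero, norm_zero, zero_add]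
  refine (Finset.sum_le_card_nsmul _ _ (((n : ℝ) + 1)⁻¹ * r) fun j _ => ?_).trans ?_
  · rw [norm_smul, Real.norm_of_nonneg (by positivity)]
    refine mul_le_mul_of_nonneg_left ?_ (by positivity)
    rw [← dist_eq_norm]
    exact h i j
  · rw [Finset.card_erase_of_mem (Finset.mem_univ i), Finset.card_univ, Fintype.card_fin,
      nsmul_eq_mul, Nat.add_sub_cancel]
    apply le_of_eq
    field_simp

/-- Subdivision preserves lengths and any set closed under convex combinations. -/
lemma affSd_mem_of_closed (C : Set (Dl m))
    (hC : ∀ {n : ℕ} (v : Fin (n + 1) → Dl m), (∀ i, v i ∈ C) → ∀ t, comb v t ∈ C) :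
    ∀ n (v : Fin n → Dl m), (∀ i, v i ∈ C) →
      affSd (affGen v) ∈ aspt {s : Σ n : ℕ, Fin n → Dl m | s.1 = n ∧ ∀ i, s.2 i ∈ C} := by
  intro n
  induction n with
  | zero =>
    intro v _
    have : affSd (affGen v) = affGen v := by
      simp [affSd, affT, affRec_gen_zero, affBdy_gen_zero]
    rw [this]
    exact Finsupp.single_mem_supported ℚ 1 ⟨rfl, fun i => i.elim0⟩
  | succ n ih =>
    intro v hv
    rw [affSd_gen_succ, affBdy_gen_succ, map_sum]
    have : (∑ i : Fin (n + 1), affSd ((-1 : ℚ) ^ (i : ℕ) • affGen (v ∘ i.succAbove))) ∈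
        aspt {s : Σ n : ℕ, Fin n → Dl m | s.1 = n ∧ ∀ i, s.2 i ∈ C} := by
      refine sum_mem fun i _ => ?_
      rw [map_smul]
      exact Submodule.smul_mem _ _ (ih _ fun j => hv _)
    refine amap_mem_of_gen _ _ (fun k w hw => ?_) this
    rw [affCone_gen]
    obtain ⟨rfl, hw⟩ := hw
    refine Finsupp.single_mem_supported ℚ 1 ⟨rfl, fun i => ?_⟩
    refine Fin.cases ?_ (fun i => ?_) i
    · exact hC v hv _
    · exact hw i

lemma affSd_small {r : ℝ} (hr : 0 ≤ r) : ∀ n (v : Fin n → Dl m), (∀ i j, dist (v i) (v j) ≤ r) →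
    affSd (affGen v) ∈ aspt {s : Σ n : ℕ, Fin n → Dl m | s.1 = n ∧
      ∀ i j, dist (s.2 i) (s.2 j) ≤ (n - 1 : ℝ) / n * r} := by
  intro n
  induction n with
  | zero =>
    intro v _
    have : affSd (affGen v) = affGen v := by
      simp [affSd, affT, affRec_gen_zero, affBdy_gen_zero]
    rw [this]
    exact Finsupp.single_mem_supported ℚ 1 ⟨rfl, fun i => i.elim0⟩
  | succ n ih =>
    intro v hv
    have hq : ((n + 1 : ℕ) - 1 : ℝ) / (n + 1 : ℕ) * r = n / (n + 1) * r := by push_cast; ring_nf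
    rw [hq, affSd_gen_succ, affBdy_gen_succ, map_sum]
    set C : Set (Dl m) := {x | dist x (bary n v) ≤ n / (n + 1) * r}
    have h1 : (∑ i : Fin (n + 1), affSd ((-1 : ℚ) ^ (i : ℕ) • affGen (v ∘ i.succAbove))) ∈
        aspt ({s : Σ n : ℕ, Fin n → Dl m | s.1 = n ∧ ∀ i, s.2 i ∈ C} ∩
          {s : Σ n : ℕ, Fin n → Dl m | s.1 = n ∧
            ∀ i j, dist (s.2 i) (s.2 j) ≤ (n - 1 : ℝ) / n * r}) := by
      refine sum_mem fun i _ => ?_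
      rw [map_smul]
      refine Submodule.smul_mem _ _ ?_
      rw [aspt, Finsupp.supported_inter]
      refine ⟨affSd_mem_of_closed C (fun v h t => dist_comb_le h t) _ _ fun j => ?_,
        ih _ fun j k => hv _ _⟩
      exact dist_bary_le hv _
    refine amap_mem_of_gen _ _ (fun k w hw => ?_) h1
    rw [affCone_gen]
    obtain ⟨⟨rfl, hw⟩, -, hw'⟩ := hw
    have hpos : 0 ≤ (k : ℝ) / (k + 1) * r := by positivity
    refine Finsupp.single_mem_supported ℚ 1 ⟨rfl, fun i j => ?_⟩
    refine Fin.cases (Fin.cases ?_ (fun j => ?_) j) (fun i => Fin.cases ?_ (fun j => ?_) j) i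
    · simpa using hpos
    · have h2 : dist (w j) (bary k v) ≤ k / (k + 1) * r := hw j
      simpa [dist_comm] using h2
    · have h2 : dist (w i) (bary k v) ≤ k / (k + 1) * r := hw i
      simpa using h2
    · simp only [Fin.cons_succ]
      refine (hw' i j).trans (mul_le_mul_of_nonneg_right ?_ hr)
      have hk : 0 < k := i.pos
      rw [div_le_div_iff₀ (by positivity) (by positivity)]
      nlinarith

lemma affSd_iter_small (N : ℕ) : ∃ (q : ℝ), q = (m : ℝ) / (m + 1) ∧
    (affSd ^ N) (iota m) ∈ aspt {s : Σ n : ℕ, Fin n → Dl m | s.1 = m + 1 ∧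
      ∀ i j, dist (s.2 i) (s.2 j) ≤ q ^ N} := by
  refine ⟨_, rfl, ?_⟩
  induction N with
  | zero =>
    refine Finsupp.single_mem_supported ℚ 1 ⟨rfl, fun i j => ?_⟩
    rw [pow_zero]
    refine (Metric.dist_le_diam_of_mem (bounded_stdSimplex (Fin (m + 1)))
      (single_mem_stdSimplex ℝ i) (single_mem_stdSimplex ℝ j)).trans diam_stdSimplex_le
  | succ N ih =>
    rw [pow_succ', pow_succ', Module.End.mul_apply]
    refine amap_mem_of_gen _ _ (fun k w hw => ?_) ih
    obtain ⟨rfl, hw⟩ := hw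
    have := affSd_small (m := m) (by positivity) _ w hw
    refine Finsupp.supported_mono ?_ this
    rintro ⟨k, u⟩ ⟨h1, h2⟩
    refine ⟨h1, fun i j => (h2 i j).trans (le_of_eq ?_)⟩
    push_cast
    ring

end Small

section Subdivide

variable {X : Type} [TopologicalSpace X]

lemma subS_iter_gen (N : ℕ) {n : ℕ} (σ : C(Dl n, X)) :
    (subS ^ N) (gen σ) = push σ (real ((affSd ^ N) (iota n))) := by
  induction N with
  | zero => exact gen_eq_push σ
  | succ N ih =>
    rw [pow_succ', Module.End.mul_apply, ih, subS_push, subS_real, pow_succ', Module.End.mul_apply]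

lemma subS_iter_mem {A : Set X} (N : ℕ) {c : Ch X} (hc : c ∈ CA A) : (subS ^ N) c ∈ CA A := by
  induction N with
  | zero => exact hc
  | succ N ih => rw [pow_succ', Module.End.mul_apply]; exact subS_mem ih

lemma subS_iter_dgs {D : Set ℕ} (N : ℕ) {c : Ch X} (hc : c ∈ dgs D) : (subS ^ N) c ∈ dgs D := by
  refine map_mem_of_gen _ _ (fun n σ hσ => ?_) hc
  rw [subS_iter_gen]
  refine push_dgs _ ?_
  obtain ⟨q, -, h⟩ := affSd_iter_small (m := n) N
  refine amap_mem_of_gen _ _ (fun k w hw => ?_) h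
  obtain ⟨rfl, -⟩ := hw
  rw [real_gen_succ]
  exact gen_mem_spt hσ

lemma exists_subS_iter_gen {ι : Type} (U : ι → Set X) (hU : ∀ i, IsOpen (U i)) {n : ℕ}
    (σ : C(Dl n, X)) (hσ : Set.range σ ⊆ ⋃ i, U i) :
    ∃ N, (subS ^ N) (gen σ) ∈ spt {s : Σ n : ℕ, C(Dl n, X) | ∃ i, Set.range s.2 ⊆ U i} := by
  obtain ⟨δ, hδ, h⟩ := lebesgue_number_lemma_of_metric (s := (Set.univ : Set (Dl n)))
    (c := fun i => σ ⁻¹' U i) isCompact_univ (fun i => (hU i).preimage σ.continuous)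
    (fun x _ => by
      have := hσ ⟨x, rfl⟩
      simpa using this)
  have hq : (n : ℝ) / (n + 1) < 1 := by
    rw [div_lt_one (by positivity)]
    linarith
  obtain ⟨N, hN⟩ := exists_pow_lt_of_lt_one hδ hq
  refine ⟨N, ?_⟩
  rw [subS_iter_gen]
  obtain ⟨q, rfl, hs⟩ := affSd_iter_small (m := n) N
  change (push σ ∘ₗ real) _ ∈ _
  refine amap_mem_of_gen _ _ (fun k w hw => ?_) hs
  obtain ⟨rfl, hw⟩ := hw
  rw [LinearMap.comp_apply, real_gen_succ, push_gen]
  refine gen_mem_spt ?_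
  obtain ⟨i, hi⟩ := h (w 0) trivial
  refine ⟨i, ?_⟩
  rintro _ ⟨t, rfl⟩
  exact hi (lt_of_le_of_lt (dist_comb_le (fun j => hw j 0) t) hN)

lemma exists_subS_iter {ι : Type} (U : ι → Set X) (hU : ∀ i, IsOpen (U i)) {z : Ch X}
    (hz : z ∈ CA (⋃ i, U i)) :
    ∃ N, (subS ^ N) z ∈ spt {s : Σ n : ℕ, C(Dl n, X) | ∃ i, Set.range s.2 ⊆ U i} := by
  have hmono : ∀ {c : Ch X} {N N' : ℕ}, N ≤ N' →
      (subS ^ N) c ∈ spt {s : Σ n : ℕ, C(Dl n, X) | ∃ i, Set.range s.2 ⊆ U i} →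
      (subS ^ N') c ∈ spt {s : Σ n : ℕ, C(Dl n, X) | ∃ i, Set.range s.2 ⊆ U i} := by
    intro c N N' hN h
    obtain ⟨k, rfl⟩ := Nat.exists_eq_add_of_le' hN
    rw [pow_add, Module.End.mul_apply]
    refine map_mem_of_gen _ _ (fun n σ hσ => ?_) h
    obtain ⟨i, hi⟩ := hσ
    have h2 : (subS ^ k) (gen σ) ∈ CA (U i) := subS_iter_mem k (gen_mem_spt hi)
    refine Finsupp.supported_mono ?_ h2
    exact fun s hs => ⟨i, hs⟩
  let L : Submodule ℚ (Ch X) :=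
    { carrier := {c | ∃ N, (subS ^ N) c ∈
        spt {s : Σ n : ℕ, C(Dl n, X) | ∃ i, Set.range s.2 ⊆ U i}}
      add_mem' := by
        rintro a b ⟨N, hN⟩ ⟨N', hN'⟩
        refine ⟨max N N', ?_⟩
        rw [map_add]
        exact add_mem (hmono (le_max_left _ _) hN) (hmono (le_max_right _ _) hN')
      zero_mem' := ⟨0, by rw [map_zero]; exact zero_mem _⟩
      smul_mem' := by
        rintro q a ⟨N, hN⟩
        exact ⟨N, by rw [map_smul]; exact Submodule.smul_mem _ _ hN⟩ }
  exact map_mem_of_gen LinearMap.id L (fun n σ hσ => exists_subS_iter_gen U hU σ hσ) hz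

/-- The homotopy between the identity and the iterated subdivision. -/
noncomputable def subTN (N : ℕ) : Ch X →ₗ[ℚ] Ch X := ∑ k ∈ Finset.range N, subT ∘ₗ (subS ^ k)

lemma subS_pow_bdy (N : ℕ) (c : Ch X) : bdy ((subS ^ N) c) = (subS ^ N) (bdy c) := by
  induction N with
  | zero => rfl
  | succ N ih => rw [pow_succ', Module.End.mul_apply, bdy_subS, ih, Module.End.mul_apply]

lemma subTN_eq (N : ℕ) (c : Ch X) :
    bdy (subTN N c) + subTN N (bdy c) = c - (subS ^ N) c := by
  induction N with
  | zero => simp [subTN]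
  | succ N ih =>
    have h : ∀ c : Ch X, subTN (N + 1) c = subTN N c + subT ((subS ^ N) c) := by
      intro c; simp [subTN, Finset.sum_range_succ]
    have h2 := subS_eq ((subS ^ N) c)
    rw [subS_pow_bdy] at h2
    rw [h, h, map_add, pow_succ', Module.End.mul_apply]
    calc _ = (bdy (subTN N c) + subTN N (bdy c)) +
          (bdy (subT ((subS ^ N) c)) + subT ((subS ^ N) (bdy c))) := by abel
      _ = _ := by rw [ih, h2]; abel

lemma subTN_mem {A : Set X} (N : ℕ) {c : Ch X} (hc : c ∈ CA A) : subTN N c ∈ CA A := by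
  simp only [subTN, LinearMap.sum_apply, LinearMap.comp_apply]
  exact sum_mem fun k _ => subT_mem (subS_iter_mem k hc)

/-- Small chains: subdivision relative to an open cover. -/
theorem subdivide {ι : Type} (U : ι → Set X) (hU : ∀ i, IsOpen (U i)) {z : Ch X}
    (hz : z ∈ CA (⋃ i, U i)) :
    ∃ S T : Ch X →ₗ[ℚ] Ch X, (∀ A : Set X, ∀ c ∈ CA A, S c ∈ CA A) ∧
      (∀ A : Set X, ∀ c ∈ CA A, T c ∈ CA A) ∧
      (∀ c, bdy (T c) + T (bdy c) = c - S c) ∧ (∀ c, bdy (S c) = S (bdy c)) ∧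
      (∀ D : Set ℕ, ∀ c ∈ dgs D, S c ∈ dgs D) ∧
      S z ∈ spt {s : Σ n : ℕ, C(Dl n, X) | ∃ i, Set.range s.2 ⊆ U i} := by
  obtain ⟨N, hN⟩ := exists_subS_iter U hU hz
  exact ⟨subS ^ N, subTN N, fun A c hc => subS_iter_mem N hc, fun A c hc => subTN_mem N hc,
    subTN_eq N, subS_pow_bdy N, fun D c hc => subS_iter_dgs N hc, hN⟩

theorem subdivide_two {U V : Set X} (hU : IsOpen U) (hV : IsOpen V) {z : Ch X}
    (hz : z ∈ CA (U ∪ V)) :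
    ∃ S T : Ch X →ₗ[ℚ] Ch X, (∀ A : Set X, ∀ c ∈ CA A, S c ∈ CA A) ∧
      (∀ A : Set X, ∀ c ∈ CA A, T c ∈ CA A) ∧
      (∀ c, bdy (T c) + T (bdy c) = c - S c) ∧ (∀ c, bdy (S c) = S (bdy c)) ∧
      (∀ D : Set ℕ, ∀ c ∈ dgs D, S c ∈ dgs D) ∧
      ∃ a b : Ch X, S z = a + b ∧ a ∈ CA U ∧ b ∈ CA V ∧
        ∀ R, S z ∈ spt R → a ∈ spt R ∧ b ∈ spt R := by
  obtain ⟨S, T, h1, h2, h3, h4, h5, h6⟩ := subdivide (fun b : Bool => bif b then U else V)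
    (by rintro (_ | _) <;> assumption) (z := z) (by
      refine CA_mono ?_ hz
      intro x hx
      rw [Set.mem_iUnion]
      rcases hx with h | h
      exacts [⟨true, h⟩, ⟨false, h⟩])
  refine ⟨S, T, h1, h2, h3, h4, h5, exists_split (Finsupp.supported_mono ?_ h6)⟩
  rintro s ⟨_ | _, hs⟩
  · exact Or.inr hs
  · exact Or.inl hs

end Subdivide

section Augmentation

variable {X Y : Type} [TopologicalSpace X] [TopologicalSpace Y]

/-- The augmentation. -/
noncomputable def aug : Ch X →ₗ[ℚ] ℚ :=
  Finsupp.linearCombination ℚ fun s => if s.1 = 0 then 1 else 0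

lemma aug_gen {n : ℕ} (σ : C(Dl n, X)) : aug (gen σ) = if n = 0 then 1 else 0 := by
  simp [aug, gen]

lemma aug_bdy (c : Ch X) : aug (bdy c) = 0 := by
  suffices h : aug ∘ₗ bdy = (0 : Ch X →ₗ[ℚ] ℚ) from LinearMap.congr_fun h c
  apply ch_hom_ext
  intro n σ
  rw [LinearMap.comp_apply]
  rcases n with _ | _ | n
  · simp [bdy_gen_zero]
  · simp [bdy_gen_succ, Fin.sum_univ_two, aug_gen]
  · simp [bdy_gen_succ, aug_gen]

lemma aug_push (f : C(X, Y)) (c : Ch X) : aug (push f c) = aug c := by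
  suffices h : aug ∘ₗ push f = (aug : Ch X →ₗ[ℚ] ℚ) from LinearMap.congr_fun h c
  apply ch_hom_ext
  intro n σ
  simp [push_gen, aug_gen]

lemma affPrism_length {n : ℕ} (v : Fin n → X) :
    affPrism (affGen v) ∈ aspt {s : Σ n : ℕ, Fin n → X × unitInterval | s.1 = n + 1} := by
  induction n with
  | zero => rw [affPrism, affRec_gen_zero]; exact zero_mem _
  | succ n ih =>
    rw [affPrism, affRec_gen_succ, ← affPrism]
    refine amap_mem_of_gen (R := {s | s.1 = n + 1}) _ _ ?_ ?_
    · rintro k w (rfl : k = n + 1)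
      rw [affCone_gen]
      exact Finsupp.single_mem_supported _ _ rfl
    · refine sub_mem ?_ ?_
      · rw [LinearMap.sub_apply, affMap_gen, affMap_gen]
        exact sub_mem (Finsupp.single_mem_supported _ _ rfl)
          (Finsupp.single_mem_supported _ _ rfl)
      · rw [affBdy_gen_succ, map_sum]
        refine sum_mem fun i _ => ?_
        rw [map_smul]
        exact Submodule.smul_mem _ _ (ih _)

lemma homOp_dgs (F : C(X × unitInterval, Y)) {D D' : Set ℕ} (h : ∀ n ∈ D, n + 1 ∈ D') {c : Ch X}
    (hc : c ∈ dgs D) : homOp F c ∈ dgs D' := by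
  refine map_mem_of_gen _ _ (fun n σ hσ => ?_) hc
  rw [homOp, LinearMap.comp_apply, prism_gen]
  refine push_dgs _ (push_dgs _ ?_)
  refine amap_mem_of_gen real _ ?_ (affPrism_length _)
  rintro k w (rfl : k = n + 1 + 1)
  rw [real_gen_succ]
  exact gen_mem_spt (h n hσ)

lemma aug_of_pos {c : Ch X} (hc : c ∈ dgs {n | 1 ≤ n}) : aug c = 0 := by
  refine map_mem_of_gen aug ⊥ (fun n σ hσ => ?_) hc
  rw [aug_gen, if_neg (Nat.one_le_iff_ne_zero.1 hσ)]
  exact zero_mem _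

lemma aug_homOp (F : C(X × unitInterval, Y)) (c : Ch X) : aug (homOp F c) = 0 :=
  aug_of_pos (homOp_dgs F (D := Set.univ) (fun n _ => Nat.succ_pos n) fun _ _ => trivial)

/-- The contraction of constant chains. -/
noncomputable def constOp (a : X) : Ch X →ₗ[ℚ] Ch X :=
  Finsupp.linearCombination ℚ fun s => gen (ContinuousMap.const (Dl (s.1 + 1)) a)

lemma constOp_gen (a : X) {n : ℕ} (σ : C(Dl n, X)) :
    constOp a (gen σ) = gen (ContinuousMap.const (Dl (n + 1)) a) := by
  simp [constOp, gen]

lemma constOp_eq (a : X) (c : Ch X) : bdy (constOp a c) + constOp a (bdy c) =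
    push (ContinuousMap.const X a) c - aug c • gen (ContinuousMap.const (Dl 0) a) := by
  suffices h : bdy ∘ₗ constOp a + constOp a ∘ₗ bdy = push (ContinuousMap.const X a) -
      aug.smulRight (gen (ContinuousMap.const (Dl 0) a)) from LinearMap.congr_fun h c
  apply ch_hom_ext
  intro n σ
  simp only [LinearMap.add_apply, LinearMap.sub_apply, LinearMap.comp_apply, constOp_gen,
    push_gen, LinearMap.smulRight_apply, aug_gen]
  cases n with
  | zero =>
    simp [bdy_gen_zero, bdy_gen_succ, Fin.sum_univ_two, ContinuousMap.const_comp]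
  | succ n =>
    rw [bdy_gen_succ, bdy_gen_succ, map_sum, Fin.sum_univ_succ]
    simp [constOp_gen, ContinuousMap.const_comp, pow_succ]

/-- Cycles of augmentation zero bound in contractible subsets. -/
lemma exists_bdy_of_contract {F : C(X × unitInterval, X)} {a : X} {A : Set X}
    (h0 : ∀ x, F (x, 0) = x) (h1 : ∀ x, F (x, 1) = a) (ha : a ∈ A)
    (hA : ∀ x ∈ A, ∀ t, F (x, t) ∈ A) {z : Ch X} (hz : z ∈ CA A) (hb : bdy z = 0)
    (he : aug z = 0) : ∃ w ∈ CA A, bdy w = z := by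
  have e1 := homOp_eq F (ContinuousMap.id X) (ContinuousMap.const X a) h0 h1 z
  have e2 := constOp_eq a z
  rw [hb, map_zero, add_zero, push_id] at e1
  rw [hb, map_zero, add_zero, he, zero_smul, sub_zero] at e2
  refine ⟨constOp a z - homOp F z, sub_mem ?_ (homOp_mem hA hz), ?_⟩
  · refine map_mem_of_gen _ _ (fun n σ _ => ?_) hz
    rw [constOp_gen]
    refine gen_mem_spt ?_
    rintro _ ⟨t, rfl⟩
    exact ha
  · rw [map_sub, e1, e2]
    abel

end Augmentation

lemma spt_left_of_add {X : Type} [TopologicalSpace X] {P Q R : Set (Σ n : ℕ, C(Dl n, X))}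
    (hPQ : Disjoint P Q) {a b : Ch X} (ha : a ∈ spt P) (hb : b ∈ spt Q) (h : a + b ∈ spt R) :
    a ∈ spt R := by
  intro s hs
  apply h
  have hb' : b s = 0 := by
    by_contra h'
    exact Set.disjoint_left.1 hPQ (ha hs) (hb (Finsupp.mem_support_iff.2 h'))
  rw [Finset.mem_coe, Finsupp.mem_support_iff, Finsupp.add_apply, hb', add_zero]
  exact Finsupp.mem_support_iff.1 hs

section Kill

variable {X : Type} [TopologicalSpace X]

/-- The operator `1 + τ`. -/
noncomputable def symOp (τ : C(X, X)) : Ch X →ₗ[ℚ] Ch X := LinearMap.id + push τ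

lemma symOp_bdy (τ : C(X, X)) (c : Ch X) : bdy (symOp τ c) = symOp τ (bdy c) := by
  simp [symOp, bdy_push]

lemma symOp_symOp {τ : C(X, X)} (hτ : τ.comp τ = ContinuousMap.id X) (c : Ch X) :
    symOp τ (symOp τ c) = (2 : ℚ) • symOp τ c := by
  simp only [symOp, LinearMap.add_apply, LinearMap.id_apply, map_add, push_push, hτ, push_id]
  rw [two_smul]
  abel

lemma symOp_mem {τ : C(X, X)} {A : Set X} (hA : Set.MapsTo τ A A) {c : Ch X} (hc : c ∈ CA A) :
    symOp τ c ∈ CA A := add_mem hc (push_mem hA hc)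

lemma symOp_dgs {τ : C(X, X)} {D : Set ℕ} {c : Ch X} (hc : c ∈ dgs D) :
    symOp τ c ∈ dgs D := add_mem hc (push_dgs _ hc)

/-- `1 + τ` kills relative cycles of `(U, U \ A)` of dimension less than `d`. -/
def Kills (τ : C(X, X)) (A : Set X) (d : ℕ) (U : Set X) : Prop :=
  ∀ z ∈ CA U, z ∈ dgs {n | n < d} → bdy z ∈ CA (U \ A) →
    ∃ w ∈ CA U, symOp τ z - bdy w ∈ CA (U \ A)

lemma Kills.exists_bounded {τ : C(X, X)} {A : Set X} {d : ℕ} {U : Set X} (h : Kills τ A d U)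
    {z : Ch X} (hz : z ∈ CA U) (hd : z ∈ dgs {n | n < d}) (hb : bdy z ∈ CA (U \ A)) :
    ∃ w ∈ CA U, w ∈ dgs {n | n < d + 1} ∧ symOp τ z - bdy w ∈ CA (U \ A) := by
  obtain ⟨w, hw, hwz⟩ := h z hz hd hb
  obtain ⟨a, b, rfl, ha, hb, hR⟩ := exists_split (P := {s : Σ n : ℕ, C(Dl n, X) | s.1 < d + 1})
    (Q := {s | d + 1 ≤ s.1}) (c := w) (fun s _ => lt_or_ge s.1 (d + 1))
  refine ⟨a, (hR _ hw).1, ha, ?_⟩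
  refine spt_left_of_add (P := {s : Σ n : ℕ, C(Dl n, X) | s.1 < d}) (Q := {s | d ≤ s.1})
    (b := - bdy b) ?_ ?_ ?_ ?_
  · exact Set.disjoint_left.2 fun s hs hs' => absurd hs' (Nat.not_le.2 hs)
  · exact sub_mem (symOp_dgs hd) (bdy_dgs_succ (D := {n | n < d + 1}) (D' := {n | n < d})
      (fun n hn => Nat.lt_of_succ_lt_succ hn) ha)
  · exact neg_mem (bdy_dgs_succ (D := {n | d + 1 ≤ n}) (D' := {n | d ≤ n})
      (fun n hn => Nat.le_of_succ_le_succ hn) hb)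
  · rw [map_add] at hwz
    convert hwz using 1
    abel

lemma kills_union {τ : C(X, X)} (hτ : τ.comp τ = ContinuousMap.id X) {A : Set X}
    {d : ℕ} {U V : Set X} (hU : IsOpen U) (hV : IsOpen V) (hUA : IsOpen (U \ A))
    (hVA : IsOpen (V \ A)) (hA : Set.MapsTo τ Aᶜ Aᶜ) (hτU : Set.MapsTo τ U U)
    (hτV : Set.MapsTo τ V V) (k1 : Kills τ A d (U ∩ V)) (k2 : Kills τ A (d + 1) U)
    (k3 : Kills τ A (d + 1) V) : Kills τ A (d + 1) (U ∪ V) := by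
  intro z hz hzd hzb
  have hτUA : Set.MapsTo τ (U \ A) (U \ A) := fun x hx => ⟨hτU hx.1, hA hx.2⟩
  have hτVA : Set.MapsTo τ (V \ A) (V \ A) := fun x hx => ⟨hτV hx.1, hA hx.2⟩
  have hτW : Set.MapsTo τ (U ∪ V) (U ∪ V) := fun x hx => hx.imp (fun h => hτU h) fun h => hτV h
  have hτWA : Set.MapsTo τ ((U ∪ V) \ A) ((U ∪ V) \ A) := fun x hx => ⟨hτW hx.1, hA hx.2⟩
  obtain ⟨S, T, hS, hT, hST, hSb, hSd, a, b, hab, ha, hb, hR⟩ := subdivide_two hU hV hz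
  obtain ⟨S', T', hS', hT', hST', hSb', hSd', p, q, hpq, hp, hq, hR'⟩ :=
    subdivide_two hUA hVA (z := S (bdy z)) (hS _ _ (by rwa [← Set.union_sdiff_distrib]))
  have had := hR _ (hSd _ _ hzd)
  have hbzd : bdy z ∈ dgs {n | n < d} :=
    bdy_dgs_succ (D := {n | n < d + 1}) (D' := {n | n < d})
      (fun n hn => Nat.lt_of_succ_lt_succ hn) hzd
  have hpd := hR' _ (hSd' _ _ (hSd _ _ hbzd))
  have key : bdy (S' a) + bdy (S' b) = p + q := by
    rw [hSb', hSb', ← map_add, ← map_add, ← hab, hSb, hpq]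
  have hy : bdy (S' a) - p = q - bdy (S' b) := by
    rw [sub_eq_sub_iff_add_eq_add, key, add_comm]
  have haU := hS' _ _ ha
  have hbV := hS' _ _ hb
  have hyUV : bdy (S' a) - p ∈ CA (U ∩ V) := by
    refine mem_CA_inter (sub_mem (bdy_mem haU) (CA_mono Set.sdiff_subset hp)) ?_
    rw [hy]
    exact sub_mem (CA_mono Set.sdiff_subset hq) (bdy_mem hbV)
  have hyd : bdy (S' a) - p ∈ dgs {n | n < d} :=
    sub_mem (bdy_dgs_succ (D := {n | n < d + 1}) (D' := {n | n < d})
      (fun n hn => Nat.lt_of_succ_lt_succ hn) (hSd' _ _ had.1)) hpd.1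
  have hyb : bdy (bdy (S' a) - p) ∈ CA ((U ∩ V) \ A) := by
    have h1 : bdy (bdy (S' a) - p) ∈ CA (U \ A) := by
      rw [map_sub, bdy_bdy, zero_sub]
      exact neg_mem (bdy_mem hp)
    have h2 : bdy (bdy (S' a) - p) ∈ CA (V \ A) := by
      rw [hy, map_sub, bdy_bdy, sub_zero]
      exact bdy_mem hq
    refine CA_mono ?_ (mem_CA_inter h1 h2)
    rintro x ⟨⟨h1, h2⟩, h3, -⟩
    exact ⟨⟨h1, h3⟩, h2⟩
  obtain ⟨g, hg, hgd, hgy⟩ := k1.exists_bounded hyUV hyd hyb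
  have hgU := CA_mono (Set.sdiff_subset_sdiff_left Set.inter_subset_left) hgy
  have hgV := CA_mono (Set.sdiff_subset_sdiff_left Set.inter_subset_right) hgy
  obtain ⟨w1, hw1, hw1'⟩ := k2 (symOp τ (S' a) - g)
    (sub_mem (symOp_mem hτU haU) (CA_mono Set.inter_subset_left hg))
    (sub_mem (symOp_dgs (hSd' _ _ had.1)) hgd) (by
      have : bdy (symOp τ (S' a) - g) = (symOp τ (bdy (S' a) - p) - bdy g) + symOp τ p := by
        rw [map_sub, map_sub, symOp_bdy]; abel
      rw [this]
      exact add_mem hgU (symOp_mem hτUA hp))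
  obtain ⟨w2, hw2, hw2'⟩ := k3 (symOp τ (S' b) + g)
    (add_mem (symOp_mem hτV hbV) (CA_mono Set.inter_subset_right hg))
    (add_mem (symOp_dgs (hSd' _ _ had.2)) hgd) (by
      have : bdy (symOp τ (S' b) + g) = symOp τ q - (symOp τ (bdy (S' a) - p) - bdy g) := by
        rw [hy, map_add, map_sub, symOp_bdy]; abel
      rw [this]
      exact sub_mem (symOp_mem hτVA hq) hgV)
  have hz' : z = S' (S z) + bdy (T z + T' (S z)) + (T (bdy z) + T' (S (bdy z))) := by
    have e1 := hST z
    have e2 := hST' (S z)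
    rw [hSb] at e2
    rw [map_add]
    calc z = S z + (z - S z) := by abel
      _ = S' (S z) + (S z - S' (S z)) + (z - S z) := by abel
      _ = _ := by rw [← e1, ← e2]; abel
  refine ⟨(2⁻¹ : ℚ) • (w1 + w2) + symOp τ (T z + T' (S z)), ?_, ?_⟩
  · refine add_mem (Submodule.smul_mem _ _ (add_mem (CA_mono Set.subset_union_left hw1)
      (CA_mono Set.subset_union_right hw2))) (symOp_mem hτW (add_mem (hT _ _ hz)
        (hT' _ _ (hS _ _ hz))))
  · have e : symOp τ z - bdy ((2⁻¹ : ℚ) • (w1 + w2) + symOp τ (T z + T' (S z))) =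
        (2⁻¹ : ℚ) • ((symOp τ (symOp τ (S' a) - g) - bdy w1) +
          (symOp τ (symOp τ (S' b) + g) - bdy w2)) +
        symOp τ (T (bdy z) + T' (S (bdy z))) := by
      have e3 : symOp τ (symOp τ (S' a) - g) + symOp τ (symOp τ (S' b) + g) =
          (2 : ℚ) • symOp τ (S' (S z)) := by
        rw [← symOp_symOp hτ, hab]
        simp only [map_add, map_sub]
        abel
      have e4 : (symOp τ (symOp τ (S' a) - g) - bdy w1) +
          (symOp τ (symOp τ (S' b) + g) - bdy w2) =
          (2 : ℚ) • symOp τ (S' (S z)) - bdy (w1 + w2) := by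
        rw [← e3, map_add bdy w1]; abel
      rw [e4, smul_sub, smul_smul, inv_mul_cancel₀ two_ne_zero, one_smul, map_add bdy, map_smul]
      nth_rewrite 1 [hz']
      rw [map_add (symOp τ), map_add (symOp τ), symOp_bdy]
      abel
    rw [e]
    refine add_mem (Submodule.smul_mem _ _ (add_mem (CA_mono ?_ hw1') (CA_mono ?_ hw2')))
      (symOp_mem hτWA (add_mem (hT _ _ hzb) (hT' _ _ (hS _ _ hzb))))
    · exact Set.sdiff_subset_sdiff_left Set.subset_union_left
    · exact Set.sdiff_subset_sdiff_left Set.subset_union_right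

/-- The set of points covered by a chain. -/
def carrier (c : Ch X) : Set X := ⋃ s ∈ c.support, Set.range s.2

lemma isCompact_carrier (c : Ch X) : IsCompact (carrier c) :=
  c.support.isCompact_biUnion fun s _ => isCompact_range s.2.continuous

lemma mem_CA_iff {c : Ch X} {A : Set X} : c ∈ CA A ↔ carrier c ⊆ A := by
  simp only [carrier, Set.iUnion₂_subset_iff]
  rfl

/-- Local-to-global principle for `Kills`. -/
theorem kills_of_basis {τ : C(X, X)} (hτ : τ.comp τ = ContinuousMap.id X) {A N : Set X}
    (hA : Set.MapsTo τ Aᶜ Aᶜ) (hN : ∀ U, IsOpen U → U ⊆ N → IsOpen (U \ A))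
    (hbasis : ∀ W, IsOpen W → W ⊆ N → Set.MapsTo τ W W → ∀ x ∈ W, ∃ V, IsOpen V ∧ V ⊆ W ∧
      Set.MapsTo τ V V ∧ x ∈ V ∧ ∀ d, Kills τ A d V) (d : ℕ) :
    ∀ W, IsOpen W → W ⊆ N → Set.MapsTo τ W W → Kills τ A d W := by
  induction d with
  | zero =>
    intro W _ _ _ z _ hz _
    have : z = 0 := by
      rw [← Finsupp.support_eq_empty, Finset.eq_empty_iff_forall_notMem]
      intro s hs
      exact absurd (hz hs) (Nat.not_lt_zero _)
    exact ⟨0, zero_mem _, by simp [this]⟩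
  | succ d ih =>
    intro W hW hWN hτW z hz hzd hzb
    choose! V hVo hVW hVτ hxV hVk using hbasis W hW hWN hτW
    have hfin : ∀ s : Finset X, (∀ x ∈ s, x ∈ W) → Kills τ A (d + 1) (⋃ x ∈ s, V x) := by
      classical
      intro s
      induction s using Finset.induction_on with
      | empty =>
        intro _ z hz _ _
        simp only [Finset.notMem_empty, Set.iUnion_of_empty, Set.iUnion_empty] at hz
        rw [CA_empty hz]
        exact ⟨0, zero_mem _, by simp⟩
      | insert x s hx ihs =>
        intro hs
        rw [Finset.set_biUnion_insert]
        have hxW := hs x (Finset.mem_insert_self x s)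
        have hs' : ∀ y ∈ s, y ∈ W := fun y hy => hs y (Finset.mem_insert_of_mem hy)
        have ho : IsOpen (⋃ y ∈ s, V y) := isOpen_biUnion fun y hy => hVo y (hs' y hy)
        have hsub : (⋃ y ∈ s, V y) ⊆ N :=
          Set.iUnion₂_subset fun y hy => (hVW y (hs' y hy)).trans hWN
        have hτs : Set.MapsTo τ (⋃ y ∈ s, V y) (⋃ y ∈ s, V y) := by
          intro y hy
          simp only [Set.mem_iUnion] at hy ⊢
          obtain ⟨i, hi, hyi⟩ := hy
          exact ⟨i, hi, hVτ i (hs' i hi) hyi⟩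
        have hxN := (hVW x hxW).trans hWN
        refine kills_union hτ (hVo x hxW) ho (hN _ (hVo x hxW) hxN) (hN _ ho hsub) hA
          (hVτ x hxW) hτs ?_ (hVk x hxW _) (ihs hs')
        exact ih _ ((hVo x hxW).inter ho) (Set.inter_subset_left.trans hxN)
          fun y hy => ⟨hVτ x hxW hy.1, hτs hy.2⟩
    have hzW := mem_CA_iff.1 hz
    obtain ⟨t, htW, ht⟩ := (isCompact_carrier z).elim_nhds_subcover V
      (fun x hx => (hVo x (hzW hx)).mem_nhds (hxV x (hzW hx)))
    have hsub : (⋃ x ∈ t, V x) ⊆ W := Set.iUnion₂_subset fun x hx => hVW x (hzW (htW x hx))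
    have hzt := mem_CA_iff.2 ht
    obtain ⟨w, hw, hw'⟩ := hfin t (fun x hx => hzW (htW x hx)) z hzt hzd
      (CA_mono (B := (⋃ x ∈ t, V x) \ A) (fun x hx => ⟨hx.1, hx.2.2⟩)
        (mem_CA_inter (bdy_mem hzt) hzb))
    exact ⟨w, CA_mono hsub hw, CA_mono (Set.sdiff_subset_sdiff_left hsub) hw'⟩

end Kill

section Reflection

variable {E : Type} [NormedAddCommGroup E]

/-- `T` acts as the scalar `s` on the relative homology of `(E, E \ L)`. -/
def ActsAs (L : Set E) (T : C(E, E)) (s : ℚ) : Prop :=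
  ∀ z : Ch E, bdy z ∈ CA Lᶜ → ∃ w, push T z - s • z - bdy w ∈ CA Lᶜ

lemma ActsAs.comp {L : Set E} {T T' : C(E, E)} {s s' : ℚ} (h : ActsAs L T s)
    (h' : ActsAs L T' s') (hT : Set.MapsTo T' Lᶜ Lᶜ) : ActsAs L (T'.comp T) (s * s') := by
  intro z hz
  obtain ⟨w, hw⟩ := h z hz
  obtain ⟨w', hw'⟩ := h' z hz
  refine ⟨push T' w + s • w', ?_⟩
  have := add_mem (push_mem hT hw) (Submodule.smul_mem _ s hw')
  convert this using 1
  simp only [map_sub, map_add, map_smul, push_push, smul_sub, smul_smul, bdy_push]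
  abel

lemma ActsAs.id (L : Set E) : ActsAs L (ContinuousMap.id E) 1 := fun z _ =>
  ⟨0, by simp [push_id]⟩

variable [NormedSpace ℝ E]

/-- Real affine combination homotopies. -/
noncomputable def segHom (f g : C(E, E)) : C(E × unitInterval, E) where
  toFun p := f p.1 + (p.2 : ℝ) • (g p.1 - f p.1)
  continuous_toFun := by fun_prop

/-- The reflection `x ↦ x - c x • e`. -/
noncomputable def reflMap (c : E →L[ℝ] ℝ) (e : E) : C(E, E) where
  toFun x := x - c x • e
  continuous_toFun := by fun_prop

lemma actsAs_reflMap (L : Submodule ℝ E) (hL : IsClosed (L : Set E)) (c : E →L[ℝ] ℝ) (e : E)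
    (hc : ∀ x ∈ L, c x = 0) (hce : c e = 2) : ActsAs (L : Set E) (reflMap c e) (-1) := by
  intro z hz
  set ρ := reflMap c e with hρ
  have ρa : ∀ x, ρ x = x - c x • e := fun _ => rfl
  let P : E → E := fun x => x - (c x / 2) • e
  have hP : Continuous P := by fun_prop
  let U : ℝ → Set E := fun s => {x | P x ∉ L ∨ 0 < s * c x}
  have hU : ∀ s, IsOpen (U s) := fun s => by
    refine IsOpen.union (hL.isOpen_compl.preimage hP) ?_
    exact isOpen_lt continuous_const (continuous_const.mul c.continuous)
  have hUL : ∀ s, U s ⊆ (L : Set E)ᶜ := by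
    rintro s x hx hxL
    rcases hx with hx | hx
    · apply hx
      simp only [P, hc x hxL]
      simpa using hxL
    · rw [hc x hxL, mul_zero] at hx
      exact lt_irrefl _ hx
  have hLU : (L : Set E)ᶜ ⊆ U 1 ∪ U (-1) := by
    intro x hx
    rcases lt_trichotomy (c x) 0 with h | h | h
    · exact Or.inr (Or.inr (by linarith))
    · refine Or.inl (Or.inl fun h' => hx ?_)
      simpa [P, h] using h'
    · exact Or.inl (Or.inr (by linarith))
  have cρ : ∀ x, c (ρ x) = - c x := fun x => by
    rw [ρa, map_sub, map_smul, hce, smul_eq_mul]; ring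
  have Pρ : ∀ x, P (ρ x) = P x := fun x => by
    simp only [P, cρ]
    rw [ρa]
    module
  have hρU : ∀ s, Set.MapsTo ρ (U s) (U (-s)) := fun s x hx => by
    refine hx.imp (fun h => ?_) fun h => ?_
    · rwa [Pρ]
    · rw [cρ]; linarith
  have hρL : Set.MapsTo ρ (L : Set E)ᶜ (L : Set E)ᶜ := fun x hx => by
    rcases hLU hx with h | h
    · exact hUL _ (hρU _ h)
    · exact hUL _ (hρU _ h)
  -- contractions
  have hcontr : ∀ s : ℝ, s * s = 1 → ∀ y ∈ CA (U s), bdy y = 0 → aug y = 0 →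
      ∃ w ∈ CA (U s), bdy w = y := by
    intro s hs y hy hb he
    refine exists_bdy_of_contract (F := segHom (ContinuousMap.id E)
      (ContinuousMap.const E (s • e))) (a := s • e) (fun x => by simp [segHom])
      (fun x => by simp [segHom]) ?_ ?_ hy hb he
    · right
      rw [map_smul, hce, smul_eq_mul, ← mul_assoc, hs]; norm_num
    · intro x hx t
      have e1 : segHom (ContinuousMap.id E) (ContinuousMap.const E (s • e)) (x, t) =
        x + (t : ℝ) • (s • e - x) := rfl
      rw [e1]
      have hc' : c (x + (t : ℝ) • (s • e - x)) = (1 - t) * c x + 2 * t * s := by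
        simp only [map_add, map_smul, map_sub, hce, smul_eq_mul]; ring
      have hP' : P (x + (t : ℝ) • (s • e - x)) = (1 - (t : ℝ)) • P x := by
        simp only [P, hc']
        module
      rcases eq_or_lt_of_le t.2.2 with h1 | h1
      · right
        rw [hc', h1]
        have : s * ((1 - 1) * c x + 2 * 1 * s) = 2 * (s * s) := by ring
        rw [this, hs]; norm_num
      · have h1' : 0 < 1 - (t : ℝ) := by linarith
        refine hx.imp (fun h => ?_) fun h => ?_
        · rw [hP']
          exact fun h' => h ((L.smul_mem_iff h1'.ne').1 h')
        · rw [hc']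
          have : s * ((1 - t) * c x + 2 * t * s) = (1 - t) * (s * c x) + 2 * t * (s * s) := by ring
          rw [this, hs]
          have := mul_pos h1' h
          have := t.2.1
          linarith
  obtain ⟨S, T, hS, hT, hST, hSb, -, p, q, hpq, hp, hq, -⟩ :=
    subdivide_two (hU 1) (hU (-1)) (CA_mono hLU hz)
  have hbz : bdy z = bdy (T (bdy z)) + (p + q) := by
    have := hST (bdy z)
    rw [bdy_bdy, map_zero, add_zero, hpq] at this
    rw [this]; abel
  have hyq : bdy q = - bdy p := by
    have := congrArg bdy hbz
    rw [bdy_bdy, map_add, bdy_bdy, map_add, zero_add] at this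
    exact (neg_eq_of_add_eq_zero_right this.symm).symm
  have hy : bdy p ∈ CA (U 1 ∩ U (-1)) := by
    refine mem_CA_inter (bdy_mem hp) ?_
    rw [← neg_eq_iff_eq_neg.2 hyq]
    exact neg_mem (bdy_mem hq)
  let G := homOp (segHom (ContinuousMap.id E) ρ)
  have hG : bdy (G (bdy p)) = push ρ (bdy p) - bdy p := by
    have := homOp_eq (segHom (ContinuousMap.id E) ρ) (ContinuousMap.id E) ρ
      (fun x => by simp [segHom]) (fun x => by simp [segHom]) (bdy p)
    rwa [bdy_bdy, map_zero, add_zero, push_id] at this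
  have hGm : G (bdy p) ∈ CA (U 1 ∩ U (-1)) := by
    refine homOp_mem (fun x hx t => ?_) hy
    have e1 : segHom (ContinuousMap.id E) ρ (x, t) = x - ((t : ℝ) * c x) • e := by
      change x + (t : ℝ) • (x - c x • e - x) = _
      module
    have hPx : P x ∉ L := by
      rcases hx.1 with h | h
      · exact h
      · rcases hx.2 with h' | h'
        · exact h'
        · linarith
    have hPy : P (segHom (ContinuousMap.id E) ρ (x, t)) = P x := by
      rw [e1]
      simp only [P, map_sub, map_smul, hce, smul_eq_mul]
      module
    exact ⟨Or.inl (by rwa [hPy]), Or.inl (by rwa [hPy])⟩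
  have haug : aug p + aug q = 0 := by
    have := congrArg aug hbz
    rw [aug_bdy, map_add, aug_bdy, map_add, zero_add] at this
    exact this.symm
  have haugG : aug (G (bdy p)) = 0 := aug_homOp _ _
  obtain ⟨w1, hw1, e1⟩ := hcontr 1 (by norm_num) (p + push ρ q + G (bdy p))
    (add_mem (add_mem hp (push_mem (by simpa using hρU (-1)) hq))
      (CA_mono Set.inter_subset_left hGm))
    (by rw [map_add, map_add, bdy_push, hyq, hG, map_neg]; abel)
    (by rw [map_add, map_add, aug_push, haugG, haug, add_zero])
  obtain ⟨w2, hw2, e2⟩ := hcontr (-1) (by norm_num) (q + push ρ p - G (bdy p))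
    (sub_mem (add_mem hq (push_mem (hρU 1) hp)) (CA_mono Set.inter_subset_right hGm))
    (by rw [map_sub, map_add, bdy_push, hyq, hG]; abel)
    (by rw [map_sub, map_add, aug_push, haugG, add_comm, haug, sub_zero])
  set v := T (bdy z) + push ρ (T (bdy z)) + w1 + w2 with hv
  have hvm : v ∈ CA (L : Set E)ᶜ := by
    have := hT _ _ hz
    exact add_mem (add_mem (add_mem this (push_mem hρL this)) (CA_mono (hUL _) hw1))
      (CA_mono (hUL _) hw2)
  have hcyc : bdy (z + push ρ z - v) = 0 := by
    rw [map_sub, map_add, bdy_push, hv, map_add, map_add, map_add, bdy_push, e1, e2]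
    nth_rewrite 1 2 [hbz]
    simp only [map_add]
    abel
  have he : gen (ContinuousMap.const (Dl 0) e) ∈ CA (L : Set E)ᶜ := by
    refine gen_mem_spt ?_
    rintro _ ⟨t, rfl⟩ h
    have := hc e h
    rw [hce] at this
    norm_num at this
  obtain ⟨w, -, hw⟩ := exists_bdy_of_contract (A := Set.univ)
    (F := segHom (ContinuousMap.id E) (ContinuousMap.const E e)) (a := e)
    (fun x => by simp [segHom]) (fun x => by simp [segHom]) trivial (fun _ _ _ => trivial)
    (z := z + push ρ z - v - aug (z + push ρ z - v) • gen (ContinuousMap.const (Dl 0) e))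
    (mem_CA_univ _) (by rw [map_sub, map_smul, bdy_gen_zero, hcyc, smul_zero, sub_zero])
    (by simp [aug_gen])
  refine ⟨w, ?_⟩
  have : push ρ z - (-1 : ℚ) • z - bdy w =
      v + aug (z + push ρ z - v) • gen (ContinuousMap.const (Dl 0) e) := by
    rw [hw, neg_one_smul]; abel
  rw [this]
  exact add_mem hvm (Submodule.smul_mem _ _ he)

end Reflection

section Swap

variable {k n : ℕ}

/-- Interchange the coordinates in `s` of the vectors numbered `a` and `b`. -/
noncomputable def swapOn (a b : Fin k) (s : Finset (Fin n)) :
    C(Fin k → EuclideanSpace ℝ (Fin n), Fin k → EuclideanSpace ℝ (Fin n)) where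
  toFun x i := WithLp.toLp 2 fun j => if j ∈ s then x (Equiv.swap a b i) j else x i j
  continuous_toFun := by
    refine continuous_pi fun i => ?_
    refine (PiLp.continuous_toLp 2 _).comp (continuous_pi fun j => ?_)
    split_ifs <;> fun_prop

/-- The tuples constant on the classes of `r`. -/
def diagSub (r : Setoid (Fin k)) : Submodule ℝ (Fin k → EuclideanSpace ℝ (Fin n)) where
  carrier := {x | ∀ i j, r i j → x i = x j}
  add_mem' h h' i j hij := by simp [h i j hij, h' i j hij]
  zero_mem' _ _ _ := rfl
  smul_mem' c x h i j hij := by simp [h i j hij]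

lemma isClosed_diagSub (r : Setoid (Fin k)) :
    IsClosed (diagSub (n := n) r : Set (Fin k → EuclideanSpace ℝ (Fin n))) := by
  have : (diagSub (n := n) r : Set (Fin k → EuclideanSpace ℝ (Fin n))) =
      ⋂ i, ⋂ j, ⋂ _ : r i j, {x | x i = x j} := by
    ext x; simp [diagSub]
  rw [this]
  refine isClosed_iInter fun i => isClosed_iInter fun j => isClosed_iInter fun _ =>
    isClosed_eq (by fun_prop) (by fun_prop)

lemma actsAs_swapOn (r : Setoid (Fin k)) {a b : Fin k} (hab : a ≠ b) (hr : r a b)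
    (s : Finset (Fin n)) :
    ActsAs (diagSub (n := n) r : Set (Fin k → EuclideanSpace ℝ (Fin n)))
      (swapOn a b s) ((-1) ^ s.card) := by
  classical
  induction s using Finset.induction_on with
  | empty =>
    have : swapOn a b (∅ : Finset (Fin n)) = ContinuousMap.id _ := by
      ext x i j
      simp [swapOn]
    rw [this, Finset.card_empty, pow_zero]
    exact ActsAs.id _
  | insert l s hl ih =>
    let c : (Fin k → EuclideanSpace ℝ (Fin n)) →L[ℝ] ℝ :=
      (EuclideanSpace.proj l).comp (ContinuousLinearMap.proj a) -
        (EuclideanSpace.proj l).comp (ContinuousLinearMap.proj b)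
    let e : Fin k → EuclideanSpace ℝ (Fin n) :=
      Pi.single a (EuclideanSpace.single l 1) - Pi.single b (EuclideanSpace.single l 1)
    have hc : ∀ x, c x = x a l - x b l := fun x => rfl
    have he : c e = 2 := by rw [hc]; simp [e, hab, hab.symm]; norm_num
    have hR := actsAs_reflMap (diagSub r (n := n)) (isClosed_diagSub r) c e
      (fun x hx => by rw [hc, hx a b hr, sub_self])
      he
    have hcomp : swapOn a b (insert l s) = (reflMap c e).comp (swapOn a b s) := by
      ext x i j
      simp only [swapOn, reflMap, ContinuousMap.coe_mk, ContinuousMap.comp_apply, hc,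
        Finset.mem_insert, Pi.sub_apply, Pi.smul_apply, PiLp.sub_apply, PiLp.smul_apply, e, hl,
        if_false, smul_eq_mul]
      by_cases hjl : j = l
      · subst hjl
        by_cases hia : i = a
        · subst hia; simp [hab, hl]
        · by_cases hib : i = b
          · subst hib; simp [hl, hia]
          · simp [hl, hia, hib, Equiv.swap_apply_of_ne_of_ne hia hib]
      · simp only [hjl, false_or]
        by_cases hia : i = a
        · subst hia; simp [hab, hjl]
        · by_cases hib : i = b
          · subst hib; simp [hia, hjl]
          · simp [hia, hib]
    rw [hcomp, Finset.card_insert_of_notMem hl, pow_succ]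
    refine ih.comp hR fun x hx h => hx ?_
    have hρρ : reflMap c e (reflMap c e x) = x := by
      change x - c x • e - c (x - c x • e) • e = x
      rw [map_sub, map_smul, he, smul_eq_mul]
      module
    have hfix : ∀ y ∈ diagSub r (n := n), reflMap c e y = y := fun y hy => by
      change y - c y • e = y
      rw [hc, hy a b hr, sub_self, zero_smul, sub_zero]
    have := hfix _ h
    rw [hρρ] at this
    rw [this]
    exact h

end Swap

section Transport

variable {X Y : Type} [TopologicalSpace X] [TopologicalSpace Y]

lemma push_mem_iff {φ : C(Y, X)} (hφ : Function.Injective φ) {B : Set X} {c : Ch Y} :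
    push φ c ∈ CA B ↔ c ∈ CA (φ ⁻¹' B) := by
  classical
  refine ⟨fun h s hs => ?_, fun h => push_mem (fun x hx => hx) h⟩
  have hinj : Function.Injective fun s : Σ n : ℕ, C(Dl n, Y) =>
      (⟨s.1, φ.comp s.2⟩ : Σ n : ℕ, C(Dl n, X)) := by
    rintro ⟨n, σ⟩ ⟨m, τ⟩ h
    obtain ⟨rfl, h⟩ := Sigma.mk.inj_iff.1 h
    obtain rfl := (ContinuousMap.cancel_left hφ).1 (eq_of_heq h)
    rfl
  have e : push φ c = Finsupp.mapDomain (fun s : Σ n : ℕ, C(Dl n, Y) =>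
      (⟨s.1, φ.comp s.2⟩ : Σ n : ℕ, C(Dl n, X))) c := rfl
  have : (⟨s.1, φ.comp s.2⟩ : Σ n : ℕ, C(Dl n, X)) ∈ (push φ c).support := by
    rw [e, Finsupp.mapDomain_support_of_injective hinj]
    exact Finset.mem_image_of_mem _ hs
  have := h this
  rintro _ ⟨t, rfl⟩
  exact this ⟨t, rfl⟩

lemma push_injective {φ : C(Y, X)} (hφ : Function.Injective φ) : Function.Injective (push φ) := by
  rw [injective_iff_map_eq_zero]
  intro c hc
  have : push φ c ∈ CA (∅ : Set X) := by rw [hc]; exact zero_mem _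
  exact CA_empty ((push_mem_iff hφ).1 this)

lemma exists_push_eq {φ : C(Y, X)} (hφ : Topology.IsEmbedding φ) {z : Ch X}
    (hz : z ∈ CA (Set.range φ)) : ∃ z', push φ z' = z := by
  refine map_mem_of_gen LinearMap.id (LinearMap.range (push φ)) (fun n σ hσ => ?_) hz
  let e := hφ.toHomeomorph
  let σ' : C(Dl n, Y) := (⟨e.symm, e.symm.continuous⟩ : C(Set.range φ, Y)).comp
    ⟨Set.codRestrict σ _ fun t => hσ ⟨t, rfl⟩, σ.continuous.codRestrict _⟩
  refine ⟨gen σ', ?_⟩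
  rw [push_gen]
  congr 1
  ext t
  change φ (e.symm _) = σ t
  have : ((e (e.symm ⟨σ t, hσ ⟨t, rfl⟩⟩) : Set.range φ) : X) = σ t := by
    rw [Homeomorph.apply_symm_apply]
  exact this

lemma kills_of_embedding {E : Type} [NormedAddCommGroup E] [NormedSpace ℝ E] {φ : C(E, X)}
    (hφ : Topology.IsEmbedding φ) {τ : C(X, X)} {T : C(E, E)} (hT : τ.comp φ = φ.comp T)
    {A : Set X} {L : Set E} (hA : φ ⁻¹' A = L) (h : ActsAs L T (-1)) (d : ℕ) :
    Kills τ A d (Set.range φ) := by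
  intro z hz _ hb
  obtain ⟨z', rfl⟩ := exists_push_eq hφ hz
  have hpre : φ ⁻¹' (Set.range φ \ A) = Lᶜ := by
    rw [← hA]
    ext x
    simp
  rw [bdy_push, push_mem_iff hφ.injective, hpre] at hb
  obtain ⟨w, hw⟩ := h z' hb
  refine ⟨push φ w, push_mem_range le_rfl _, ?_⟩
  rw [← hpre, ← push_mem_iff hφ.injective] at hw
  convert hw using 1
  simp only [symOp, LinearMap.add_apply, LinearMap.id_apply, push_push, hT, map_sub, bdy_push,
    map_smul]
  rw [neg_one_smul]
  abel

end Transport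

section Config

variable {M : Type} [TopologicalSpace M] {k : ℕ}

/-- Permutation of the coordinates. -/
def permC (σ : Equiv.Perm (Fin k)) : C(Fin k → M, Fin k → M) where
  toFun x := x ∘ σ
  continuous_toFun := by fun_prop

/-- The sum over all permutations. -/
noncomputable def symE : Ch (Fin k → M) →ₗ[ℚ] Ch (Fin k → M) := ∑ σ, push (permC σ)

lemma permC_comp (σ τ : Equiv.Perm (Fin k)) :
    (permC σ).comp (permC τ) = (permC (τ * σ) : C(Fin k → M, Fin k → M)) := rfl

lemma symE_apply (c : Ch (Fin k → M)) : symE c = ∑ σ, push (permC σ) c := by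
  simp [symE]

lemma symE_push (τ : Equiv.Perm (Fin k)) (c : Ch (Fin k → M)) :
    symE (push (permC τ) c) = symE c := by
  simp only [symE_apply, push_push, permC_comp]
  exact Fintype.sum_equiv (Equiv.mulLeft τ) _ _ fun σ => rfl

lemma push_symE (τ : Equiv.Perm (Fin k)) (c : Ch (Fin k → M)) :
    push (permC τ) (symE c) = symE c := by
  simp only [symE_apply, map_sum, push_push, permC_comp]
  exact Fintype.sum_equiv (Equiv.mulRight τ) _ _ fun σ => rfl

lemma symE_bdy (c : Ch (Fin k → M)) : bdy (symE c) = symE (bdy c) := by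
  simp only [symE_apply, map_sum, bdy_push]

lemma symE_mem {A : Set (Fin k → M)} (hA : ∀ σ, Set.MapsTo (permC σ) A A) {c : Ch (Fin k → M)}
    (hc : c ∈ CA A) : symE c ∈ CA A := by
  rw [symE_apply]
  exact sum_mem fun σ _ => push_mem (hA σ) hc

lemma symE_symOp (τ : Equiv.Perm (Fin k)) (c : Ch (Fin k → M)) :
    symE (symOp (permC τ) c) = (2 : ℚ) • symE c := by
  rw [symOp, LinearMap.add_apply, map_add, symE_push, two_smul]; rfl

lemma symE_symE (c : Ch (Fin k → M)) : symE (symE c) = (k.factorial : ℚ) • symE c := by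
  nth_rewrite 1 [symE_apply]
  simp [push_symE, Fintype.card_perm, Nat.cast_smul_eq_nsmul]

/-- Tuples whose coincidences are allowed by `r`. -/
def coinLe (M : Type) (r : Setoid (Fin k)) : Set (Fin k → M) := {x | Setoid.ker x ≤ r}

/-- Tuples whose coincidences are exactly those of `r`. -/
def coinEq (M : Type) (r : Setoid (Fin k)) : Set (Fin k → M) := {x | Setoid.ker x = r}

/-- Tuples with at least `p` different entries. -/
def distinctGe (M : Type) (k p : ℕ) : Set (Fin k → M) :=
  {x | p ≤ Nat.card (Quotient (Setoid.ker x))}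

lemma card_quotient_le {r s : Setoid (Fin k)} (h : r ≤ s) :
    Nat.card (Quotient s) ≤ Nat.card (Quotient r) :=
  Nat.card_le_card_of_surjective (Quotient.map' id h)
    (by rintro ⟨x⟩; exact ⟨Quotient.mk r x, rfl⟩)

lemma eq_of_card_quotient_le {r s : Setoid (Fin k)} (h : r ≤ s)
    (hc : Nat.card (Quotient r) ≤ Nat.card (Quotient s)) : r = s := by
  refine le_antisymm h fun x y hxy => ?_
  have hs : Function.Surjective (Quotient.map' id h : Quotient r → Quotient s) := by
    rintro ⟨x⟩; exact ⟨Quotient.mk r x, rfl⟩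
  have hb := (Function.Surjective.bijective_of_nat_card_le hs hc).1
  exact Quotient.exact (hb (a₁ := Quotient.mk r x) (a₂ := Quotient.mk r y) (Quotient.sound hxy))

lemma ker_permC (σ : Equiv.Perm (Fin k)) (x : Fin k → M) (i j : Fin k) :
    Setoid.ker (permC σ x) i j ↔ Setoid.ker x (σ i) (σ j) := Iff.rfl

lemma mapsTo_permC_distinctGe (p : ℕ) (σ : Equiv.Perm (Fin k)) :
    Set.MapsTo (permC σ) (distinctGe M k p) (distinctGe M k p) := by
  intro x hx
  refine le_trans (b := Nat.card (Quotient (Setoid.ker x))) hx (le_of_eq ?_)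
  exact Nat.card_congr (Quotient.congr σ.symm fun i j => by
    change x i = x j ↔ x (σ (σ.symm i)) = x (σ (σ.symm j))
    simp)

lemma swap_rel (r : Setoid (Fin k)) {a b : Fin k} (hab : r a b) (i : Fin k) :
    r (Equiv.swap a b i) i := by
  rcases eq_or_ne i a with rfl | ha
  · rw [Equiv.swap_apply_left]; exact r.symm hab
  · rcases eq_or_ne i b with rfl | hb
    · rw [Equiv.swap_apply_right]; exact hab
    · rw [Equiv.swap_apply_of_ne_of_ne ha hb]

lemma swap_rel_iff (r : Setoid (Fin k)) {a b : Fin k} (hab : r a b) (i j : Fin k) :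
    r (Equiv.swap a b i) (Equiv.swap a b j) ↔ r i j :=
  ⟨fun h => r.trans (r.symm (swap_rel r hab i)) (r.trans h (swap_rel r hab j)),
    fun h => r.trans (swap_rel r hab i) (r.trans h (r.symm (swap_rel r hab j)))⟩

lemma mapsTo_swap_coinLe (r : Setoid (Fin k)) {a b : Fin k} (hab : r a b) :
    Set.MapsTo (permC (Equiv.swap a b)) (coinLe M r) (coinLe M r) := fun _ hx i j h =>
  (swap_rel_iff r hab i j).1 (hx h)

lemma mapsTo_swap_coinEq (r : Setoid (Fin k)) {a b : Fin k} (hab : r a b) :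
    Set.MapsTo (permC (Equiv.swap a b)) (coinEq M r) (coinEq M r) := fun x hx => by
  ext i j
  rw [ker_permC, show Setoid.ker x = r from hx]
  exact swap_rel_iff r hab i j

lemma permC_swap_invol (a b : Fin k) : (permC (Equiv.swap a b)).comp (permC (Equiv.swap a b)) =
    ContinuousMap.id (Fin k → M) := by
  rw [permC_comp, Equiv.swap_mul_self]
  rfl

lemma mapsTo_swap_coinEq_compl (r : Setoid (Fin k)) {a b : Fin k} (hab : r a b) :
    Set.MapsTo (permC (Equiv.swap a b)) (coinEq M r)ᶜ (coinEq M r)ᶜ := fun _ hx h => hx (by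
  have := mapsTo_swap_coinEq r hab h
  rwa [← ContinuousMap.comp_apply, permC_swap_invol] at this)

lemma isOpen_coinLe [T2Space M] (r : Setoid (Fin k)) : IsOpen (coinLe M r) := by
  have : coinLe M r = ⋂ i, ⋂ j, ⋂ _ : ¬ r i j, {x | x i ≠ x j} := by
    ext x
    simp only [coinLe, Set.mem_ofPred_eq, Set.mem_iInter, Setoid.le_def]
    exact forall₂_congr fun i j => not_imp_not.symm
  rw [this]
  refine isOpen_iInter_of_finite fun i => isOpen_iInter_of_finite fun j =>
    isOpen_iInter_of_finite fun _ => (isClosed_eq (by fun_prop) (by fun_prop)).isOpen_compl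

lemma isOpen_sdiff_coinEq [T2Space M] (r : Setoid (Fin k)) {U : Set (Fin k → M)} (hU : IsOpen U)
    (hUr : U ⊆ coinLe M r) : IsOpen (U \ coinEq M r) := by
  have : U \ coinEq M r = U ∩ ⋃ i, ⋃ j, ⋃ _ : r i j, {x | x i ≠ x j} := by
    ext x
    refine and_congr_right fun hx => ?_
    have h1 := hUr hx
    simp only [Set.mem_iUnion]
    constructor
    · intro h
      by_contra! h'
      refine h (le_antisymm h1 fun i j hij => ?_)
      by_contra hne
      exact h' i j hij hne
    · rintro ⟨i, j, hij, hne⟩ h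
      have h2 : Setoid.ker x = r := h
      exact hne (show Setoid.ker x i j by rw [h2]; exact hij)
  rw [this]
  exact hU.inter (isOpen_iUnion fun i => isOpen_iUnion fun j => isOpen_iUnion fun _ =>
    (isClosed_eq (by fun_prop) (by fun_prop)).isOpen_compl)

/-- Small Euclidean neighbourhoods. -/
lemma exists_euclidean_nhd {n : ℕ} [ChartedSpace (EuclideanSpace ℝ (Fin n)) M] (p : M)
    {O : Set M} (hO : IsOpen O) (hp : p ∈ O) :
    ∃ ψ : EuclideanSpace ℝ (Fin n) → M, Topology.IsOpenEmbedding ψ ∧ p ∈ Set.range ψ ∧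
      Set.range ψ ⊆ O := by
  let e := chartAt (EuclideanSpace ℝ (Fin n)) p
  have hps : p ∈ e.source := mem_chart_source _ p
  have hopen : IsOpen (e.target ∩ e.symm ⁻¹' O) := e.isOpen_inter_preimage_symm hO
  obtain ⟨ε, hε, hball⟩ := Metric.isOpen_iff.1 hopen (e p)
    ⟨e.map_source hps, by simpa [e.left_inv hps] using hp⟩
  let b : OpenPartialHomeomorph (EuclideanSpace ℝ (Fin n)) (EuclideanSpace ℝ (Fin n)) :=
    OpenPartialHomeomorph.univBall (e p) ε
  have hbs : b.source = Set.univ := OpenPartialHomeomorph.univBall_source _ _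
  have hbt : b.target = Metric.ball (e p) ε := OpenPartialHomeomorph.univBall_target _ hε
  have hmem : ∀ y, b y ∈ Metric.ball (e p) ε := fun y => by
    rw [← hbt]; exact b.map_source (by rw [hbs]; trivial)
  have hsrc : (b.trans e.symm).source = Set.univ := by
    rw [OpenPartialHomeomorph.trans_source, hbs, Set.univ_inter, Set.eq_univ_iff_forall]
    exact fun y => (hball (hmem y)).1
  refine ⟨b.trans e.symm, (b.trans e.symm).isOpenEmbedding hsrc, ⟨0, ?_⟩, ?_⟩
  · change e.symm (b 0) = p
    rw [OpenPartialHomeomorph.univBall_apply_zero, e.left_inv hps]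
  · rintro _ ⟨y, rfl⟩
    exact (hball (hmem y)).2

lemma exists_kills_nhd [T2Space M] {n : ℕ} [ChartedSpace (EuclideanSpace ℝ (Fin n)) M]
    (hn : Odd n) (r : Setoid (Fin k)) {a b : Fin k} (hne : a ≠ b) (hab : r a b)
    {W : Set (Fin k → M)} (hW : IsOpen W) {x : Fin k → M} (hx : x ∈ W)
    (hxr : x ∈ coinEq M r) :
    ∃ V, IsOpen V ∧ V ⊆ W ∧ Set.MapsTo (permC (Equiv.swap a b)) V V ∧ x ∈ V ∧
      ∀ d, Kills (permC (Equiv.swap a b)) (coinEq M r) d V := by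
  have hker : Setoid.ker x = r := hxr
  obtain ⟨U, hU, hUd⟩ := (Set.finite_range x).t2_separation
  obtain ⟨u, hu, huW⟩ := isOpen_pi_iff'.1 hW x hx
  have key : ∀ p : M, ∃ ψ : EuclideanSpace ℝ (Fin n) → M, Topology.IsOpenEmbedding ψ ∧
      p ∈ Set.range ψ ∧ Set.range ψ ⊆ U p ∩ ⋂ i, ⋂ _ : x i = p, u i := fun p =>
    exists_euclidean_nhd p ((hU p).2.inter (isOpen_iInter_of_finite fun i =>
      isOpen_iInter_of_finite fun _ => (hu i).1)) ⟨(hU p).1, by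
        simp only [Set.mem_iInter]
        rintro i rfl
        exact (hu i).2⟩
  choose ψ hψ hpψ hψU using key
  let φ : C(Fin k → EuclideanSpace ℝ (Fin n), Fin k → M) :=
    ⟨Pi.map fun i => ψ (x i), Continuous.piMap fun i => (hψ (x i)).continuous⟩
  have hφ : Topology.IsEmbedding φ := Topology.IsEmbedding.piMap fun i => (hψ (x i)).isEmbedding
  have hrange : Set.range φ = Set.pi Set.univ fun i => Set.range (ψ (x i)) := Set.range_piMap _
  have hab' : x a = x b := by
    have : Setoid.ker x a b := by rw [hker]; exact hab
    exact this
  have hsw : ∀ i, x (Equiv.swap a b i) = x i := fun i => by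
    have : Setoid.ker x (Equiv.swap a b i) i := by rw [hker]; exact swap_rel r hab i
    exact this
  have hT : (permC (Equiv.swap a b)).comp φ = φ.comp (swapOn a b Finset.univ) := by
    ext y i
    change ψ (x (Equiv.swap a b i)) (y (Equiv.swap a b i)) = ψ (x i) _
    rw [hsw]
    congr 1
    ext j
    simp [swapOn]
  refine ⟨Set.range φ, ?_, ?_, ?_, ?_, fun d => ?_⟩
  · rw [hrange]
    exact isOpen_set_pi Set.finite_univ fun i _ => (hψ (x i)).isOpen_range
  · rw [hrange]
    refine Set.Subset.trans (b := Set.univ.pi u) ?_ huW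
    intro y hy i _
    have := (hψU (x i) (hy i trivial)).2
    simp only [Set.mem_iInter] at this
    exact this i rfl
  · rintro _ ⟨y, rfl⟩
    exact ⟨swapOn a b Finset.univ y, (DFunLike.congr_fun hT y).symm⟩
  · rw [hrange]
    exact fun i _ => hpψ (x i)
  · refine kills_of_embedding hφ hT (L := (diagSub (n := n) r : Set _)) ?_ ?_ d
    · ext y
      have hφy : ∀ i j, Setoid.ker (φ y) i j → r i j := by
        intro i j hij
        have hij' : ψ (x i) (y i) = ψ (x j) (y j) := hij
        rw [← hker]
        by_contra hne'
        refine Set.disjoint_left.1 (hUd ⟨i, rfl⟩ ⟨j, rfl⟩ hne')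
          (hψU (x i) ⟨y i, rfl⟩).1 ?_
        rw [hij']
        exact (hψU (x j) ⟨y j, rfl⟩).1
      have hx' : ∀ i j, r i j → x i = x j := fun i j hij => by
        rw [← hker] at hij; exact hij
      constructor
      · intro hy i j hij
        have h2 : Setoid.ker (φ y) i j := by
          rw [show Setoid.ker (φ y) = r from hy]; exact hij
        have h3 : ψ (x i) (y i) = ψ (x j) (y j) := h2
        rw [hx' i j hij] at h3
        exact (hψ (x j)).injective h3
      · intro hy
        refine le_antisymm (fun i j h => hφy i j h) fun i j hij => ?_
        change ψ (x i) (y i) = ψ (x j) (y j)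
        rw [hx' i j hij, hy i j hij]
    · have := actsAs_swapOn (n := n) r hne hab Finset.univ
      rwa [Finset.card_univ, Fintype.card_fin, hn.neg_one_pow] at this

lemma kills_coinLe [T2Space M] {n : ℕ} [ChartedSpace (EuclideanSpace ℝ (Fin n)) M]
    (hn : Odd n) (r : Setoid (Fin k)) {a b : Fin k} (hne : a ≠ b) (hab : r a b) (d : ℕ) :
    Kills (permC (Equiv.swap a b)) (coinEq M r) d (coinLe M r) := by
  refine kills_of_basis (permC_swap_invol a b) (mapsTo_swap_coinEq_compl r hab)
    (fun U => isOpen_sdiff_coinEq r) (fun W hW hWr hτ x hx => ?_) d _ (isOpen_coinLe r) le_rfl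
    (mapsTo_swap_coinLe r hab)
  by_cases hxr : x ∈ coinEq M r
  · exact exists_kills_nhd hn r hne hab hW hx hxr
  · have hτ' : Set.MapsTo (permC (Equiv.swap a b)) (W \ coinEq M r) (W \ coinEq M r) :=
      fun y hy => ⟨hτ hy.1, mapsTo_swap_coinEq_compl r hab hy.2⟩
    refine ⟨W \ coinEq M r, isOpen_sdiff_coinEq r hW hWr, Set.sdiff_subset, hτ', ⟨hx, hxr⟩, ?_⟩
    intro d z hz _ _
    refine ⟨0, zero_mem _, ?_⟩
    rw [map_zero, sub_zero, sdiff_idem]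
    exact symOp_mem hτ' hz

/-- Pushing invariant relative cycles off one stratum. -/
lemma exists_pushoff [T2Space M] {n : ℕ} [ChartedSpace (EuclideanSpace ℝ (Fin n)) M]
    (hn : Odd n) {p : ℕ} (hp : p < k) (s : Set (Setoid (Fin k)))
    (hs : ∀ r ∈ s, Nat.card (Quotient r) = p) (z : Ch (Fin k → M))
    (hz : z ∈ CA (distinctGe M k (p + 1) ∪ ⋃ r ∈ s, coinLe M r))
    (hb : bdy z ∈ CA (distinctGe M k (p + 1))) :
    ∃ w v, v ∈ CA (distinctGe M k (p + 1)) ∧ symE z = bdy w + v := by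
  classical
  have hfin : Finite (Setoid (Fin k)) :=
    Finite.of_injective (fun r : Setoid (Fin k) => (fun i j => r i j : Fin k → Fin k → Prop))
      fun r s h => Setoid.ext fun i j => by rw [show r i j = s i j from congrFun₂ h i j]
  induction s, Set.toFinite s using Set.Finite.induction_on generalizing z with
  | empty =>
    refine ⟨0, symE z, symE_mem (mapsTo_permC_distinctGe _) ?_, by simp⟩
    simpa using hz
  | @insert r s hrs _ ih =>
    have hrc := hs r (Set.mem_insert r s)
    have hdopen : IsOpen (distinctGe M k (p + 1)) := by
      have : distinctGe M k (p + 1) = ⋃ r : {r : Setoid (Fin k) // p + 1 ≤ Nat.card (Quotient r)},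
          coinLe M r.1 := by
        ext x
        rw [Set.mem_iUnion]
        exact ⟨fun h => ⟨⟨_, h⟩, le_refl (Setoid.ker x)⟩,
          fun ⟨r, hr⟩ => r.2.trans (card_quotient_le hr)⟩
      rw [this]
      exact isOpen_iUnion fun r => isOpen_coinLe _
    have hUo : IsOpen (distinctGe M k (p + 1) ∪ ⋃ r ∈ s, coinLe M r) :=
      hdopen.union (isOpen_biUnion fun r _ => isOpen_coinLe r)
    have hoff : coinLe M r \ coinEq M r ⊆ distinctGe M k (p + 1) := by
      rintro x ⟨h1, h2⟩
      have := card_quotient_le h1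
      rw [hrc] at this
      refine Nat.lt_of_le_of_ne this fun h => h2 (eq_of_card_quotient_le h1 ?_)
      rw [hrc, h]
    have hinter : (distinctGe M k (p + 1) ∪ ⋃ r ∈ s, coinLe M r) ∩ coinLe M r ⊆
        coinLe M r \ coinEq M r := by
      rintro x ⟨h1, h2⟩
      refine ⟨h2, fun h3 => ?_⟩
      have h3 : Setoid.ker x = r := h3
      rcases h1 with h1 | h1
      · have h1 : p + 1 ≤ Nat.card (Quotient (Setoid.ker x)) := h1
        rw [h3, hrc] at h1
        omega
      · simp only [Set.mem_iUnion] at h1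
        obtain ⟨r', hr', h4⟩ := h1
        have h4 : Setoid.ker x ≤ r' := h4
        rw [h3] at h4
        have := eq_of_card_quotient_le h4 (by rw [hrc, hs r' (Set.mem_insert_of_mem _ hr')])
        exact hrs (this ▸ hr')
    obtain ⟨i, j, hij, hrij⟩ : ∃ i j, i ≠ j ∧ r i j := by
      by_contra! h
      have : Function.Injective (Quotient.mk r) := fun i j hij => by
        by_contra hne
        exact h i j hne (Quotient.exact hij)
      have := Nat.card_le_card_of_injective _ this
      rw [hrc, Nat.card_eq_fintype_card, Fintype.card_fin] at this
      omega
    rw [Set.biUnion_insert, Set.union_left_comm, Set.union_comm] at hz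
    obtain ⟨S, T, hS, hT, hST, hSb, -, a, b, hab, ha, hbb, -⟩ :=
      subdivide_two hUo (isOpen_coinLe r) hz
    have hSz := hS _ _ hb
    rw [← hSb, hab, map_add] at hSz
    have hbN : bdy b ∈ CA (coinLe M r \ coinEq M r) := by
      refine CA_mono hinter (mem_CA_inter ?_ (bdy_mem hbb))
      have := sub_mem (CA_mono Set.subset_union_left hSz) (bdy_mem ha)
      rwa [add_sub_cancel_left] at this
    have haN : bdy a ∈ CA (distinctGe M k (p + 1)) := by
      have := sub_mem hSz (CA_mono hoff hbN)
      rwa [add_sub_cancel_right] at this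
    obtain ⟨w1, v1, hv1, e1⟩ := ih (fun r hr => hs r (Set.mem_insert_of_mem _ hr)) a ha haN
    have hmax : ∃ d, b ∈ dgs {m | m < d} := by
      refine ⟨b.support.sup (fun s => s.1 + 1), fun s hs => ?_⟩
      exact Nat.lt_of_succ_le
        (Finset.le_sup (f := fun s : Σ n : ℕ, C(Dl n, Fin k → M) => s.1 + 1) hs)
    obtain ⟨d, hd⟩ := hmax
    obtain ⟨w2, -, hw2⟩ := kills_coinLe hn r hij hrij d b hbb hd hbN
    set v2 := symOp (permC (Equiv.swap i j)) b - bdy w2 with hv2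
    have e2 : symE b = bdy ((2⁻¹ : ℚ) • symE w2) + (2⁻¹ : ℚ) • symE v2 := by
      rw [hv2, map_sub, symE_symOp, map_smul, symE_bdy, ← smul_add, add_sub_cancel, smul_smul,
        inv_mul_cancel₀ two_ne_zero, one_smul]
    have hSE : z = S z + bdy (T z) + T (bdy z) := by
      rw [add_assoc, hST]; abel
    refine ⟨w1 + (2⁻¹ : ℚ) • symE w2 + symE (T z),
      v1 + (2⁻¹ : ℚ) • symE v2 + symE (T (bdy z)), ?_, ?_⟩
    · exact add_mem (add_mem hv1 (Submodule.smul_mem _ _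
        (symE_mem (mapsTo_permC_distinctGe _) (CA_mono hoff hw2))))
        (symE_mem (mapsTo_permC_distinctGe _) (hT _ _ hb))
    · nth_rewrite 1 [hSE]
      rw [map_add, map_add, hab, map_add, e1, e2, ← symE_bdy, map_add bdy, map_add bdy]
      abel

/-- Symmetrized relative cycles of `(M ^ k, F_k M)` are trivial in odd dimensions. -/
theorem exists_injective_rep [T2Space M] {n : ℕ} [ChartedSpace (EuclideanSpace ℝ (Fin n)) M]
    (hn : Odd n) (z : Ch (Fin k → M)) (hb : bdy z ∈ CA {x | Function.Injective x}) :
    ∃ w v, v ∈ CA {x : Fin k → M | Function.Injective x} ∧ symE z = bdy w + v := by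
  have hinj : {x : Fin k → M | Function.Injective x} = distinctGe M k k := by
    ext x
    have e : Nat.card (Fin k) = k := by simp
    constructor
    · intro h
      have : Function.Injective (Quotient.mk (Setoid.ker x)) := fun i j hij =>
        h (Quotient.exact hij)
      have := Nat.card_le_card_of_injective _ this
      rwa [e] at this
    · intro h i j hij
      have hs : Function.Surjective (Quotient.mk (Setoid.ker x)) := Quotient.mk_surjective
      have h : k ≤ _ := h
      exact (Function.Surjective.bijective_of_nat_card_le hs (e.le.trans h)).1 (Quotient.sound hij)
  rw [hinj] at hb ⊢
  have main : ∀ q ≤ k, ∀ z : Ch (Fin k → M), z ∈ CA (distinctGe M k (k - q)) →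
      bdy z ∈ CA (distinctGe M k k) → ∃ w v, v ∈ CA (distinctGe M k k) ∧ symE z = bdy w + v := by
    intro q
    induction q with
    | zero =>
      intro _ z hz _
      exact ⟨0, symE z, symE_mem (mapsTo_permC_distinctGe _) hz, by simp⟩
    | succ q ih =>
      intro hq z hz hb
      have hmono : distinctGe M k k ⊆ distinctGe M k (k - (q + 1) + 1) := fun x hx =>
        (show k - (q + 1) + 1 ≤ k by omega).trans hx
      obtain ⟨w1, v1, hv1, e1⟩ := exists_pushoff hn (p := k - (q + 1)) (by omega)
        {r | Nat.card (Quotient r) = k - (q + 1)} (fun r hr => hr) z (by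
          refine CA_mono (fun x hx => ?_) hz
          rcases Nat.eq_or_lt_of_le hx with h | h
          · right
            simp only [Set.mem_iUnion]
            exact ⟨Setoid.ker x, h.symm, le_refl (Setoid.ker x)⟩
          · exact Or.inl h) (CA_mono hmono hb)
      have ev : bdy v1 = symE (bdy z) := by
        rw [← symE_bdy, e1, map_add, bdy_bdy, zero_add]
      obtain ⟨w2, v2, hv2, e2⟩ := ih (by omega) v1
        (by rwa [show k - (q + 1) + 1 = k - q by omega] at hv1)
        (by rw [ev]; exact symE_mem (mapsTo_permC_distinctGe _) hb)
      have hf : (k.factorial : ℚ) ≠ 0 := by exact_mod_cast k.factorial_ne_zero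
      refine ⟨(k.factorial : ℚ)⁻¹ • (symE w1 + w2), (k.factorial : ℚ)⁻¹ • v2,
        Submodule.smul_mem _ _ hv2, ?_⟩
      have := symE_symE z
      rw [e1, map_add, ← symE_bdy, e2] at this
      rw [map_smul, ← smul_add, map_add, add_assoc, this, ← e1, smul_smul, inv_mul_cancel₀ hf,
        one_smul]
  exact main k le_rfl z (fun s _ => by
    rintro _ ⟨t, rfl⟩; simp [distinctGe]) hb

end Config

section Covering

variable {M : Type} [TopologicalSpace M] {k : ℕ}

instance permAction : MulAction (Equiv.Perm (Fin k)) (orderedConfig M k) where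
  smul σ f := ⟨f.1 ∘ (σ⁻¹ : Equiv.Perm (Fin k)), f.2.comp (σ⁻¹ : Equiv.Perm (Fin k)).injective⟩
  one_smul _ := rfl
  mul_smul σ τ f := Subtype.ext (by
    change f.1 ∘ ((σ * τ)⁻¹ : Equiv.Perm (Fin k)) = (f.1 ∘ (τ⁻¹ : Equiv.Perm (Fin k))) ∘ _
    rw [mul_inv_rev]; rfl)

lemma smul_val (σ : Equiv.Perm (Fin k)) (f : orderedConfig M k) :
    (σ • f).1 = f.1 ∘ (σ⁻¹ : Equiv.Perm (Fin k)) := rfl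

def toUnordered (f : orderedConfig M k) : unorderedConfig M k := Quot.mk _ f

lemma toUnordered_eq_iff {f g : orderedConfig M k} :
    toUnordered f = toUnordered g ↔ ∃ σ : Equiv.Perm (Fin k), g.1 = f.1 ∘ σ := by
  refine ⟨fun h => ?_, fun h => Quot.sound h⟩
  have := Quot.eqvGen_exact h
  clear h
  induction this with
  | rel _ _ h' => exact h'
  | refl _ => exact ⟨1, rfl⟩
  | symm _ _ _ ih =>
    obtain ⟨σ, hσ⟩ := ih
    exact ⟨σ⁻¹, by rw [hσ]; ext i; simp⟩
  | trans _ _ _ h1 h2 ih1 ih2 =>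
    obtain ⟨σ, hσ⟩ := ih1
    obtain ⟨τ, hτ⟩ := ih2
    exact ⟨σ * τ, by rw [hτ, hσ]; rfl⟩

lemma isQuotientCoveringMap_toUnordered [T2Space M] :
    IsQuotientCoveringMap (toUnordered (M := M) (k := k)) (Equiv.Perm (Fin k)) where
  toIsQuotientMap := isQuotientMap_quot_mk
  continuous_const_smul σ := Continuous.subtype_mk
    ((permC (σ⁻¹)).continuous.comp continuous_subtype_val) _
  apply_eq_iff_mem_orbit {f g} := by
    rw [eq_comm, toUnordered_eq_iff]
    constructor
    · rintro ⟨σ, h⟩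
      exact ⟨σ⁻¹, Subtype.ext (by simp [smul_val, h])⟩
    · rintro ⟨σ, h⟩
      exact ⟨σ⁻¹, by rw [← h]; rfl⟩
  disjoint f := by
    obtain ⟨V, hV, hd⟩ := Set.Finite.t2_separation (Set.finite_range f.1)
    refine ⟨{g | ∀ i, g.1 i ∈ V (f.1 i)}, ?_, ?_⟩
    · refine IsOpen.mem_nhds ?_ fun i => (hV _).1
      simp only [Set.ofPred_forall]
      refine isOpen_iInter_of_finite fun i => (hV _).2.preimage ?_
      exact (continuous_apply i).comp continuous_subtype_val
    · rintro σ ⟨_, ⟨g, hg, rfl⟩, hg'⟩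
      have : σ⁻¹ = 1 := by
        ext1 i
        by_contra hne
        have hne' : f.1 (σ⁻¹ i) ≠ f.1 i := fun h => hne (f.2 h)
        exact Set.disjoint_left.1 (hd ⟨_, rfl⟩ ⟨_, rfl⟩ hne') (hg (σ⁻¹ i)) (hg' i)
      simpa using this

instance (n : ℕ) : LocallyPathConnectedSpace (Dl n) :=
  (convex_stdSimplex ℝ (Fin (n + 1))).locallyPathConnectedSpace

instance (n : ℕ) : ContractibleSpace (Dl n) :=
  (convex_stdSimplex ℝ (Fin (n + 1))).contractibleSpace ⟨_, (stdSimplex.vertex 0 : Dl n).2⟩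

variable (M k) in
def configIncl : C(orderedConfig M k, Fin k → M) := ⟨Subtype.val, continuous_subtype_val⟩

variable (M k) in
def configQuot : C(orderedConfig M k, unorderedConfig M k) := ⟨toUnordered, continuous_quot_mk⟩

lemma isEmbedding_configIncl : Topology.IsEmbedding (configIncl M k) :=
  Topology.IsEmbedding.subtypeVal

lemma range_configIncl : Set.range (configIncl M k) = {x | Function.Injective x} :=
  Subtype.range_val

def permF (σ : Equiv.Perm (Fin k)) : C(orderedConfig M k, orderedConfig M k) :=
  ⟨fun f => ⟨f.1 ∘ σ, f.2.comp σ.injective⟩, Continuous.subtype_mk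
    ((permC σ).continuous.comp continuous_subtype_val) _⟩

lemma configIncl_permF (σ : Equiv.Perm (Fin k)) :
    (configIncl M k).comp (permF σ) = (permC σ).comp (configIncl M k) := rfl

lemma configQuot_permF (σ : Equiv.Perm (Fin k)) :
    (configQuot M k).comp (permF σ) = configQuot M k := by
  ext f
  exact (toUnordered_eq_iff.2 ⟨σ, rfl⟩).symm

lemma exists_push_configIncl {v : Ch (Fin k → M)} (hv : v ∈ CA {x | Function.Injective x}) :
    ∃ v' : Ch (orderedConfig M k), push (configIncl M k) v' = v :=
  exists_push_eq isEmbedding_configIncl (by rwa [range_configIncl])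

lemma push_mem_injective (c : Ch (orderedConfig M k)) :
    push (configIncl M k) c ∈ CA {x | Function.Injective x} := by
  rw [← range_configIncl]; exact push_mem_range subset_rfl _

variable [T2Space M]

lemma exists_lift {n : ℕ} (σ : C(Dl n, unorderedConfig M k)) :
    ∃ F : C(Dl n, orderedConfig M k), (configQuot M k).comp F = σ := by
  obtain ⟨e, he⟩ := Quot.exists_rep (σ (stdSimplex.vertex 0))
  obtain ⟨F, ⟨-, hF⟩, -⟩ := (isQuotientCoveringMap_toUnordered (M := M)
    (k := k)).isCoveringMap.existsUnique_continuousMap_lifts σ (stdSimplex.vertex 0) e he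
  exact ⟨F, ContinuousMap.ext fun x => congrFun hF x⟩

lemma lift_unique {n : ℕ} {F G : C(Dl n, orderedConfig M k)}
    (h : (configQuot M k).comp F = (configQuot M k).comp G) :
    ∃ σ : Equiv.Perm (Fin k), G = (permF σ).comp F := by
  have h0 := DFunLike.congr_fun h (stdSimplex.vertex 0)
  obtain ⟨σ, hσ⟩ := toUnordered_eq_iff.1 h0
  refine ⟨σ, DFunLike.coe_injective ?_⟩
  refine (isQuotientCoveringMap_toUnordered (M := M) (k := k)).isCoveringMap.eq_of_comp_eq
    G.continuous ((permF σ).comp F).continuous ?_ (stdSimplex.vertex 0) (Subtype.ext hσ)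
  have := congrArg (fun f : C(orderedConfig M k, unorderedConfig M k) => f.comp F)
    (configQuot_permF σ)
  exact congrArg DFunLike.coe (h.symm.trans this.symm)

lemma push_configQuot_surjective : Function.Surjective (push (configQuot M k)) := by
  rw [← LinearMap.range_eq_top, eq_top_iff]
  intro c _
  induction c using Finsupp.induction_linear with
  | zero => exact zero_mem _
  | add a b ha hb => exact add_mem (ha trivial) (hb trivial)
  | single s a =>
    obtain ⟨F, hF⟩ := exists_lift s.2
    refine ⟨a • gen F, ?_⟩
    rw [map_smul, push_gen, hF, gen]
    simp

variable (M k) in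
/-- The chain-level transfer of the covering from ordered to unordered configurations,
followed by the inclusion into the Cartesian power. -/
noncomputable def transfer : Ch (unorderedConfig M k) →ₗ[ℚ] Ch (Fin k → M) :=
  Finsupp.lift (Ch (Fin k → M)) ℚ _ fun s =>
    symE (push (configIncl M k) (gen (exists_lift s.2).choose))

lemma transfer_push (c : Ch (orderedConfig M k)) :
    transfer M k (push (configQuot M k) c) = symE (push (configIncl M k) c) := by
  suffices transfer M k ∘ₗ push (configQuot M k) = symE ∘ₗ push (configIncl M k) from
    LinearMap.congr_fun this c
  refine ch_hom_ext fun n F => ?_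
  obtain ⟨σ, hσ⟩ := lift_unique (exists_lift ((configQuot M k).comp F)).choose_spec.symm
  have e : transfer M k (gen ((configQuot M k).comp F)) =
      symE (push (configIncl M k) (gen (exists_lift ((configQuot M k).comp F)).choose)) := by
    simp [transfer, gen]
  rw [LinearMap.comp_apply, push_gen, e, hσ, ← push_gen, push_push, configIncl_permF, ← push_push,
    symE_push]
  rfl

lemma transfer_bdy (c : Ch (unorderedConfig M k)) :
    bdy (transfer M k c) = transfer M k (bdy c) := by
  obtain ⟨c, rfl⟩ := push_configQuot_surjective c
  rw [transfer_push, symE_bdy, bdy_push, ← transfer_push, bdy_push]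

lemma symE_transfer (c : Ch (unorderedConfig M k)) :
    symE (transfer M k c) = (k.factorial : ℚ) • transfer M k c := by
  obtain ⟨c, rfl⟩ := push_configQuot_surjective c
  rw [transfer_push, symE_symE]

theorem exists_bdy_of_transfer {n : ℕ} [ChartedSpace (EuclideanSpace ℝ (Fin n)) M] (hn : Odd n)
    {c : Ch (unorderedConfig M k)} {w : Ch (Fin k → M)} (h : transfer M k c = bdy w) :
    ∃ u, c = bdy u := by
  obtain ⟨c, rfl⟩ := push_configQuot_surjective c
  rw [transfer_push] at h
  have e : symE (push (configIncl M k) c) =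
      push (configIncl M k) (∑ σ, push (permF σ) c) := by
    simp only [symE_apply, map_sum, push_push, configIncl_permF]
  obtain ⟨w', v, hv, hw⟩ := exists_injective_rep hn w (by
    rw [← h, e]; exact push_mem_injective _)
  obtain ⟨v, rfl⟩ := exists_push_configIncl hv
  have h1 : (k.factorial : ℚ) • push (configIncl M k) (∑ σ, push (permF σ) c) =
      push (configIncl M k) (bdy v) := by
    rw [← e, ← symE_symE, h, ← symE_bdy, hw, map_add, bdy_bdy, zero_add, bdy_push]
  rw [← map_smul] at h1
  have h2 := congrArg (push (configQuot M k)) (push_injective isEmbedding_configIncl.injective h1)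
  simp only [map_smul, map_sum, push_push, configQuot_permF, Finset.sum_const, Finset.card_univ,
    Fintype.card_perm, Fintype.card_fin, ← bdy_push, ← Nat.cast_smul_eq_nsmul ℚ, smul_smul] at h2
  have h0 : (k.factorial : ℚ) ≠ 0 := by positivity
  exact ⟨((k.factorial : ℚ) * k.factorial)⁻¹ • push (configQuot M k) v, by
    rw [map_smul, ← h2, smul_smul, inv_mul_cancel₀ (mul_ne_zero h0 h0), one_smul]⟩

theorem exists_transfer_rep {n : ℕ} [ChartedSpace (EuclideanSpace ℝ (Fin n)) M] (hn : Odd n)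
    {z : Ch (Fin k → M)} (hz : bdy z = 0) :
    ∃ y w, bdy y = 0 ∧ symE z = transfer M k y + bdy w := by
  obtain ⟨w, v, hv, hw⟩ := exists_injective_rep hn z (by rw [hz]; exact zero_mem _)
  obtain ⟨v, rfl⟩ := exists_push_configIncl hv
  have hb : bdy v = 0 := push_injective isEmbedding_configIncl.injective (by
    have := congrArg bdy hw
    rwa [symE_bdy, hz, map_add, bdy_bdy, zero_add, map_zero, bdy_push, eq_comm,
      ← map_zero (push (configIncl M k))] at this)
  have h0 : (k.factorial : ℚ) ≠ 0 := by positivity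
  refine ⟨(k.factorial : ℚ)⁻¹ • push (configQuot M k) v, (k.factorial : ℚ)⁻¹ • symE w, ?_, ?_⟩
  · rw [map_smul, bdy_push, hb, map_zero, smul_zero]
  · rw [map_smul, map_smul, transfer_push, ← smul_add, symE_bdy, ← map_add, add_comm, ← hw,
      symE_symE, smul_smul, inv_mul_cancel₀ h0, one_smul]

end Covering

section Degree

variable {X Y : Type} [TopologicalSpace X] [TopologicalSpace Y]

/-- The projection of a chain to its part of degree `i`. -/
noncomputable def degPart (i : ℕ) : Ch X →ₗ[ℚ] Ch X :=
  Finsupp.lift (Ch X) ℚ _ fun s => if s.1 = i then gen s.2 else 0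

lemma degPart_gen (i : ℕ) {n : ℕ} (σ : C(Dl n, X)) :
    degPart i (gen σ) = if n = i then gen σ else 0 := by
  simp [degPart, gen]

lemma degPart_push (i : ℕ) (f : C(X, Y)) (c : Ch X) :
    degPart i (push f c) = push f (degPart i c) := by
  suffices degPart i ∘ₗ push f = push f ∘ₗ degPart i from LinearMap.congr_fun this c
  refine ch_hom_ext fun n σ => ?_
  simp only [LinearMap.comp_apply, push_gen, degPart_gen]
  split_ifs <;> simp [push_gen]

lemma degPart_bdy (i : ℕ) (c : Ch X) : degPart i (bdy c) = bdy (degPart (i + 1) c) := by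
  suffices degPart i ∘ₗ bdy = bdy ∘ₗ degPart (X := X) (i + 1) from LinearMap.congr_fun this c
  refine ch_hom_ext fun n σ => ?_
  simp only [LinearMap.comp_apply, degPart_gen]
  cases n with
  | zero => simp [bdy_gen_zero]
  | succ n =>
    rw [bdy_gen_succ]
    simp only [map_sum, map_smul, degPart_gen, add_left_inj]
    split_ifs <;> simp [bdy_gen_succ]

lemma bdy_degPart_zero (c : Ch X) : bdy (degPart 0 c) = 0 := by
  suffices bdy ∘ₗ degPart (X := X) 0 = 0 from LinearMap.congr_fun this c
  refine ch_hom_ext fun n σ => ?_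
  simp only [LinearMap.comp_apply, degPart_gen, LinearMap.zero_apply]
  split_ifs with h
  · subst h; exact bdy_gen_zero _
  · simp

lemma degPart_of_mem {i : ℕ} {c : Ch X} (hc : c ∈ dgs {i}) : degPart i c = c := by
  have := map_mem_of_gen (degPart (X := X) i - LinearMap.id) ⊥ (fun n σ (hσ : n = i) => by
    simp [degPart_gen, hσ]) hc
  simpa [sub_eq_zero] using this

lemma degPart_mem (i : ℕ) (c : Ch X) : degPart i c ∈ dgs {i} := by
  refine map_mem_of_gen (R := Set.univ) _ _ (fun n σ _ => ?_) (by simp [spt])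
  rw [degPart_gen]
  split_ifs with h
  · exact gen_mem_spt h
  · exact zero_mem _

lemma degPart_symE {k : ℕ} (i : ℕ) (c : Ch (Fin k → X)) :
    degPart i (symE c) = symE (degPart i c) := by
  simp only [symE_apply, map_sum, degPart_push]

lemma degPart_transfer [T2Space X] {k : ℕ} (i : ℕ) (c : Ch (unorderedConfig X k)) :
    degPart i (transfer X k c) = transfer X k (degPart i c) := by
  obtain ⟨c, rfl⟩ := push_configQuot_surjective c
  rw [transfer_push, degPart_symE, degPart_push, ← transfer_push, degPart_push]

end Degree
section Vanishing

variable {X Y : Type} [TopologicalSpace X] [TopologicalSpace Y]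

/-- The cycles of degree at least `d` in `U` bound in `U`. -/
def VanishesFrom (d : ℕ) (U : Set X) : Prop :=
  ∀ z ∈ CA U, z ∈ dgs {n | d ≤ n} → bdy z = 0 → ∃ w ∈ CA U, bdy w = z

lemma VanishesFrom.mono {d d' : ℕ} (h : d ≤ d') {U : Set X} (hU : VanishesFrom d U) :
    VanishesFrom d' U := fun z hz hd hb =>
  hU z hz (Finsupp.supported_mono (fun _ (hs : d' ≤ _) => h.trans hs) hd) hb

lemma exists_bounded_of_bdy_mem {d : ℕ} {U : Set X} {w : Ch X} (hw : w ∈ CA U)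
    (hz : bdy w ∈ dgs {n | d ≤ n}) :
    ∃ w' ∈ CA U, w' ∈ dgs {n | d + 1 ≤ n} ∧ bdy w' = bdy w := by
  obtain ⟨a, b, rfl, ha, hb, hR⟩ := exists_split (P := {s : Σ n : ℕ, C(Dl n, X) | s.1 < d + 1})
    (Q := {s | d + 1 ≤ s.1}) (c := w) (fun s _ => lt_or_ge s.1 (d + 1))
  refine ⟨b, (hR _ hw).2, hb, ?_⟩
  have h1 : bdy a ∈ dgs {n | n < d} := bdy_dgs_succ (D := {n | n < d + 1}) (D' := {n | n < d})
    (fun n hn => Nat.lt_of_succ_lt_succ hn) ha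
  have h2 : bdy b ∈ dgs {n | d ≤ n} := bdy_dgs_succ (D := {n | d + 1 ≤ n}) (D' := {n | d ≤ n})
    (fun n hn => Nat.le_of_succ_le_succ hn) hb
  have h3 : bdy a ∈ dgs {n | d ≤ n} := by
    rw [map_add] at hz
    simpa using sub_mem hz h2
  have h4 : bdy a = 0 := by
    rw [← Finsupp.support_eq_empty, Finset.eq_empty_iff_forall_notMem]
    intro s hs
    exact absurd (h3 hs) (Nat.not_le.2 (h1 hs))
  rw [map_add, h4, zero_add]

lemma dgs_pred {d : ℕ} {c : Ch X} (hc : c ∈ dgs {n | d + 1 ≤ n}) : bdy c ∈ dgs {n | d ≤ n} :=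
  bdy_dgs_succ (D := {n | d + 1 ≤ n}) (D' := {n | d ≤ n}) (fun _ hn => Nat.le_of_succ_le_succ hn) hc

lemma VanishesFrom.exists_bounded {d : ℕ} {U : Set X} (h : VanishesFrom d U) {z : Ch X}
    (hz : z ∈ CA U) (hd : z ∈ dgs {n | d ≤ n}) (hb : bdy z = 0) :
    ∃ w ∈ CA U, w ∈ dgs {n | d + 1 ≤ n} ∧ bdy w = z := by
  obtain ⟨w, hw, rfl⟩ := h z hz hd hb
  exact exists_bounded_of_bdy_mem hw hd

lemma VanishesFrom.union {d : ℕ} {U V : Set X} (hU : IsOpen U) (hV : IsOpen V)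
    (h1 : VanishesFrom d (U ∩ V)) (h2 : VanishesFrom (d + 1) U) (h3 : VanishesFrom (d + 1) V) :
    VanishesFrom (d + 1) (U ∪ V) := by
  intro z hz hd hb
  obtain ⟨S, T, hS, hT, hST, hSb, hSd, a, b, hab, ha, hbV, hR⟩ := subdivide_two hU hV hz
  have hsum : bdy a + bdy b = 0 := by rw [← map_add, ← hab, hSb, hb, map_zero]
  obtain ⟨had, hbd⟩ := hR _ (hSd _ _ hd)
  obtain ⟨g, hg, hgd, hga⟩ := h1.exists_bounded (z := bdy a)
    (mem_CA_inter (bdy_mem ha) (by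
      rw [eq_neg_of_add_eq_zero_left hsum]; exact neg_mem (bdy_mem hbV)))
    (dgs_pred had) (bdy_bdy _)
  obtain ⟨p, hp, hpa⟩ := h2 (a - g) (sub_mem ha (CA_mono Set.inter_subset_left hg))
    (sub_mem had hgd) (by rw [map_sub, hga, sub_self])
  obtain ⟨q, hq, hqb⟩ := h3 (b + g) (add_mem hbV (CA_mono Set.inter_subset_right hg))
    (add_mem hbd hgd) (by rw [map_add, hga, add_comm, hsum])
  refine ⟨p + q + T z, add_mem (add_mem (CA_mono Set.subset_union_left hp)
    (CA_mono Set.subset_union_right hq)) (hT _ _ hz), ?_⟩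
  have := hST z
  rw [hb, map_zero, add_zero, hab] at this
  rw [map_add, map_add, hpa, hqb, this]
  abel

lemma exists_split_disjoint {U V : Set X} (hU : IsOpen U) (hV : IsOpen V) (hd : Disjoint U V)
    {c : Ch X} (hc : c ∈ CA (U ∪ V)) : ∃ a b : Ch X, c = a + b ∧ a ∈ CA U ∧ b ∈ CA V ∧
      ∀ R, c ∈ spt R → a ∈ spt R ∧ b ∈ spt R := by
  refine exists_split (Finsupp.supported_mono ?_ hc)
  intro s hs
  have : IsPreconnected (Set.range s.2) := by
    rw [← Set.image_univ]
    exact isPreconnected_univ.image _ s.2.continuous.continuousOn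
  exact this.subset_or_subset hU hV hd hs

lemma VanishesFrom.disjoint_union {d : ℕ} {U V : Set X} (hU : IsOpen U) (hV : IsOpen V)
    (hd : Disjoint U V) (h1 : VanishesFrom d U) (h2 : VanishesFrom d V) :
    VanishesFrom d (U ∪ V) := by
  intro z hz hzd hb
  obtain ⟨a, b, rfl, ha, hbV, hR⟩ := exists_split_disjoint hU hV hd hz
  have e := hb
  rw [map_add] at e
  have ha0 : bdy a = 0 := CA_empty (by
    rw [← hd.inter_eq]
    refine mem_CA_inter (bdy_mem ha) ?_
    rw [eq_neg_of_add_eq_zero_left e]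
    exact neg_mem (bdy_mem hbV))
  rw [ha0, zero_add] at e
  obtain ⟨p, hp, rfl⟩ := h1 a ha (hR _ hzd).1 ha0
  obtain ⟨q, hq, rfl⟩ := h2 b hbV (hR _ hzd).2 e
  exact ⟨p + q, add_mem (CA_mono Set.subset_union_left hp) (CA_mono Set.subset_union_right hq),
    map_add _ _ _⟩

lemma vanishesFrom_empty (d : ℕ) : VanishesFrom d (∅ : Set X) := fun z hz _ _ =>
  ⟨0, zero_mem _, by rw [CA_empty hz, map_zero]⟩

lemma vanishesFrom_of_embedding {φ : C(Y, X)} (hφ : Topology.IsEmbedding φ) {d : ℕ} {W : Set X}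
    (hW : W ⊆ Set.range φ) (h : VanishesFrom d (φ ⁻¹' W)) : VanishesFrom d W := by
  intro z hz hd hb
  obtain ⟨z, rfl⟩ := exists_push_eq hφ (CA_mono hW hz)
  have hzd : z ∈ dgs {n | d ≤ n} := by
    have hinj : Function.Injective fun s : Σ n : ℕ, C(Dl n, Y) =>
        (⟨s.1, φ.comp s.2⟩ : Σ n : ℕ, C(Dl n, X)) := by
      rintro ⟨n, σ⟩ ⟨m, τ⟩ h
      obtain ⟨rfl, h⟩ := Sigma.mk.inj_iff.1 h
      obtain rfl := (ContinuousMap.cancel_left hφ.injective).1 (eq_of_heq h)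
      rfl
    have e : push φ z = Finsupp.mapDomain (fun s : Σ n : ℕ, C(Dl n, Y) =>
      (⟨s.1, φ.comp s.2⟩ : Σ n : ℕ, C(Dl n, X))) z := rfl
    intro s hs
    have : (⟨s.1, φ.comp s.2⟩ : Σ n : ℕ, C(Dl n, X)) ∈ (push φ z).support := by
      classical
      rw [e, Finsupp.mapDomain_support_of_injective hinj]
      exact Finset.mem_image_of_mem _ hs
    exact hd this
  obtain ⟨w, hw, rfl⟩ := h z ((push_mem_iff hφ.injective).1 hz) hzd
    (push_injective hφ.injective (by rw [← bdy_push, hb, map_zero]))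
  exact ⟨push φ w, (push_mem_iff hφ.injective).2 hw, bdy_push _ _⟩

end Vanishing

section Euclidean

variable {ι : Type}

lemma vanishesFrom_convex {C : Set (ι → ℝ)} (hC : Convex ℝ C) {d : ℕ} (hd : 1 ≤ d) :
    VanishesFrom d C := by
  rcases C.eq_empty_or_nonempty with rfl | ⟨a, ha⟩
  · exact vanishesFrom_empty d
  intro z hz hzd hb
  let F : C((ι → ℝ) × unitInterval, ι → ℝ) :=
    ⟨fun p => (1 - (p.2 : ℝ)) • p.1 + (p.2 : ℝ) • a, by fun_prop⟩
  refine exists_bdy_of_contract (F := F) (a := a) (by simp [F]) (by simp [F]) ha ?_ hz hb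
    (aug_of_pos (Finsupp.supported_mono (fun _ (hs : d ≤ _) => hd.trans hs) hzd))
  intro x hx t
  exact hC hx ha (sub_nonneg.2 t.2.2) t.2.1 (by simp)

lemma vanishesFrom_convex_inter_iUnion {r : ℕ} (A B : Fin r → Set (ι → ℝ))
    (hA : ∀ i, Convex ℝ (A i) ∧ IsOpen (A i)) (hB : ∀ i, Convex ℝ (B i) ∧ IsOpen (B i))
    (hAB : ∀ i, Disjoint (A i) (B i)) {C : Set (ι → ℝ)} (hC : Convex ℝ C) (hCo : IsOpen C) :
    VanishesFrom r (C ∩ ⋃ i, (A i ∪ B i)) := by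
  induction r generalizing C with
  | zero => simpa using vanishesFrom_empty 0
  | succ r ih =>
    have ih' := fun {C : Set (ι → ℝ)} (hC : Convex ℝ C) (hCo : IsOpen C) =>
      ih (fun i => A i.succ) (fun i => B i.succ) (fun i => hA _) (fun i => hB _) (fun i => hAB _)
        hC hCo
    have ho : IsOpen (⋃ i : Fin r, (A i.succ ∪ B i.succ)) :=
      isOpen_iUnion fun i => (hA _).2.union (hB _).2
    have e : C ∩ ⋃ i, (A i ∪ B i) =
        (C ∩ ⋃ i : Fin r, (A i.succ ∪ B i.succ)) ∪ ((C ∩ A 0) ∪ (C ∩ B 0)) := by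
      rw [← Set.inter_union_distrib_left, ← Set.inter_union_distrib_left]
      congr 1
      ext x
      simp only [Set.mem_iUnion, Set.mem_union, Fin.exists_fin_succ]
      exact or_comm
    have hd : Disjoint (C ∩ A 0) (C ∩ B 0) :=
      (hAB 0).mono Set.inter_subset_right Set.inter_subset_right
    rw [e]
    refine VanishesFrom.union (hCo.inter ho)
      ((hCo.inter (hA 0).2).union (hCo.inter (hB 0).2)) ?_ ((ih' hC hCo).mono (Nat.le_succ r)) ?_
    · have e2 : (C ∩ ⋃ i : Fin r, (A i.succ ∪ B i.succ)) ∩ ((C ∩ A 0) ∪ (C ∩ B 0)) =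
          ((C ∩ A 0) ∩ ⋃ i : Fin r, (A i.succ ∪ B i.succ)) ∪
          ((C ∩ B 0) ∩ ⋃ i : Fin r, (A i.succ ∪ B i.succ)) := by
        ext x
        simp only [Set.mem_union, Set.mem_inter_iff]
        tauto
      rw [e2]
      exact VanishesFrom.disjoint_union ((hCo.inter (hA 0).2).inter ho)
        ((hCo.inter (hB 0).2).inter ho) (hd.mono Set.inter_subset_left Set.inter_subset_left)
        (ih' (hC.inter (hA 0).1) (hCo.inter (hA 0).2))
        (ih' (hC.inter (hB 0).1) (hCo.inter (hB 0).2))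
    · exact VanishesFrom.disjoint_union (hCo.inter (hA 0).2) (hCo.inter (hB 0).2) hd
        (vanishesFrom_convex (hC.inter (hA 0).1) (by simp))
        (vanishesFrom_convex (hC.inter (hB 0).1) (by simp))

/-- The homology of the pair `(ℝⁿ, ℝⁿ \ A)` vanishes from degree `d` on. -/
def VanishesRel (d : ℕ) (A : Set (ι → ℝ)) : Prop :=
  ∀ z ∈ dgs {n | d ≤ n}, bdy z ∈ CA Aᶜ → ∃ w, z - bdy w ∈ CA Aᶜ

lemma vanishesRel_Icc {n : ℕ} (a b : Fin n → ℝ) : VanishesRel (n + 1) (Set.Icc a b) := by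
  intro z hz hb
  by_cases hab : a ≤ b
  · have e : (Set.Icc a b)ᶜ = Set.univ ∩ ⋃ i, ({x | x i < a i} ∪ {x | b i < x i}) := by
      ext x
      simp only [Set.mem_compl_iff, Set.mem_Icc, Pi.le_def, Set.mem_inter_iff, Set.mem_univ,
        true_and, Set.mem_iUnion, Set.mem_union, Set.mem_ofPred_eq, not_and_or, not_forall, not_le,
        exists_or]
    have hv : VanishesFrom n (Set.Icc a b)ᶜ := by
      rw [e]
      refine vanishesFrom_convex_inter_iUnion _ _ (fun i => ⟨?_, ?_⟩) (fun i => ⟨?_, ?_⟩)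
        (fun i => ?_) convex_univ isOpen_univ
      · exact (convex_Iio (a i)).linear_preimage (LinearMap.proj (R := ℝ) (φ := fun _ => ℝ) i)
      · exact isOpen_lt (continuous_apply i) continuous_const
      · exact (convex_Ioi (b i)).linear_preimage (LinearMap.proj (R := ℝ) (φ := fun _ => ℝ) i)
      · exact isOpen_lt continuous_const (continuous_apply i)
      · rw [Set.disjoint_left]
        intro x hx hx'
        exact absurd (hab i) (not_le.2 (lt_trans hx' hx))
    obtain ⟨v, hv, hvd, hvb⟩ := hv.exists_bounded hb (dgs_pred hz) (bdy_bdy _)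
    obtain ⟨w, -, hw⟩ := vanishesFrom_convex (ι := Fin n) convex_univ (Nat.le_add_left 1 n) (z - v)
      (mem_CA_univ _) (sub_mem hz hvd) (by rw [map_sub, hvb, sub_self])
    exact ⟨w, by rw [hw, sub_sub_cancel]; exact hv⟩
  · rw [Set.Icc_eq_empty hab, Set.compl_empty]
    exact ⟨0, mem_CA_univ _⟩

lemma VanishesRel.mono {d d' : ℕ} (h : d ≤ d') {A : Set (ι → ℝ)} (hA : VanishesRel d A) :
    VanishesRel d' A := fun z hd hb =>
  hA z (Finsupp.supported_mono (fun _ (hs : d' ≤ _) => h.trans hs) hd) hb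

lemma VanishesRel.exists_bounded {d : ℕ} {A : Set (ι → ℝ)} (hA : VanishesRel d A)
    {z : Ch (ι → ℝ)} (hz : z ∈ dgs {n | d ≤ n}) (hb : bdy z ∈ CA Aᶜ) :
    ∃ w ∈ dgs {n | d + 1 ≤ n}, z - bdy w ∈ CA Aᶜ := by
  obtain ⟨w, hw⟩ := hA z hz hb
  obtain ⟨p, q, rfl, hp, hq, -⟩ :=
    exists_split (P := {s : Σ n : ℕ, C(Dl n, ι → ℝ) | s.1 < d + 1})
    (Q := {s | d + 1 ≤ s.1}) (c := w) (fun s _ => lt_or_ge s.1 (d + 1))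
  refine ⟨q, hq, spt_left_of_add (P := {s : Σ n : ℕ, C(Dl n, ι → ℝ) | d ≤ s.1})
    (Q := {s | s.1 < d}) (b := - bdy p) ?_ (sub_mem hz (dgs_pred hq)) ?_ ?_⟩
  · exact Set.disjoint_left.2 fun s hs hs' => absurd hs (Nat.not_le.2 hs')
  · exact neg_mem (bdy_dgs_succ (D := {n | n < d + 1}) (D' := {n | n < d})
      (fun n hn => Nat.lt_of_succ_lt_succ hn) hp)
  · rw [map_add] at hw
    convert hw using 1
    abel

lemma VanishesRel.union {d : ℕ} {A B : Set (ι → ℝ)} (hA : IsClosed A) (hB : IsClosed B)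
    (h1 : VanishesRel d A) (h2 : VanishesRel d B) (h3 : VanishesRel (d + 1) (A ∩ B)) :
    VanishesRel d (A ∪ B) := by
  intro z hz hb
  rw [Set.compl_union] at hb ⊢
  obtain ⟨w, hw, hzw⟩ := h1.exists_bounded hz (CA_mono Set.inter_subset_left hb)
  obtain ⟨v, hv, hzv⟩ := h2.exists_bounded hz (CA_mono Set.inter_subset_right hb)
  have hbd : bdy (w - v) = (z - bdy v) - (z - bdy w) := by rw [map_sub]; abel
  obtain ⟨u, hu⟩ := h3 (w - v) (sub_mem hw hv) (by
    rw [hbd, Set.compl_inter]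
    exact sub_mem (CA_mono Set.subset_union_right hzv) (CA_mono Set.subset_union_left hzw))
  rw [Set.compl_inter] at hu
  obtain ⟨S, T, hS, hT, hST, hSb, -, a, b, hab, ha, hbB, -⟩ :=
    subdivide_two hA.isOpen_compl hB.isOpen_compl hu
  have hbu : bdy (w - v - bdy u) = (z - bdy v) - (z - bdy w) := by
    rw [map_sub bdy (w - v), bdy_bdy, sub_zero, hbd]
  have e := hST (w - v - bdy u)
  rw [hbu, map_sub T (z - bdy v), hab] at e
  have key : w - a + T (z - bdy w) = v + b + T (z - bdy v) + bdy (u + T (w - v - bdy u)) := by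
    rw [map_add]
    have e' : w = v + bdy u + (bdy (T (w - v - bdy u)) + (T (z - bdy v) - T (z - bdy w))) +
        (a + b) := by rw [e]; abel
    nth_rewrite 1 [e']
    abel
  refine ⟨w - a + T (z - bdy w), mem_CA_inter ?_ ?_⟩
  · rw [map_add, map_sub, show z - (bdy w - bdy a + bdy (T (z - bdy w))) =
      (z - bdy w) + bdy a - bdy (T (z - bdy w)) by abel]
    exact sub_mem (add_mem hzw (bdy_mem ha)) (bdy_mem (hT _ _ hzw))
  · rw [key, map_add, bdy_bdy, add_zero, map_add, map_add,
      show z - (bdy v + bdy b + bdy (T (z - bdy v))) =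
        (z - bdy v) - bdy b - bdy (T (z - bdy v)) by abel]
    exact sub_mem (sub_mem hzv (bdy_mem hbB)) (bdy_mem (hT _ _ hzv))

lemma vanishesRel_iUnion_Icc {n r : ℕ} (a b : Fin r → Fin n → ℝ) :
    VanishesRel (n + 1) (⋃ i, Set.Icc (a i) (b i)) := by
  induction r with
  | zero =>
    rw [Set.iUnion_of_empty]
    exact fun z _ _ => ⟨0, by rw [Set.compl_empty]; exact mem_CA_univ _⟩
  | succ r ih =>
    have e : ⋃ i, Set.Icc (a i) (b i) =
        Set.Icc (a 0) (b 0) ∪ ⋃ i : Fin r, Set.Icc (a i.succ) (b i.succ) := by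
      ext x
      simp only [Set.mem_iUnion, Set.mem_union, Fin.exists_fin_succ]
    rw [e]
    refine VanishesRel.union isClosed_Icc (isClosed_iUnion_of_finite fun i => isClosed_Icc)
      (vanishesRel_Icc _ _) (ih _ _) (VanishesRel.mono (Nat.le_succ _) ?_)
    rw [Set.inter_iUnion]
    simp only [Set.Icc_inter_Icc]
    exact ih _ _

lemma vanishesRel_of_isCompact {n : ℕ} {A : Set (Fin n → ℝ)} (hA : IsCompact A) :
    VanishesRel (n + 1) A := by
  intro z hz hb
  have hK : IsClosed (carrier (bdy z)) := (isCompact_carrier _).isClosed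
  have hAK : ∀ x ∈ A, ∃ a b : Fin n → ℝ, Set.Icc a b ∈ nhds x ∧
      Set.Icc a b ⊆ (carrier (bdy z))ᶜ := by
    intro x hx
    have : (carrier (bdy z))ᶜ ∈ nhds x :=
      hK.isOpen_compl.mem_nhds fun h => mem_CA_iff.1 hb h hx
    obtain ⟨ε, hε, h⟩ := Metric.nhds_basis_closedBall.mem_iff.1 this
    have e : Metric.closedBall x ε = Set.Icc (fun i => x i - ε) (fun i => x i + ε) := by
      rw [closedBall_pi x hε.le, ← Set.pi_univ_Icc]
      simp only [Real.closedBall_eq_Icc]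
    exact ⟨_, _, e ▸ Metric.closedBall_mem_nhds x hε, e ▸ h⟩
  choose! a b hab hsub using hAK
  obtain ⟨t, htA, ht⟩ := hA.elim_nhds_subcover (fun x => Set.Icc (a x) (b x)) hab
  have e : (⋃ x ∈ t, Set.Icc (a x) (b x)) =
      ⋃ i : Fin t.card, Set.Icc (a (t.equivFin.symm i)) (b (t.equivFin.symm i)) := by
    rw [t.equivFin.symm.surjective.iUnion_comp (fun x : t => Set.Icc (a x) (b x)),
      Set.iUnion_subtype]
  obtain ⟨w, hw⟩ := vanishesRel_iUnion_Icc _ _ z hz (by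
    rw [← e, mem_CA_iff, Set.compl_iUnion₂]
    exact Set.subset_iInter₂ fun x hx => Set.subset_compl_comm.1 (hsub x (htA x hx)))
  rw [← e] at hw
  exact ⟨w, CA_mono (Set.compl_subset_compl.2 ht) hw⟩

lemma vanishesFrom_of_isOpen {n : ℕ} (hn : 1 ≤ n) {U : Set (Fin n → ℝ)} (hU : IsOpen U) :
    VanishesFrom n U := by
  intro z hz hd hb
  obtain ⟨R, hR⟩ := (isCompact_carrier z).isBounded.subset_ball 0
  set U' := U ∩ Metric.ball 0 R
  have hU' : IsOpen U' := hU.inter Metric.isOpen_ball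
  have hzU : z ∈ CA U' := mem_CA_iff.2 (Set.subset_inter (mem_CA_iff.1 hz) hR)
  have hfr : IsCompact (frontier U') := by
    refine Metric.isCompact_of_isClosed_isBounded isClosed_frontier ?_
    exact (Metric.isBounded_ball.subset Set.inter_subset_right).closure.subset
      frontier_subset_closure
  obtain ⟨w, -, hwd, rfl⟩ :=
    (vanishesFrom_convex convex_univ hn).exists_bounded (mem_CA_univ z) hd hb
  obtain ⟨u, hu⟩ := vanishesRel_of_isCompact hfr w hwd
    (CA_mono (fun x hx hx' => by rw [hU'.frontier_eq] at hx'; exact hx'.2 hx) hzU)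
  have hsub : (frontier U')ᶜ ⊆ U' ∪ (closure U')ᶜ := by
    intro x hx
    rw [hU'.frontier_eq, Set.mem_compl_iff, Set.mem_sdiff, not_and, not_not] at hx
    exact (em (x ∈ closure U')).imp hx id
  have hdis : Disjoint U' (closure U')ᶜ :=
    disjoint_compl_right.mono_left subset_closure
  obtain ⟨p, q, hpq, hp, hq, -⟩ :=
    exists_split_disjoint hU' isClosed_closure.isOpen_compl hdis (CA_mono hsub hu)
  have e : bdy w = bdy p + bdy q := by
    rw [← map_add, ← hpq, map_sub, bdy_bdy, sub_zero]
  have hq0 : bdy q = 0 := CA_empty (by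
    rw [← hdis.inter_eq]
    refine mem_CA_inter ?_ (bdy_mem hq)
    rw [eq_sub_of_add_eq' e.symm]
    exact sub_mem hzU (bdy_mem hp))
  exact ⟨p, CA_mono Set.inter_subset_left hp, by rw [e, hq0, add_zero]⟩

end Euclidean

theorem vanishesFrom_manifold {n : ℕ} (hn : 1 ≤ n) {M : Type} [TopologicalSpace M]
    [ChartedSpace (EuclideanSpace ℝ (Fin n)) M] : VanishesFrom (n + 1) (Set.univ : Set M) := by
  have loc : ∀ x : M, ∃ V : Set M, IsOpen V ∧ x ∈ V ∧ ∀ W ⊆ V, IsOpen W → VanishesFrom n W := by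
    intro x
    obtain ⟨ψ, hψ, hx, -⟩ := exists_euclidean_nhd (n := n) x isOpen_univ trivial
    refine ⟨Set.range ψ, hψ.isOpen_range, hx, fun W hW hWo => ?_⟩
    let e := (EuclideanSpace.equiv (Fin n) ℝ).toHomeomorph
    have he : Topology.IsEmbedding (ψ ∘ e.symm) := hψ.isEmbedding.comp e.symm.isEmbedding
    refine vanishesFrom_of_embedding (φ := ⟨ψ ∘ e.symm, he.continuous⟩) he ?_
      (vanishesFrom_of_isOpen hn (hWo.preimage he.continuous))
    rw [ContinuousMap.coe_mk, e.symm.surjective.range_comp]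
    exact hW
  choose V hV hxV hW using loc
  have key : ∀ t : Finset M, VanishesFrom (n + 1) (⋃ x ∈ t, V x) := by
    classical
    intro t
    induction t using Finset.induction_on with
    | empty => simpa using vanishesFrom_empty _
    | insert x t _ ih =>
      have ho : IsOpen (⋃ x ∈ t, V x) := isOpen_biUnion fun x _ => hV x
      rw [Finset.set_biUnion_insert]
      exact VanishesFrom.union (hV x) ho
        (hW x _ Set.inter_subset_left ((hV x).inter ho))
        ((hW x _ subset_rfl (hV x)).mono (Nat.le_succ n)) ih
  intro z _ hd hb
  obtain ⟨t, ht⟩ := (isCompact_carrier z).elim_finite_subcover V hV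
    fun x _ => Set.mem_iUnion.2 ⟨x, hxV x⟩
  obtain ⟨w, -, hw⟩ := key t z (mem_CA_iff.2 ht) hd hb
  exact ⟨w, mem_CA_univ w, hw⟩

section AcyclicModels

universe u

/-- Functors to augmented differential rational vector spaces. -/
structure DFun (C : Type u) [Category.{0} C] where
  obj : C → Type
  [addCommGroup : ∀ X, AddCommGroup (obj X)]
  [module : ∀ X, Module ℚ (obj X)]
  map : ∀ {X Y : C}, (X ⟶ Y) → obj X →ₗ[ℚ] obj Y
  d : ∀ X, obj X →ₗ[ℚ] obj X
  aug : ∀ X, obj X →ₗ[ℚ] ℚ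
  map_id : ∀ X x, map (𝟙 X) x = x
  map_comp : ∀ {X Y Z : C} (f : X ⟶ Y) (g : Y ⟶ Z) x, map (f ≫ g) x = map g (map f x)
  d_map : ∀ {X Y : C} (f : X ⟶ Y) x, d Y (map f x) = map f (d X x)
  d_d : ∀ X x, d X (d X x) = 0
  aug_map : ∀ {X Y : C} (f : X ⟶ Y) x, aug Y (map f x) = aug X x
  aug_d : ∀ X x, aug X (d X x) = 0

attribute [instance] DFun.addCommGroup DFun.module

/-- A presentation of a functor as free on models. -/
structure DFun.Models {C : Type u} [Category.{0} C] (S : DFun C) where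
  I : Type
  deg : I → ℕ
  m : I → C
  elt : ∀ i, S.obj (m i)
  basis : ∀ X, Module.Basis (Σ i, m i ⟶ X) ℚ (S.obj X)
  basis_apply : ∀ X i (f : m i ⟶ X), basis X ⟨i, f⟩ = S.map f (elt i)
  d_elt : ∀ i, S.d _ (elt i) ∈ Submodule.span ℚ
    {x | ∃ j, ∃ f : m j ⟶ m i, deg j + 1 = deg i ∧ x = S.map f (elt j)}

variable {C : Type u} [Category.{0} C] {S G : DFun C}

/-- Natural linear maps. -/
def IsNat (h : ∀ X, S.obj X →ₗ[ℚ] G.obj X) : Prop :=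
  ∀ {X Y : C} (f : X ⟶ Y) x, h Y (S.map f x) = G.map f (h X x)

namespace DFun.Models

variable (F : S.Models)

/-- The natural map with prescribed values on the models. -/
noncomputable def extend (h : ∀ i, G.obj (F.m i)) (X : C) : S.obj X →ₗ[ℚ] G.obj X :=
  (F.basis X).constr ℚ fun s => G.map s.2 (h s.1)

lemma extend_map (h : ∀ i, G.obj (F.m i)) {X : C} (i : F.I) (f : F.m i ⟶ X) :
    F.extend h X (S.map f (F.elt i)) = G.map f (h i) := by
  rw [← F.basis_apply, extend, Module.Basis.constr_basis]

lemma extend_elt (h : ∀ i, G.obj (F.m i)) (i : F.I) : F.extend h _ (F.elt i) = h i := by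
  have := F.extend_map h i (𝟙 _)
  rwa [S.map_id, G.map_id] at this

lemma hom_ext {V : Type*} [AddCommGroup V] [Module ℚ V] {X : C} {f g : S.obj X →ₗ[ℚ] V}
    (h : ∀ i (p : F.m i ⟶ X), f (S.map p (F.elt i)) = g (S.map p (F.elt i))) : f = g :=
  (F.basis X).ext fun s => by rw [F.basis_apply]; exact h _ _

lemma isNat_extend (h : ∀ i, G.obj (F.m i)) : IsNat (F.extend h) := by
  intro X Y f x
  suffices e : F.extend h Y ∘ₗ S.map f = G.map f ∘ₗ F.extend h X from LinearMap.congr_fun e x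
  refine F.hom_ext fun i p => ?_
  rw [LinearMap.comp_apply, LinearMap.comp_apply, ← S.map_comp, extend_map, extend_map, G.map_comp]

lemma d_extend_apply (h : ∀ i, G.obj (F.m i)) {i : F.I} {N : Submodule ℚ (G.obj (F.m i))}
    (hN : ∀ j (f : F.m j ⟶ F.m i), F.deg j + 1 = F.deg i → G.map f (h j) ∈ N) :
    F.extend h _ (S.d _ (F.elt i)) ∈ N := by
  have := Submodule.mem_map_of_mem (f := F.extend h _) (F.d_elt i)
  refine (?_ : Submodule.map _ _ ≤ N) this
  rw [Submodule.map_span, Submodule.span_le]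
  rintro _ ⟨_, ⟨j, f, hj, rfl⟩, rfl⟩
  rw [extend_map]
  exact hN j f hj

lemma extend_congr {h h' : ∀ i, G.obj (F.m i)} {i : F.I}
    (hh : ∀ j, F.deg j + 1 = F.deg i → h j = h' j) :
    F.extend h _ (S.d _ (F.elt i)) = F.extend h' _ (S.d _ (F.elt i)) := by
  have e : Set.EqOn (F.extend h (F.m i)) (F.extend h' (F.m i))
      (Submodule.span ℚ {x | ∃ j, ∃ f : F.m j ⟶ F.m i, F.deg j + 1 = F.deg i ∧
        x = S.map f (F.elt j)}) := by
    refine LinearMap.eqOn_span' ?_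
    rintro _ ⟨j, f, hj, rfl⟩
    rw [extend_map, extend_map, hh j hj]
  exact e (F.d_elt i)

lemma exists_fixed (Φ : (∀ i, G.obj (F.m i)) → ∀ i, G.obj (F.m i))
    (hΦ : ∀ h h' i, (∀ j, F.deg j + 1 = F.deg i → h j = h' j) → Φ h i = Φ h' i) :
    ∃ h, ∀ i, h i = Φ h i := by
  let it : ℕ → ∀ i, G.obj (F.m i) := fun k => Φ^[k] 0
  have st : ∀ n i, F.deg i = n → ∀ k, n < k → it k i = it (n + 1) i := by
    intro n
    induction n with
    | zero =>
      intro i hi k hk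
      obtain ⟨k, rfl⟩ := Nat.exists_eq_succ_of_ne_zero hk.ne'
      simp only [it, Nat.succ_eq_add_one, Function.iterate_succ_apply']
      exact hΦ _ _ _ fun j hj => absurd (hj.trans hi) (Nat.succ_ne_zero _)
    | succ n ih =>
      intro i hi k hk
      obtain ⟨k, rfl⟩ := Nat.exists_eq_succ_of_ne_zero (Nat.zero_lt_of_lt hk).ne'
      simp only [it, Nat.succ_eq_add_one, Function.iterate_succ_apply' Φ k,
        Function.iterate_succ_apply' Φ (n + 1)]
      exact hΦ _ _ _ fun j hj =>
        ih j (Nat.succ_injective (hj.trans hi)) k (Nat.lt_of_succ_lt_succ hk)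
  refine ⟨fun i => it (F.deg i + 1) i, fun i => ?_⟩
  simp only [it, Function.iterate_succ_apply' Φ (F.deg i)]
  refine hΦ _ _ _ fun j hj => ?_
  rw [← hj]

/-- The method of acyclic models: natural solutions of `d h = R + ε h d`. -/
theorem solve (R : ∀ X, S.obj X →ₗ[ℚ] G.obj X) (hR : IsNat R) (ε c : ℚ)
    (hRd : ∀ X x, G.d X (R X x) = -(ε • R X (S.d X x)))
    (hRa : ∀ X x, G.aug X (R X x) = 0)
    (P : Set F.I) (g : ∀ i, G.obj (F.m i))
    (hg : ∀ h : ∀ X, S.obj X →ₗ[ℚ] G.obj X, IsNat h → (∀ i ∈ P, h _ (F.elt i) = g i) →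
      ∀ i ∈ P, G.d _ (g i) = R _ (F.elt i) + ε • h _ (S.d _ (F.elt i)))
    (hga : ∀ i ∈ P, G.aug _ (g i) = c * S.aug _ (F.elt i))
    (hPa : ∀ i ∉ P, c * S.aug _ (F.elt i) = 0)
    (κ : ∀ i, G.obj (F.m i) →ₗ[ℚ] G.obj (F.m i)) (a : ∀ i, G.obj (F.m i))
    (hκ : ∀ i x, G.d _ (κ i x) + κ i (G.d _ x) = x - G.aug _ x • a i)
    (hκa : ∀ i x, G.aug _ (κ i x) = 0)
    (Q : ℕ → ∀ X : C, Submodule ℚ (G.obj X))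
    (hQ : ∀ n ⦃X Y : C⦄ (f : X ⟶ Y) x, x ∈ Q n X → G.map f x ∈ Q n Y)
    (hQg : ∀ i ∈ P, g i ∈ Q (F.deg i) _) (hQR : ∀ i, κ i (R _ (F.elt i)) ∈ Q (F.deg i) _)
    (hQκ : ∀ i n x, x ∈ Q n _ → κ i x ∈ Q (n + 1) _) :
    ∃ h : ∀ X, S.obj X →ₗ[ℚ] G.obj X, IsNat h ∧
      (∀ X x, G.d X (h X x) = R X x + ε • h X (S.d X x)) ∧
      (∀ X x, G.aug X (h X x) = c * S.aug X x) ∧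
      (∀ i ∈ P, h _ (F.elt i) = g i) ∧ ∀ i, h _ (F.elt i) ∈ Q (F.deg i) _ := by
  classical
  let y : (∀ i, G.obj (F.m i)) → ∀ i, G.obj (F.m i) := fun h i =>
    R _ (F.elt i) + ε • F.extend h _ (S.d _ (F.elt i))
  obtain ⟨h, hh⟩ := F.exists_fixed (fun h i => if i ∈ P then g i else κ i (y h i))
    (fun h h' i e => by simp only [y, F.extend_congr e])
  have hP : ∀ i ∈ P, h i = g i := fun i hi => by rw [hh, if_pos hi]
  have hnP : ∀ i ∉ P, h i = κ i (y h i) := fun i hi => by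
    conv_lhs => rw [hh]
    rw [if_neg hi]
  have haug : ∀ X x, G.aug X (F.extend h X x) = c * S.aug X x := by
    intro X x
    suffices e : G.aug X ∘ₗ F.extend h X = c • S.aug X from LinearMap.congr_fun e x
    refine F.hom_ext fun i p => ?_
    rw [LinearMap.comp_apply, extend_map, G.aug_map, LinearMap.smul_apply, S.aug_map, smul_eq_mul]
    by_cases hi : i ∈ P
    · rw [hP i hi, hga i hi]
    · rw [hnP i hi, hκa, hPa i hi]
  have hya : ∀ i, G.aug _ (y h i) = 0 := fun i => by
    simp only [y, map_add, map_smul, hRa, haug, S.aug_d, mul_zero, smul_zero, add_zero]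
  let y' : ∀ X, S.obj X →ₗ[ℚ] G.obj X := fun X => R X + ε • F.extend h X ∘ₗ S.d X
  have hyd : ∀ X x, G.d X (y' X x) = ε • (G.d X (F.extend h X (S.d X x)) - y' X (S.d X x)) := by
    intro X x
    simp only [y', LinearMap.add_apply, LinearMap.smul_apply, LinearMap.comp_apply, map_add,
      map_smul, hRd, S.d_d, map_zero, smul_zero, add_zero, smul_sub]
    abel
  have hnat : IsNat (F.extend h) := F.isNat_extend h
  have hy'nat : IsNat y' := by
    intro X Y f x
    simp only [y', LinearMap.add_apply, LinearMap.smul_apply, LinearMap.comp_apply, map_add,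
      map_smul, hR f, S.d_map, hnat f]
  have hdh : ∀ i, G.d _ (h i) = y h i - if i ∈ P then 0 else κ i (G.d _ (y h i)) := by
    intro i
    by_cases hi : i ∈ P
    · rw [if_pos hi, hP i hi, sub_zero, hg _ hnat (fun j hj => by rw [extend_elt, hP j hj]) i hi]
    · have := hκ i (y h i)
      rw [hya, zero_smul, sub_zero] at this
      rw [if_neg hi, hnP i hi, eq_sub_iff_add_eq, this]
  have defect : ∀ X x, G.d X (F.extend h X x) - y' X x =
      F.extend (fun i => - if i ∈ P then 0 else κ i (G.d _ (y h i))) X x := by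
    intro X x
    suffices e : G.d X ∘ₗ F.extend h X - y' X =
        F.extend (fun i => - if i ∈ P then 0 else κ i (G.d _ (y h i))) X from
      LinearMap.congr_fun e x
    refine F.hom_ext fun i p => ?_
    rw [LinearMap.sub_apply, LinearMap.comp_apply, extend_map, extend_map, G.d_map, hdh,
      hy'nat p, ← map_sub]
    congr 1
    simp only [y', y, LinearMap.add_apply, LinearMap.smul_apply, LinearMap.comp_apply]
    abel
  have hzero : ∀ n i, F.deg i = n → G.d _ (y h i) = 0 := by
    intro n
    induction n with
    | zero =>
      intro i hi
      change G.d _ (y' _ (F.elt i)) = 0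
      rw [hyd, defect, ← Submodule.mem_bot ℚ]
      refine Submodule.smul_mem _ _ (F.d_extend_apply _ fun j f hj => ?_)
      exact absurd (hj.trans hi) (Nat.succ_ne_zero _)
    | succ n ih =>
      intro i hi
      change G.d _ (y' _ (F.elt i)) = 0
      rw [hyd, defect, ← Submodule.mem_bot ℚ]
      refine Submodule.smul_mem _ _ (F.d_extend_apply _ fun j f hj => ?_)
      rw [ih j (Nat.succ_injective (hj.trans hi)), map_zero, ite_self, neg_zero, map_zero]
      exact zero_mem _
  refine ⟨F.extend h, hnat, fun X x => ?_, haug, fun i hi => ?_, fun i => ?_⟩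
  · rw [← sub_eq_zero]
    have e := defect X x
    rw [show (fun i => - if i ∈ P then 0 else κ i (G.d _ (y h i))) = (0 : ∀ i, G.obj (F.m i)) from
      funext fun i => by rw [hzero _ i rfl, map_zero, ite_self, neg_zero]; rfl] at e
    refine e.trans ?_
    suffices e : F.extend (0 : ∀ i, G.obj (F.m i)) X = 0 from LinearMap.congr_fun e x
    refine F.hom_ext fun i p => ?_
    rw [extend_map, Pi.zero_apply, map_zero, LinearMap.zero_apply]
  · rw [extend_elt, hP i hi]
  · rw [extend_elt]
    suffices H : ∀ n i, F.deg i = n → h i ∈ Q (F.deg i) _ from H _ i rfl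
    intro n
    induction n with
    | zero =>
      intro i hi
      by_cases hiP : i ∈ P
      · rw [hP i hiP]
        exact hQg i hiP
      · rw [hnP i hiP, map_add, map_smul]
        have : F.extend h _ (S.d _ (F.elt i)) = 0 := by
          rw [← Submodule.mem_bot ℚ]
          exact F.d_extend_apply _ fun j f hj => absurd (hj.trans hi) (Nat.succ_ne_zero _)
        rw [this, map_zero, smul_zero, add_zero]
        exact hQR i
    | succ n ih =>
      intro i hi
      by_cases hiP : i ∈ P
      · rw [hP i hiP]
        exact hQg i hiP
      · rw [hnP i hiP, map_add, map_smul]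
        refine add_mem (hQR i) (Submodule.smul_mem _ _ ?_)
        rw [hi]
        refine hQκ i n _ (F.d_extend_apply _ fun j f hj => ?_)
        have hj' : F.deg j = n := Nat.succ_injective (hj.trans hi)
        have := ih j hj'
        rw [hj'] at this
        exact hQ n f _ this

end DFun.Models

end AcyclicModels

open TensorProduct

section Sign

variable {X Y : Type} [TopologicalSpace X] [TopologicalSpace Y]

/-- The sign `(-1) ^ n` on chains of degree `n`. -/
noncomputable def sgn : Ch X →ₗ[ℚ] Ch X :=
  Finsupp.linearCombination ℚ fun s => (-1 : ℚ) ^ s.1 • gen s.2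

lemma sgn_gen {n : ℕ} (σ : C(Dl n, X)) : sgn (gen σ) = (-1 : ℚ) ^ n • gen σ := by
  simp [sgn, gen]

lemma sgn_of_mem {n : ℕ} {c : Ch X} (hc : c ∈ dgs {n}) : sgn c = (-1 : ℚ) ^ n • c := by
  have : (sgn - (-1 : ℚ) ^ n • LinearMap.id : Ch X →ₗ[ℚ] Ch X) c ∈ (⊥ : Submodule ℚ (Ch X)) := by
    refine map_mem_of_gen _ _ (fun m σ hσ => ?_) hc
    obtain rfl : m = n := hσ
    simp [sgn_gen]
  exact sub_eq_zero.1 this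

lemma gen_mem_dgs {n : ℕ} (σ : C(Dl n, X)) : gen σ ∈ dgs {n} :=
  gen_mem_spt rfl

lemma bdy_gen_mem_dgs {n : ℕ} (σ : C(Dl (n + 1), X)) : bdy (gen σ) ∈ dgs {n} :=
  bdy_dgs_succ (D := {n + 1}) (fun _ h => Nat.succ_injective h) (gen_mem_dgs σ)

lemma sgn_push (f : C(X, Y)) (c : Ch X) : sgn (push f c) = push f (sgn c) := by
  suffices h : sgn ∘ₗ push f = push f ∘ₗ sgn from LinearMap.congr_fun h c
  apply ch_hom_ext
  intro n σ
  simp [push_gen, sgn_gen]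

lemma sgn_bdy (c : Ch X) : sgn (bdy c) = - bdy (sgn c) := by
  suffices h : sgn ∘ₗ bdy = - (bdy ∘ₗ sgn : Ch X →ₗ[ℚ] Ch X) from LinearMap.congr_fun h c
  apply ch_hom_ext
  intro n σ
  rw [LinearMap.comp_apply, LinearMap.neg_apply, LinearMap.comp_apply, sgn_gen, map_smul]
  cases n with
  | zero => simp [bdy_gen_zero]
  | succ n => rw [sgn_of_mem (bdy_gen_mem_dgs σ), pow_succ]; simp

lemma sgn_sgn (c : Ch X) : sgn (sgn c) = c := by
  suffices h : sgn ∘ₗ sgn = (LinearMap.id : Ch X →ₗ[ℚ] Ch X) from LinearMap.congr_fun h c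
  apply ch_hom_ext
  intro n σ
  simp [sgn_gen, smul_smul, ← mul_pow]

lemma aug_sgn (c : Ch X) : aug (sgn c) = aug c := by
  suffices h : aug ∘ₗ sgn = (aug : Ch X →ₗ[ℚ] ℚ) from LinearMap.congr_fun h c
  apply ch_hom_ext
  intro n σ
  cases n <;> simp [sgn_gen, aug_gen]

lemma map_bdy_gen_mem {V : Type} [AddCommGroup V] [Module ℚ V] {p : ℕ} (σ : C(Dl p, X))
    (φ : Ch X →ₗ[ℚ] V) {N : Submodule ℚ V}
    (h : ∀ j (τ : C(Dl j, X)), j + 1 = p → φ (gen τ) ∈ N) : φ (bdy (gen σ)) ∈ N := by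
  cases p with
  | zero => rw [bdy_gen_zero, map_zero]; exact zero_mem _
  | succ p =>
    refine map_mem_of_gen φ N (fun n τ hn => h n τ ?_) (bdy_gen_mem_dgs σ)
    exact congrArg Nat.succ hn

lemma exists_contraction (Z : Type) [TopologicalSpace Z] [ContractibleSpace Z] :
    ∃ (κ : Ch Z →ₗ[ℚ] Ch Z) (a : Z), (∀ c, bdy (κ c) + κ (bdy c) =
      c - aug c • gen (ContinuousMap.const (Dl 0) a)) ∧ (∀ c, aug (κ c) = 0) ∧
      ∀ n, ∀ c ∈ dgs {n}, κ c ∈ dgs {n + 1} := by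
  obtain ⟨a, ⟨H⟩⟩ := id_nullhomotopic Z
  let F : C(Z × unitInterval, Z) := H.toContinuousMap.comp ContinuousMap.prodSwap
  have hd : ∀ n, ∀ c ∈ (dgs {n} : Submodule ℚ (Ch Z)),
      (constOp a - homOp F) c ∈ dgs {n + 1} := by
    intro n c hc
    refine sub_mem ?_ (homOp_dgs F (D := {n}) (D' := {n + 1}) (fun _ h => congrArg Nat.succ h) hc)
    refine map_mem_of_gen _ _ (fun m σ hm => ?_) hc
    obtain rfl : m = n := hm
    rw [constOp_gen]
    exact gen_mem_dgs _
  refine ⟨constOp a - homOp F, a, fun c => ?_, fun c => ?_, hd⟩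
  · have e1 := homOp_eq F (ContinuousMap.id Z) (ContinuousMap.const Z a)
      (fun x => H.apply_zero x) (fun x => H.apply_one x) c
    have e2 := constOp_eq a c
    rw [push_id] at e1
    rw [LinearMap.sub_apply, LinearMap.sub_apply, map_sub, sub_add_sub_comm, e1, e2]
    abel
  · suffices h : aug ∘ₗ (constOp a - homOp F) = (0 : Ch Z →ₗ[ℚ] ℚ) from LinearMap.congr_fun h c
    apply ch_hom_ext
    intro n σ
    exact aug_of_pos (Finsupp.supported_mono
      (fun (s : Σ n : ℕ, C(Dl n, Z)) (hs : s.1 = n + 1) => (Nat.succ_pos n).trans_eq hs.symm)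
      (hd n _ (gen_mem_dgs σ)))

lemma sgn_raise {κ : Ch X →ₗ[ℚ] Ch X} (h : ∀ n, ∀ c ∈ dgs {n}, κ c ∈ dgs {n + 1}) (c : Ch X) :
    sgn (κ c) = - κ (sgn c) := by
  suffices h : sgn ∘ₗ κ = - (κ ∘ₗ sgn) from LinearMap.congr_fun h c
  apply ch_hom_ext
  intro n σ
  rw [LinearMap.comp_apply, LinearMap.neg_apply, LinearMap.comp_apply, sgn_gen,
    sgn_of_mem (h n _ (gen_mem_dgs σ)), pow_succ]
  simp

end Sign

section Tensor

/-- The differential of the tensor product. -/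
noncomputable def tenD (A B : Type) [TopologicalSpace A] [TopologicalSpace B] :
    Ch A ⊗[ℚ] Ch B →ₗ[ℚ] Ch A ⊗[ℚ] Ch B :=
  TensorProduct.map bdy LinearMap.id + TensorProduct.map sgn bdy

variable {A B A' B' W W' : Type} [TopologicalSpace A] [TopologicalSpace B] [TopologicalSpace A']
  [TopologicalSpace B'] [TopologicalSpace W] [TopologicalSpace W']

lemma tenD_tmul (x : Ch A) (y : Ch B) : tenD A B (x ⊗ₜ y) = bdy x ⊗ₜ y + sgn x ⊗ₜ bdy y := rfl

lemma ten_induction {V V' : Type} [AddCommGroup V] [Module ℚ V] [AddCommGroup V'] [Module ℚ V']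
    {p : V ⊗[ℚ] V' → Prop} (t : V ⊗[ℚ] V') (h : ∀ x y, p (x ⊗ₜ y))
    (hadd : ∀ s t, p s → p t → p (s + t)) : p t :=
  TensorProduct.induction_on t (by simpa using h 0 0) h hadd

/-- The augmentation of the tensor product. -/
noncomputable def tenAug (A B : Type) [TopologicalSpace A] [TopologicalSpace B] :
    Ch A ⊗[ℚ] Ch B →ₗ[ℚ] ℚ :=
  LinearMap.mul' ℚ ℚ ∘ₗ TensorProduct.map aug aug

lemma tenAug_tmul (x : Ch A) (y : Ch B) : tenAug A B (x ⊗ₜ y) = aug x * aug y := rfl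

lemma tenD_map (f : C(A, A')) (g : C(B, B')) (t : Ch A ⊗[ℚ] Ch B) :
    tenD A' B' (TensorProduct.map (push f) (push g) t) =
      TensorProduct.map (push f) (push g) (tenD A B t) := by
  induction t using ten_induction with
  | h x y => simp [tenD_tmul, bdy_push, sgn_push]
  | hadd s t hs ht => simp only [map_add, hs, ht]

lemma tenD_tenD (t : Ch A ⊗[ℚ] Ch B) : tenD A B (tenD A B t) = 0 := by
  induction t using ten_induction with
  | h x y => simp [tenD_tmul, bdy_bdy, sgn_bdy, TensorProduct.neg_tmul]
  | hadd s t hs ht => simp only [map_add, hs, ht, add_zero]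

lemma tenAug_tenD (t : Ch A ⊗[ℚ] Ch B) : tenAug A B (tenD A B t) = 0 := by
  induction t using ten_induction with
  | h x y => simp [tenD_tmul, tenAug_tmul, aug_bdy]
  | hadd s t hs ht => simp only [map_add, hs, ht, add_zero]

lemma tenAug_map (f : C(A, A')) (g : C(B, B')) (t : Ch A ⊗[ℚ] Ch B) :
    tenAug A' B' (TensorProduct.map (push f) (push g) t) = tenAug A B t := by
  induction t using ten_induction with
  | h x y => simp [tenAug_tmul, aug_push]
  | hadd s t hs ht => simp only [map_add, hs, ht]

/-- The differential of the triple tensor product. -/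
noncomputable def triD (A B W : Type) [TopologicalSpace A] [TopologicalSpace B]
    [TopologicalSpace W] : Ch A ⊗[ℚ] (Ch B ⊗[ℚ] Ch W) →ₗ[ℚ] Ch A ⊗[ℚ] (Ch B ⊗[ℚ] Ch W) :=
  TensorProduct.map bdy LinearMap.id + TensorProduct.map sgn (tenD B W)

lemma triD_tmul (x : Ch A) (t : Ch B ⊗[ℚ] Ch W) :
    triD A B W (x ⊗ₜ t) = bdy x ⊗ₜ t + sgn x ⊗ₜ tenD B W t := rfl

lemma ten_contraction {V W : Type} [AddCommGroup V] [Module ℚ V] [AddCommGroup W] [Module ℚ W]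
    {d s κ : V →ₗ[ℚ] V} {d' κ' : W →ₗ[ℚ] W} {e : V →ₗ[ℚ] ℚ} {e' : W →ₗ[ℚ] ℚ} {a : V} {b : W}
    (hκ : ∀ x, d (κ x) + κ (d x) = x - e x • a) (hκ' : ∀ y, d' (κ' y) + κ' (d' y) = y - e' y • b)
    (hs : ∀ x, s (κ x) = - κ (s x)) (hsa : s a = a) (hda : d a = 0) (hed : ∀ x, e (d x) = 0)
    (hes : ∀ x, e (s x) = e x) (t : V ⊗[ℚ] W) :
    (TensorProduct.map d LinearMap.id + TensorProduct.map s d' : V ⊗[ℚ] W →ₗ[ℚ] V ⊗[ℚ] W)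
        ((TensorProduct.map κ LinearMap.id + TensorProduct.map (e.smulRight a) κ' :
          V ⊗[ℚ] W →ₗ[ℚ] V ⊗[ℚ] W) t) +
      (TensorProduct.map κ LinearMap.id + TensorProduct.map (e.smulRight a) κ' :
          V ⊗[ℚ] W →ₗ[ℚ] V ⊗[ℚ] W)
        ((TensorProduct.map d LinearMap.id + TensorProduct.map s d' :
          V ⊗[ℚ] W →ₗ[ℚ] V ⊗[ℚ] W) t) =
      t - (LinearMap.mul' ℚ ℚ ∘ₗ TensorProduct.map e e') t • (a ⊗ₜ[ℚ] b) := by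
  induction t using ten_induction with
  | h x y =>
    have e3 : d (κ x) = x - e x • a - κ (d x) := eq_sub_of_add_eq (hκ x)
    have e4 : d' (κ' y) = y - e' y • b - κ' (d' y) := eq_sub_of_add_eq (hκ' y)
    simp only [LinearMap.add_apply, TensorProduct.map_tmul, LinearMap.id_apply, map_add,
      LinearMap.smulRight_apply, map_smul, hda, hsa, e3, e4, hed, hes, hs, zero_smul,
      TensorProduct.zero_tmul, TensorProduct.sub_tmul, TensorProduct.tmul_sub,
      TensorProduct.neg_tmul, ← TensorProduct.smul_tmul', TensorProduct.tmul_smul,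
      LinearMap.comp_apply, LinearMap.mul'_apply, mul_smul]
    module
  | hadd s t hs ht =>
    rw [map_add, map_add, map_add, map_add, map_add, add_add_add_comm, hs, ht, add_smul]
    abel

lemma exists_ten_contraction (A B : Type) [TopologicalSpace A] [TopologicalSpace B]
    [ContractibleSpace A] [ContractibleSpace B] :
    ∃ (κ : Ch A ⊗[ℚ] Ch B →ₗ[ℚ] Ch A ⊗[ℚ] Ch B) (a : Ch A ⊗[ℚ] Ch B),
      (∀ t, tenD A B (κ t) + κ (tenD A B t) = t - tenAug A B t • a) ∧
      ∀ t, tenAug A B (κ t) = 0 := by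
  obtain ⟨κ, a, hκ, hκa, hκd⟩ := exists_contraction A
  obtain ⟨κ', b, hκ', hκa', -⟩ := exists_contraction B
  refine ⟨_, _, ten_contraction hκ hκ' (sgn_raise hκd) (by rw [sgn_gen, pow_zero, one_smul])
    (bdy_gen_zero _) aug_bdy aug_sgn, fun t => ?_⟩
  induction t using ten_induction with
  | h x y => simp [tenAug_tmul, hκa, hκa']
  | hadd s t hs ht => rw [map_add, map_add, hs, ht, add_zero]

end Tensor

open TensorProduct

lemma ten_map_id {V W : Type*} [AddCommGroup V] [Module ℚ V] [AddCommGroup W] [Module ℚ W]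
    {f : V →ₗ[ℚ] V} {g : W →ₗ[ℚ] W} (hf : ∀ x, f x = x) (hg : ∀ x, g x = x) (t : V ⊗[ℚ] W) :
    TensorProduct.map f g t = t := by
  have e : f = LinearMap.id := LinearMap.ext hf
  have e' : g = LinearMap.id := LinearMap.ext hg
  rw [e, e', TensorProduct.map_id, LinearMap.id_apply]

lemma ten_map_comp {V W V' W' V'' W'' : Type*} [AddCommGroup V] [Module ℚ V] [AddCommGroup W]
    [Module ℚ W] [AddCommGroup V'] [Module ℚ V'] [AddCommGroup W'] [Module ℚ W']
    [AddCommGroup V''] [Module ℚ V''] [AddCommGroup W''] [Module ℚ W'']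
    {f : V →ₗ[ℚ] V'} {g : W →ₗ[ℚ] W'} {f' : V' →ₗ[ℚ] V''} {g' : W' →ₗ[ℚ] W''}
    {f'' : V →ₗ[ℚ] V''} {g'' : W →ₗ[ℚ] W''} (hf : ∀ x, f'' x = f' (f x))
    (hg : ∀ x, g'' x = g' (g x)) (t : V ⊗[ℚ] W) :
    TensorProduct.map f'' g'' t = TensorProduct.map f' g' (TensorProduct.map f g t) := by
  have e : f'' = f' ∘ₗ f := LinearMap.ext hf
  have e' : g'' = g' ∘ₗ g := LinearMap.ext hg
  rw [e, e', TensorProduct.map_comp, LinearMap.comp_apply]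

lemma push_eq_self {X : Type} [TopologicalSpace X] {f : C(X, X)} (h : ∀ x, f x = x) (c : Ch X) :
    push f c = c := by
  rw [show f = ContinuousMap.id X from ContinuousMap.ext h, push_id]

lemma push_eq_push_push {X Y Z : Type} [TopologicalSpace X] [TopologicalSpace Y]
    [TopologicalSpace Z] {f : C(X, Y)} {g : C(Y, Z)} {h : C(X, Z)} (e : ∀ x, h x = g (f x))
    (c : Ch X) : push h c = push g (push f c) := by
  rw [show h = g.comp f from ContinuousMap.ext e, push_push]

/-- Pairs of spaces. -/
structure Sp2 : Type 1 where
  A : Type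
  B : Type
  [tA : TopologicalSpace A]
  [tB : TopologicalSpace B]

/-- Triples of spaces. -/
structure Sp3 : Type 1 where
  A : Type
  B : Type
  W : Type
  [tA : TopologicalSpace A]
  [tB : TopologicalSpace B]
  [tW : TopologicalSpace W]

attribute [instance] Sp2.tA Sp2.tB Sp3.tA Sp3.tB Sp3.tW

instance : Category.{0} Sp2 where
  Hom X Y := C(X.A, Y.A) × C(X.B, Y.B)
  id X := (ContinuousMap.id _, ContinuousMap.id _)
  comp f g := (g.1.comp f.1, g.2.comp f.2)

instance : Category.{0} Sp3 where
  Hom X Y := C(X.A, Y.A) × C(X.B, Y.B) × C(X.W, Y.W)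
  id X := (ContinuousMap.id _, ContinuousMap.id _, ContinuousMap.id _)
  comp f g := (g.1.comp f.1, g.2.1.comp f.2.1, g.2.2.comp f.2.2)

/-- Chains of the product of two spaces. -/
@[reducible] noncomputable def chProd : DFun Sp2 where
  obj X := Ch (X.A × X.B)
  map f := push (f.1.prodMap f.2)
  d _ := bdy
  aug _ := aug
  map_id _ x := push_eq_self (fun _ => rfl) x
  map_comp _ _ x := push_eq_push_push (fun _ => rfl) x
  d_map _ x := bdy_push _ x
  d_d _ x := bdy_bdy x
  aug_map _ x := aug_push _ x
  aug_d _ x := aug_bdy x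

/-- The tensor product of the chains of two spaces. -/
@[reducible] noncomputable def chTen : DFun Sp2 where
  obj X := Ch X.A ⊗[ℚ] Ch X.B
  map f := TensorProduct.map (push f.1) (push f.2)
  d X := tenD X.A X.B
  aug X := tenAug X.A X.B
  map_id _ x := ten_map_id push_id push_id x
  map_comp _ _ x := ten_map_comp (fun x => (push_push _ _ x).symm)
    (fun x => (push_push _ _ x).symm) x
  d_map _ x := tenD_map _ _ x
  d_d _ x := tenD_tenD x
  aug_map _ x := tenAug_map _ _ x
  aug_d _ x := tenAug_tenD x

/-- Chains of the product of three spaces. -/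
@[reducible] noncomputable def chTriProd : DFun Sp3 where
  obj X := Ch (X.A × (X.B × X.W))
  map f := push (f.1.prodMap (f.2.1.prodMap f.2.2))
  d _ := bdy
  aug _ := aug
  map_id _ x := push_eq_self (fun _ => rfl) x
  map_comp _ _ x := push_eq_push_push (fun _ => rfl) x
  d_map _ x := bdy_push _ x
  d_d _ x := bdy_bdy x
  aug_map _ x := aug_push _ x
  aug_d _ x := aug_bdy x

/-- The tensor product of the chains of three spaces. -/
@[reducible] noncomputable def chTri : DFun Sp3 where
  obj X := Ch X.A ⊗[ℚ] (Ch X.B ⊗[ℚ] Ch X.W)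
  map f := TensorProduct.map (push f.1) (TensorProduct.map (push f.2.1) (push f.2.2))
  d X := triD X.A X.B X.W
  aug X := LinearMap.mul' ℚ ℚ ∘ₗ TensorProduct.map aug (tenAug X.B X.W)
  map_id _ x := ten_map_id push_id (ten_map_id push_id push_id) x
  map_comp _ _ x := ten_map_comp (fun x => (push_push _ _ x).symm)
    (ten_map_comp (fun x => (push_push _ _ x).symm) (fun x => (push_push _ _ x).symm)) x
  d_map _ x := by
    induction x using ten_induction with
    | h x y => simp [triD_tmul, bdy_push, sgn_push, tenD_map]
    | hadd s t hs ht => simp only [map_add, hs, ht]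
  d_d _ x := by
    induction x using ten_induction with
    | h x y => simp [triD_tmul, bdy_bdy, sgn_bdy, tenD_tenD, TensorProduct.neg_tmul]
    | hadd s t hs ht => simp only [map_add, hs, ht, add_zero]
  aug_map _ x := by
    induction x using ten_induction with
    | h x y => simp [aug_push, tenAug_map]
    | hadd s t hs ht => simp only [map_add, hs, ht]
  aug_d _ x := by
    induction x using ten_induction with
    | h x y => simp [triD_tmul, aug_bdy, tenAug_tenD]
    | hadd s t hs ht => simp only [map_add, hs, ht, add_zero]

/-- The basis of singular simplices. -/
noncomputable def chBasis (X : Type) [TopologicalSpace X] :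
    Module.Basis (Σ n : ℕ, C(Dl n, X)) ℚ (Ch X) := Finsupp.basisSingleOne

lemma chBasis_apply {X : Type} [TopologicalSpace X] {n : ℕ} (σ : C(Dl n, X)) :
    chBasis X ⟨n, σ⟩ = gen σ := by
  rw [chBasis, Finsupp.coe_basisSingleOne]; rfl

lemma gen_eq_push_id {X : Type} [TopologicalSpace X] {n : ℕ} (σ : C(Dl n, X)) :
    gen σ = push σ (gen (ContinuousMap.id _)) := by rw [push_gen, ContinuousMap.comp_id]

open TensorProduct

lemma prod_d_elt (n : ℕ) {S : Set (Ch (Dl n × Dl n))}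
    (hS : ∀ j (τ : C(Dl j, Dl n × Dl n)), j + 1 = n → gen τ ∈ S) :
    bdy (gen ((ContinuousMap.id (Dl n)).prodMk (ContinuousMap.id (Dl n)))) ∈
      Submodule.span ℚ S :=
  map_bdy_gen_mem _ LinearMap.id fun j τ hj => Submodule.subset_span (hS j τ hj)

lemma ten_d_elt {V : Type} [AddCommGroup V] [Module ℚ V] (p q : ℕ)
    (φ : Ch (Dl p) ⊗[ℚ] Ch (Dl q) →ₗ[ℚ] V) {N : Submodule ℚ V}
    (h1 : ∀ j (τ : C(Dl j, Dl p)), j + 1 = p → φ (gen τ ⊗ₜ gen (ContinuousMap.id (Dl q))) ∈ N)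
    (h2 : ∀ j (τ : C(Dl j, Dl q)), j + 1 = q → φ (gen (ContinuousMap.id (Dl p)) ⊗ₜ gen τ) ∈ N) :
    φ (tenD (Dl p) (Dl q) (gen (ContinuousMap.id _) ⊗ₜ gen (ContinuousMap.id _))) ∈ N := by
  rw [tenD_tmul, map_add, sgn_gen, ← TensorProduct.smul_tmul', map_smul]
  refine add_mem ?_ (Submodule.smul_mem _ _ ?_)
  · exact map_bdy_gen_mem _ (φ ∘ₗ (TensorProduct.mk ℚ (Ch (Dl p)) (Ch (Dl q))).flip
      (gen (ContinuousMap.id (Dl q)))) h1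
  · exact map_bdy_gen_mem _ (φ ∘ₗ TensorProduct.mk ℚ (Ch (Dl p)) (Ch (Dl q))
      (gen (ContinuousMap.id (Dl p)))) h2

lemma tri_d_elt (p q r : ℕ) {N : Submodule ℚ (Ch (Dl p) ⊗[ℚ] (Ch (Dl q) ⊗[ℚ] Ch (Dl r)))}
    (h1 : ∀ j (τ : C(Dl j, Dl p)), j + 1 = p → gen τ ⊗ₜ (gen (ContinuousMap.id (Dl q)) ⊗ₜ
      gen (ContinuousMap.id (Dl r))) ∈ N)
    (h2 : ∀ j (τ : C(Dl j, Dl q)), j + 1 = q → gen (ContinuousMap.id (Dl p)) ⊗ₜ (gen τ ⊗ₜ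
      gen (ContinuousMap.id (Dl r))) ∈ N)
    (h3 : ∀ j (τ : C(Dl j, Dl r)), j + 1 = r → gen (ContinuousMap.id (Dl p)) ⊗ₜ
      (gen (ContinuousMap.id (Dl q)) ⊗ₜ gen τ) ∈ N) :
    triD (Dl p) (Dl q) (Dl r) (gen (ContinuousMap.id _) ⊗ₜ (gen (ContinuousMap.id _) ⊗ₜ
      gen (ContinuousMap.id _))) ∈ N := by
  rw [triD_tmul, sgn_gen, ← TensorProduct.smul_tmul']
  refine add_mem ?_ (Submodule.smul_mem _ _ ?_)
  · exact map_bdy_gen_mem _ ((TensorProduct.mk ℚ (Ch (Dl p)) (Ch (Dl q) ⊗[ℚ] Ch (Dl r))).flip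
      (gen (ContinuousMap.id (Dl q)) ⊗ₜ gen (ContinuousMap.id (Dl r)))) h1
  · exact ten_d_elt q r (TensorProduct.mk ℚ (Ch (Dl p)) (Ch (Dl q) ⊗[ℚ] Ch (Dl r))
      (gen (ContinuousMap.id (Dl p)))) h2 h3

/-- The basis of the chains of a product indexed by pairs of simplices. -/
noncomputable def prodBasis (X : Sp2) :
    Module.Basis (Σ n : ℕ, C(Dl n, X.A) × C(Dl n, X.B)) ℚ (Ch (X.A × X.B)) :=
  (chBasis (X.A × X.B)).reindex
    { toFun := fun s => ⟨s.1, (ContinuousMap.fst.comp s.2, ContinuousMap.snd.comp s.2)⟩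
      invFun := fun s => ⟨s.1, s.2.1.prodMk s.2.2⟩
      left_inv := fun _ => rfl
      right_inv := fun _ => rfl }

lemma prodBasis_apply (X : Sp2) (n : ℕ) (f : C(Dl n, X.A) × C(Dl n, X.B)) :
    prodBasis X ⟨n, f⟩ = push (f.1.prodMap f.2)
      (gen ((ContinuousMap.id (Dl n)).prodMk (ContinuousMap.id (Dl n)))) := by
  rw [prodBasis, Module.Basis.reindex_apply, push_gen]
  exact chBasis_apply _

/-- The basis of the tensor product of chains indexed by pairs of simplices. -/
noncomputable def tenBasis (X : Sp2) :
    Module.Basis (Σ n : ℕ × ℕ, C(Dl n.1, X.A) × C(Dl n.2, X.B)) ℚ (Ch X.A ⊗[ℚ] Ch X.B) :=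
  ((chBasis X.A).tensorProduct (chBasis X.B)).reindex
    { toFun := fun s => ⟨(s.1.1, s.2.1), (s.1.2, s.2.2)⟩
      invFun := fun s => (⟨s.1.1, s.2.1⟩, ⟨s.1.2, s.2.2⟩)
      left_inv := fun _ => rfl
      right_inv := fun _ => rfl }

lemma tenBasis_apply (X : Sp2) (n : ℕ × ℕ) (f : C(Dl n.1, X.A) × C(Dl n.2, X.B)) :
    tenBasis X ⟨n, f⟩ = TensorProduct.map (push f.1) (push f.2)
      (gen (ContinuousMap.id _) ⊗ₜ gen (ContinuousMap.id _)) := by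
  rw [tenBasis, Module.Basis.reindex_apply, TensorProduct.map_tmul, ← gen_eq_push_id,
    ← gen_eq_push_id]
  refine (Module.Basis.tensorProduct_apply _ _ _ _).trans ?_
  rw [chBasis_apply, chBasis_apply]

/-- The basis of the triple tensor product of chains indexed by triples of simplices. -/
noncomputable def triBasis (X : Sp3) :
    Module.Basis (Σ n : ℕ × ℕ × ℕ, C(Dl n.1, X.A) × C(Dl n.2.1, X.B) × C(Dl n.2.2, X.W)) ℚ
      (Ch X.A ⊗[ℚ] (Ch X.B ⊗[ℚ] Ch X.W)) :=
  ((chBasis X.A).tensorProduct ((chBasis X.B).tensorProduct (chBasis X.W))).reindex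
    { toFun := fun s => ⟨(s.1.1, s.2.1.1, s.2.2.1), (s.1.2, s.2.1.2, s.2.2.2)⟩
      invFun := fun s => (⟨s.1.1, s.2.1⟩, ⟨s.1.2.1, s.2.2.1⟩, ⟨s.1.2.2, s.2.2.2⟩)
      left_inv := fun _ => rfl
      right_inv := fun _ => rfl }

lemma triBasis_apply (X : Sp3) (n : ℕ × ℕ × ℕ)
    (f : C(Dl n.1, X.A) × C(Dl n.2.1, X.B) × C(Dl n.2.2, X.W)) :
    triBasis X ⟨n, f⟩ = TensorProduct.map (push f.1) (TensorProduct.map (push f.2.1) (push f.2.2))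
      (gen (ContinuousMap.id _) ⊗ₜ (gen (ContinuousMap.id _) ⊗ₜ gen (ContinuousMap.id _))) := by
  rw [triBasis, Module.Basis.reindex_apply, TensorProduct.map_tmul, TensorProduct.map_tmul,
    ← gen_eq_push_id, ← gen_eq_push_id, ← gen_eq_push_id]
  refine (Module.Basis.tensorProduct_apply _ _ _ _).trans ?_
  rw [chBasis_apply]
  congr 1
  refine (Module.Basis.tensorProduct_apply _ _ _ _).trans ?_
  rw [chBasis_apply, chBasis_apply]

lemma gen_eq_push_diag {A B : Type} [TopologicalSpace A] [TopologicalSpace B] {n : ℕ}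
    (τ : C(Dl n, A × B)) :
    gen τ = push ((ContinuousMap.fst.comp τ).prodMap (ContinuousMap.snd.comp τ))
      (gen ((ContinuousMap.id (Dl n)).prodMk (ContinuousMap.id (Dl n)))) := by
  rw [push_gen]
  rfl

lemma ten_gen_eq {A B : Type} [TopologicalSpace A] [TopologicalSpace B] {p q : ℕ}
    (σ : C(Dl p, A)) (τ : C(Dl q, B)) :
    gen σ ⊗ₜ gen τ = TensorProduct.map (push σ) (push τ)
      (gen (ContinuousMap.id _) ⊗ₜ[ℚ] gen (ContinuousMap.id _)) := by
  rw [TensorProduct.map_tmul, ← gen_eq_push_id, ← gen_eq_push_id]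

lemma tri_gen_eq {A B W : Type} [TopologicalSpace A] [TopologicalSpace B] [TopologicalSpace W]
    {p q r : ℕ} (σ : C(Dl p, A)) (τ : C(Dl q, B)) (ρ : C(Dl r, W)) :
    gen σ ⊗ₜ (gen τ ⊗ₜ gen ρ) = TensorProduct.map (push σ) (TensorProduct.map (push τ) (push ρ))
      (gen (ContinuousMap.id _) ⊗ₜ[ℚ] (gen (ContinuousMap.id _) ⊗ₜ[ℚ]
        gen (ContinuousMap.id _))) := by
  rw [TensorProduct.map_tmul, ← gen_eq_push_id, ← ten_gen_eq]

/-- Chains of products are free on diagonals of simplices. -/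
@[reducible] noncomputable def chProdModels : chProd.Models where
  I := ℕ
  deg n := n
  m n := ⟨Dl n, Dl n⟩
  elt n := (gen ((ContinuousMap.id (Dl n)).prodMk (ContinuousMap.id (Dl n))) : Ch (Dl n × Dl n))
  basis X := prodBasis X
  basis_apply X n f := prodBasis_apply X n f
  d_elt n := prod_d_elt n fun j τ hj =>
    ⟨j, (ContinuousMap.fst.comp τ, ContinuousMap.snd.comp τ), hj, gen_eq_push_diag τ⟩

/-- Tensor products of chains are free on products of simplices. -/
@[reducible] noncomputable def chTenModels : chTen.Models where
  I := ℕ × ℕ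
  deg i := i.1 + i.2
  m i := ⟨Dl i.1, Dl i.2⟩
  elt i := (gen (ContinuousMap.id (Dl i.1)) ⊗ₜ gen (ContinuousMap.id (Dl i.2)) :
    Ch (Dl i.1) ⊗[ℚ] Ch (Dl i.2))
  basis X := tenBasis X
  basis_apply X n f := tenBasis_apply X n f
  d_elt i := by
    refine ten_d_elt i.1 i.2 LinearMap.id (fun j τ hj => Submodule.subset_span
      ⟨(j, i.2), (τ, ContinuousMap.id _), by dsimp only; omega, ?_⟩)
      (fun j τ hj => Submodule.subset_span
      ⟨(i.1, j), (ContinuousMap.id _, τ), by dsimp only; omega, ?_⟩)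
    · exact ten_gen_eq τ (ContinuousMap.id (Dl i.2))
    · exact ten_gen_eq (ContinuousMap.id (Dl i.1)) τ

/-- Triple tensor products of chains are free on products of simplices. -/
@[reducible] noncomputable def chTriModels : chTri.Models where
  I := ℕ × ℕ × ℕ
  deg i := i.1 + (i.2.1 + i.2.2)
  m i := ⟨Dl i.1, Dl i.2.1, Dl i.2.2⟩
  elt i := (gen (ContinuousMap.id (Dl i.1)) ⊗ₜ (gen (ContinuousMap.id (Dl i.2.1)) ⊗ₜ
    gen (ContinuousMap.id (Dl i.2.2))) : Ch (Dl i.1) ⊗[ℚ] (Ch (Dl i.2.1) ⊗[ℚ] Ch (Dl i.2.2)))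
  basis X := triBasis X
  basis_apply X n f := triBasis_apply X n f
  d_elt i := by
    refine tri_d_elt i.1 i.2.1 i.2.2 (fun j τ hj => Submodule.subset_span
      ⟨(j, i.2.1, i.2.2), (τ, ContinuousMap.id _, ContinuousMap.id _), by dsimp only; omega, ?_⟩)
      (fun j τ hj => Submodule.subset_span
      ⟨(i.1, j, i.2.2), (ContinuousMap.id _, τ, ContinuousMap.id _), by dsimp only; omega, ?_⟩)
      (fun j τ hj => Submodule.subset_span
      ⟨(i.1, i.2.1, j), (ContinuousMap.id _, ContinuousMap.id _, τ), by dsimp only; omega, ?_⟩)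
    · exact tri_gen_eq τ (ContinuousMap.id (Dl i.2.1)) (ContinuousMap.id (Dl i.2.2))
    · exact tri_gen_eq (ContinuousMap.id (Dl i.1)) τ (ContinuousMap.id (Dl i.2.2))
    · exact tri_gen_eq (ContinuousMap.id (Dl i.1)) (ContinuousMap.id (Dl i.2.1)) τ

open TensorProduct

/-- The inclusion of a slice of a product. -/
def slice {A B : Type} [TopologicalSpace A] [TopologicalSpace B] (a : A) : C(B, A × B) :=
  (ContinuousMap.const B a).prodMk (ContinuousMap.id B)

lemma slice_model {p q : ℕ} (c : Dl p) {D : Ch (Dl p) ⊗[ℚ] Ch (Dl q) →ₗ[ℚ] Ch (Dl p × Dl q)}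
    (hp : p = 0)
    (hD : ∀ r (τ : C(Dl r, Dl q)), D (gen (ContinuousMap.id (Dl p)) ⊗ₜ gen τ) =
      push (slice c) (gen τ)) :
    bdy (push (slice c) (gen (ContinuousMap.id (Dl q)))) =
      D (tenD _ _ (gen (ContinuousMap.id (Dl p)) ⊗ₜ gen (ContinuousMap.id (Dl q)))) := by
  have h : ∀ b, D (gen (ContinuousMap.id (Dl p)) ⊗ₜ b) = push (slice c) b := by
    suffices e : D ∘ₗ TensorProduct.mk ℚ _ _ (gen (ContinuousMap.id (Dl p))) = push (slice c) from
      LinearMap.congr_fun e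
    exact ch_hom_ext hD
  have e1 : bdy (gen (ContinuousMap.id (Dl p))) = 0 := by
    subst hp
    exact bdy_gen_zero _
  have e2 : sgn (gen (ContinuousMap.id (Dl p))) = gen (ContinuousMap.id (Dl p)) := by
    rw [sgn_gen, hp, pow_zero, one_smul]
  rw [tenD_tmul, e1, zero_tmul, zero_add, e2, h, bdy_push]

theorem exists_cross : ∃ h : ∀ X : Sp2, Ch X.A ⊗[ℚ] Ch X.B →ₗ[ℚ] Ch (X.A × X.B),
    (∀ {X Y : Sp2} (f : C(X.A, Y.A)) (g : C(X.B, Y.B)) (t : Ch X.A ⊗[ℚ] Ch X.B),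
      h Y (TensorProduct.map (push f) (push g) t) = push (f.prodMap g) (h X t)) ∧
    (∀ (X : Sp2) t, bdy (h X t) = h X (tenD X.A X.B t)) ∧
    (∀ (X : Sp2) t, aug (h X t) = tenAug X.A X.B t) ∧
    (∀ q, h ⟨Dl 0, Dl q⟩ (gen (ContinuousMap.id (Dl 0)) ⊗ₜ gen (ContinuousMap.id (Dl q))) =
      push (slice (stdSimplex.vertex 0)) (gen (ContinuousMap.id (Dl q)))) ∧
    ∀ p q, h ⟨Dl p, Dl q⟩ (gen (ContinuousMap.id (Dl p)) ⊗ₜ gen (ContinuousMap.id (Dl q))) ∈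
      dgs {p + q} := by
  choose κ a hκ hκa hκd using fun i : ℕ × ℕ => exists_contraction (Dl i.1 × Dl i.2)
  refine Exists.elim (chTenModels.solve (G := chProd) (fun _ => 0)
    (fun _ _ => (map_zero _).symm) 1 1 (fun _ _ => by simp) (fun _ _ => map_zero _)
    {i | i.1 = 0} (fun i => (push (slice (stdSimplex.vertex 0)) (gen (ContinuousMap.id (Dl i.2))) :
      Ch (Dl i.1 × Dl i.2))) ?_ ?_ ?_ κ _ hκ hκa (fun n X => dgs (X := X.A × X.B) {n})
      (fun n X Y f x hx => push_dgs _ hx) ?_ ?_ (fun i n x hx => hκd i n x hx))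
    fun h ⟨hn, hd, ha, hP, hQ⟩ => ?_
  · intro h hn hP i hi
    rw [LinearMap.zero_apply, zero_add, one_smul]
    refine slice_model (D := h ⟨Dl i.1, Dl i.2⟩) (stdSimplex.vertex 0) hi fun r τ => ?_
    have e := hP (i.1, r) hi
    have e' := hn (X := ⟨Dl i.1, Dl r⟩) (Y := ⟨Dl i.1, Dl i.2⟩) (ContinuousMap.id (Dl i.1), τ)
      (gen (ContinuousMap.id (Dl i.1)) ⊗ₜ gen (ContinuousMap.id (Dl r)))
    refine (congrArg (h _) (ten_gen_eq (ContinuousMap.id (Dl i.1)) τ)).trans (e'.trans ?_)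
    refine (congrArg (push ((ContinuousMap.id (Dl i.1)).prodMap τ)) e).trans ?_
    rw [push_gen, push_gen, push_gen]
    rfl
  · intro i (hi : i.1 = 0)
    refine (?_ : aug (push (slice (A := Dl i.1) (stdSimplex.vertex 0))
      (gen (ContinuousMap.id (Dl i.2)))) =
      1 * (aug (gen (ContinuousMap.id (Dl i.1))) * aug (gen (ContinuousMap.id (Dl i.2)))))
    rw [aug_push, aug_gen, aug_gen, if_pos hi, one_mul, one_mul]
  · intro i (hi : ¬ i.1 = 0)
    refine (?_ : 1 * (aug (gen (ContinuousMap.id (Dl i.1))) * aug (gen (ContinuousMap.id (Dl i.2))))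
      = 0)
    rw [aug_gen, if_neg hi, zero_mul, mul_zero]
  · intro i (hi : i.1 = 0)
    have : chTenModels.deg i = i.2 := by
      change i.1 + i.2 = i.2
      omega
    rw [this]
    exact push_dgs _ (gen_mem_dgs _)
  · intro i
    rw [LinearMap.zero_apply, map_zero]
    exact zero_mem _
  · refine ⟨h, fun f g t => hn (f, g) t, fun X t => ?_, fun X t => ?_, fun q => hP (0, q) rfl,
      fun p q => hQ (p, q)⟩
    · have := hd X t
      rw [LinearMap.zero_apply, zero_add, one_smul] at this
      exact this
    · have := ha X t
      rw [one_mul] at this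
      exact this

variable {A B A' B' : Type} [TopologicalSpace A] [TopologicalSpace B] [TopologicalSpace A']
  [TopologicalSpace B']

variable (A B) in
/-- The cross product. -/
noncomputable def cross : Ch A ⊗[ℚ] Ch B →ₗ[ℚ] Ch (A × B) := exists_cross.choose ⟨A, B⟩

lemma cross_map (f : C(A, A')) (g : C(B, B')) (t : Ch A ⊗[ℚ] Ch B) :
    cross A' B' (TensorProduct.map (push f) (push g) t) = push (f.prodMap g) (cross A B t) :=
  exists_cross.choose_spec.1 (X := ⟨A, B⟩) (Y := ⟨A', B'⟩) f g t

lemma cross_push (f : C(A, A')) (g : C(B, B')) (a : Ch A) (b : Ch B) :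
    cross A' B' (push f a ⊗ₜ push g b) = push (f.prodMap g) (cross A B (a ⊗ₜ b)) :=
  cross_map f g (a ⊗ₜ b)

lemma bdy_cross (t : Ch A ⊗[ℚ] Ch B) : bdy (cross A B t) = cross A B (tenD A B t) :=
  exists_cross.choose_spec.2.1 ⟨A, B⟩ t

lemma aug_cross (t : Ch A ⊗[ℚ] Ch B) : aug (cross A B t) = tenAug A B t :=
  exists_cross.choose_spec.2.2.1 ⟨A, B⟩ t

lemma cross_gen_point (σ : C(Dl 0, A)) (b : Ch B) :
    cross A B (gen σ ⊗ₜ b) = push (slice (σ (stdSimplex.vertex 0))) b := by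
  suffices e : cross A B ∘ₗ TensorProduct.mk ℚ _ _ (gen σ) =
      push (slice (σ (stdSimplex.vertex 0))) from LinearMap.congr_fun e b
  refine ch_hom_ext fun q τ => ?_
  have h := exists_cross.choose_spec.2.2.2.1 q
  have := cross_push σ τ (gen (ContinuousMap.id _)) (gen (ContinuousMap.id _))
  rw [← gen_eq_push_id, ← gen_eq_push_id] at this
  refine this.trans ((congrArg _ h).trans ?_)
  rw [push_gen, push_gen, push_gen]
  rfl

lemma cross_mem_dgs {p q : ℕ} {a : Ch A} {b : Ch B} (ha : a ∈ dgs {p}) (hb : b ∈ dgs {q}) :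
    cross A B (a ⊗ₜ b) ∈ dgs {p + q} := by
  refine map_mem_of_gen (cross A B ∘ₗ (TensorProduct.mk ℚ _ _).flip b) _ (fun p' σ hσ => ?_) ha
  obtain rfl : p' = p := hσ
  refine map_mem_of_gen (cross A B ∘ₗ TensorProduct.mk ℚ _ _ (gen σ)) _ (fun q' τ hτ => ?_) hb
  obtain rfl : q' = q := hτ
  rw [LinearMap.comp_apply, TensorProduct.mk_apply, gen_eq_push_id σ, gen_eq_push_id τ, cross_push]
  exact push_dgs _ (exists_cross.choose_spec.2.2.2.2 p' q')

open TensorProduct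

lemma zero_add_one_smul {V : Type*} [AddCommGroup V] [Module ℚ V] (v : V) :
    0 + (1 : ℚ) • v = v := by rw [one_smul, zero_add]

theorem exists_aw : ∃ h : ∀ X : Sp2, Ch (X.A × X.B) →ₗ[ℚ] Ch X.A ⊗[ℚ] Ch X.B,
    (∀ {X Y : Sp2} (f : C(X.A, Y.A)) (g : C(X.B, Y.B)) (c : Ch (X.A × X.B)),
      h Y (push (f.prodMap g) c) = TensorProduct.map (push f) (push g) (h X c)) ∧
    (∀ (X : Sp2) c, tenD X.A X.B (h X c) = h X (bdy c)) ∧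
    ∀ (X : Sp2) c, tenAug X.A X.B (h X c) = aug c := by
  choose κ a hκ hκa using fun i : ℕ => exists_ten_contraction (Dl i) (Dl i)
  refine Exists.elim (chProdModels.solve (G := chTen) (fun _ => 0)
    (fun _ _ => (map_zero _).symm) 1 1 (fun _ _ => by simp) (fun _ _ => map_zero _)
    {0} (fun i => (gen (ContinuousMap.id (Dl i)) ⊗ₜ gen (ContinuousMap.id (Dl i)) :
      Ch (Dl i) ⊗[ℚ] Ch (Dl i))) ?_ ?_ ?_ κ _ hκ hκa (fun n X => ⊤)
      (fun n X Y f x hx => trivial) (fun _ _ => trivial) (fun _ => trivial)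
      (fun i n x hx => trivial))
    fun h ⟨hn, hd, ha, hP, hQ⟩ => ?_
  · rintro h hn hP i rfl
    refine Eq.trans ?_ (zero_add_one_smul _).symm
    refine (?_ : bdy (gen (ContinuousMap.id (Dl 0))) ⊗ₜ _ + sgn (gen (ContinuousMap.id (Dl 0))) ⊗ₜ
      bdy (gen (ContinuousMap.id (Dl 0))) = h ⟨Dl 0, Dl 0⟩
        (bdy (gen ((ContinuousMap.id (Dl 0)).prodMk (ContinuousMap.id (Dl 0))))))
    rw [bdy_gen_zero, bdy_gen_zero, map_zero, zero_tmul, tmul_zero, add_zero]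
  · rintro i rfl
    refine (?_ : aug (gen (ContinuousMap.id (Dl 0))) * aug (gen (ContinuousMap.id (Dl 0))) =
      1 * aug (gen ((ContinuousMap.id (Dl 0)).prodMk (ContinuousMap.id (Dl 0)))))
    simp [aug_gen]
  · intro i (hi : ¬ i = 0)
    refine (?_ : 1 * aug (gen ((ContinuousMap.id (Dl i)).prodMk (ContinuousMap.id (Dl i)))) = 0)
    rw [aug_gen, if_neg hi, mul_zero]
  · refine ⟨h, fun f g t => hn (f, g) t, fun X t => ?_, fun X t => ?_⟩
    · have := hd X t
      rw [LinearMap.zero_apply, zero_add, one_smul] at this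
      exact this
    · have := ha X t
      rw [one_mul] at this
      exact this

variable {A B A' B' W W' : Type} [TopologicalSpace A] [TopologicalSpace B] [TopologicalSpace A']
  [TopologicalSpace B'] [TopologicalSpace W] [TopologicalSpace W']

variable (A B) in
/-- The Alexander–Whitney map. -/
noncomputable def aw : Ch (A × B) →ₗ[ℚ] Ch A ⊗[ℚ] Ch B := exists_aw.choose ⟨A, B⟩

lemma aw_push (f : C(A, A')) (g : C(B, B')) (c : Ch (A × B)) :
    aw A' B' (push (f.prodMap g) c) = TensorProduct.map (push f) (push g) (aw A B c) :=
  exists_aw.choose_spec.1 (X := ⟨A, B⟩) (Y := ⟨A', B'⟩) f g c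

lemma tenD_aw (c : Ch (A × B)) : tenD A B (aw A B c) = aw A B (bdy c) :=
  exists_aw.choose_spec.2.1 ⟨A, B⟩ c

lemma tenAug_aw (c : Ch (A × B)) : tenAug A B (aw A B c) = aug c :=
  exists_aw.choose_spec.2.2 ⟨A, B⟩ c

/-- Natural chain maps with the same augmentation on a free functor are chain homotopic. -/
lemma DFun.Models.exists_homotopy {C : Type 1} [Category.{0} C] {S G : DFun C} (F : S.Models)
    (p q : ∀ X, S.obj X →ₗ[ℚ] G.obj X)
    (hp : ∀ {X Y : C} (f : X ⟶ Y) x, p Y (S.map f x) = G.map f (p X x))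
    (hq : ∀ {X Y : C} (f : X ⟶ Y) x, q Y (S.map f x) = G.map f (q X x))
    (hpd : ∀ X x, G.d X (p X x) = p X (S.d X x)) (hqd : ∀ X x, G.d X (q X x) = q X (S.d X x))
    (ha : ∀ X x, G.aug X (p X x) = G.aug X (q X x))
    (hκ : ∀ i, ∃ (κ : G.obj (F.m i) →ₗ[ℚ] G.obj (F.m i)) (a : G.obj (F.m i)),
      (∀ x, G.d _ (κ x) + κ (G.d _ x) = x - G.aug _ x • a) ∧ ∀ x, G.aug _ (κ x) = 0) (X : C) :
    ∃ h : S.obj X →ₗ[ℚ] G.obj X, ∀ x, G.d X (h x) + h (S.d X x) = p X x - q X x := by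
  choose κ a hκ hκa using hκ
  obtain ⟨h, -, hd, -⟩ := F.solve (fun X => p X - q X)
    (fun f x => by simp only [LinearMap.sub_apply, hp, hq, map_sub]) (-1) 0
    (fun X x => by simp only [LinearMap.sub_apply, hpd, hqd, map_sub]; module)
    (fun X x => by simp only [LinearMap.sub_apply, ha, map_sub, sub_self]) ∅ (fun _ => 0)
    (fun _ _ _ i hi => hi.elim) (fun i hi => hi.elim) (fun i _ => zero_mul _) κ a hκ hκa
    (fun _ _ => ⊤) (fun _ _ _ _ _ _ => trivial) (fun _ _ => trivial) (fun _ => trivial)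
    (fun _ _ _ _ => trivial)
  refine ⟨h X, fun x => ?_⟩
  rw [hd, LinearMap.sub_apply]
  module

variable (A B) in
theorem exists_cross_aw : ∃ h : Ch (A × B) →ₗ[ℚ] Ch (A × B), ∀ c,
    bdy (h c) + h (bdy c) = cross A B (aw A B c) - c := by
  refine chProdModels.exists_homotopy (G := chProd) (fun X => cross X.A X.B ∘ₗ aw X.A X.B)
    (fun X => LinearMap.id) (fun f x => ?_) (fun _ _ => rfl) (fun X x => ?_) (fun _ _ => rfl)
    (fun X x => ?_) (fun i => ?_) ⟨A, B⟩
  · exact (congrArg _ (aw_push _ _ _)).trans (cross_map _ _ _)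
  · exact (bdy_cross _).trans (congrArg _ (tenD_aw _))
  · exact (aug_cross _).trans (tenAug_aw _)
  · obtain ⟨κ, a, h, h', -⟩ := exists_contraction (Dl i × Dl i)
    exact ⟨κ, _, h, h'⟩

variable (A B) in
theorem exists_aw_cross : ∃ h : Ch A ⊗[ℚ] Ch B →ₗ[ℚ] Ch A ⊗[ℚ] Ch B, ∀ t,
    tenD A B (h t) + h (tenD A B t) = aw A B (cross A B t) - t := by
  refine chTenModels.exists_homotopy (G := chTen) (fun X => aw X.A X.B ∘ₗ cross X.A X.B)
    (fun X => LinearMap.id) (fun f x => ?_) (fun _ _ => rfl) (fun X x => ?_) (fun _ _ => rfl)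
    (fun X x => ?_) (fun i => ?_) ⟨A, B⟩
  · exact (congrArg _ (cross_map _ _ _)).trans (aw_push _ _ _)
  · exact (tenD_aw _).trans (congrArg _ (bdy_cross _))
  · exact (tenAug_aw _).trans (aug_cross _)
  · exact exists_ten_contraction (Dl i.1) (Dl i.2)

open TensorProduct

section Abstract

variable {U V W : Type} [AddCommGroup U] [Module ℚ U] [AddCommGroup V] [Module ℚ V]
  [AddCommGroup W] [Module ℚ W]

/-- The swap of the first two factors with signs given by involutions. -/
noncomputable def signedSwap (s : U →ₗ[ℚ] U) (s' : V →ₗ[ℚ] V) :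
    U ⊗[ℚ] (V ⊗[ℚ] W) →ₗ[ℚ] V ⊗[ℚ] (U ⊗[ℚ] W) :=
  (TensorProduct.map LinearMap.id (TensorProduct.map ((1 / 2 : ℚ) • (LinearMap.id + s))
      LinearMap.id) + TensorProduct.map s' (TensorProduct.map ((1 / 2 : ℚ) • (LinearMap.id - s))
      LinearMap.id)) ∘ₗ (TensorProduct.leftComm ℚ U V W).toLinearMap

lemma signedSwap_tmul (s : U →ₗ[ℚ] U) (s' : V →ₗ[ℚ] V) (a : U) (b : V) (w : W) :
    signedSwap s s' (a ⊗ₜ (b ⊗ₜ w)) = b ⊗ₜ (((1 / 2 : ℚ) • (a + s a)) ⊗ₜ w) +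
      s' b ⊗ₜ (((1 / 2 : ℚ) • (a - s a)) ⊗ₜ w) := rfl

lemma signedSwap_d {s d : U →ₗ[ℚ] U} {s' d' : V →ₗ[ℚ] V} {d'' : W →ₗ[ℚ] W}
    (hs : ∀ a, s (s a) = a) (hs' : ∀ b, s' (s' b) = b) (hd : ∀ a, d (s a) = - s (d a))
    (hd' : ∀ b, d' (s' b) = - s' (d' b)) (t : U ⊗[ℚ] (V ⊗[ℚ] W)) :
    (TensorProduct.map d' LinearMap.id + TensorProduct.map s' (TensorProduct.map d LinearMap.id +
      TensorProduct.map s d'') : V ⊗[ℚ] (U ⊗[ℚ] W) →ₗ[ℚ] V ⊗[ℚ] (U ⊗[ℚ] W)) (signedSwap s s' t) =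
    signedSwap s s' ((TensorProduct.map d LinearMap.id + TensorProduct.map s
      (TensorProduct.map d' LinearMap.id + TensorProduct.map s' d'') :
      U ⊗[ℚ] (V ⊗[ℚ] W) →ₗ[ℚ] U ⊗[ℚ] (V ⊗[ℚ] W)) t) := by
  induction t using ten_induction with
  | hadd x y hx hy => rw [map_add, map_add, map_add, map_add, hx, hy]
  | h a u =>
    induction u using ten_induction with
    | hadd x y hx hy => simp only [tmul_add, map_add, hx, hy]
    | h b w =>
      simp only [signedSwap_tmul, map_add, LinearMap.add_apply, TensorProduct.map_tmul,
        LinearMap.id_apply, map_smul, hs, hs', hd, hd', map_sub, tmul_add, smul_add, add_tmul,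
        smul_sub, sub_tmul, tmul_sub, neg_tmul, tmul_neg, smul_neg, ← smul_tmul', tmul_smul]
      module

lemma signedSwap_map {U' V' W' : Type} [AddCommGroup U'] [Module ℚ U'] [AddCommGroup V']
    [Module ℚ V'] [AddCommGroup W'] [Module ℚ W'] {s : U →ₗ[ℚ] U} {s' : V →ₗ[ℚ] V}
    {r : U' →ₗ[ℚ] U'} {r' : V' →ₗ[ℚ] V'} {f : U →ₗ[ℚ] U'} {g : V →ₗ[ℚ] V'} {h : W →ₗ[ℚ] W'}
    (hf : ∀ a, r (f a) = f (s a)) (hg : ∀ a, r' (g a) = g (s' a)) (t : U ⊗[ℚ] (V ⊗[ℚ] W)) :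
    signedSwap r r' (TensorProduct.map f (TensorProduct.map g h) t) =
      TensorProduct.map g (TensorProduct.map f h) (signedSwap s s' t) := by
  induction t using ten_induction with
  | hadd x y hx hy => rw [map_add, map_add, map_add, map_add, hx, hy]
  | h a u =>
    induction u using ten_induction with
    | hadd x y hx hy => simp only [tmul_add, map_add, hx, hy]
    | h b w =>
      simp only [signedSwap_tmul, TensorProduct.map_tmul, map_add, hf, hg, map_smul, map_sub]

lemma signedSwap_aug {s : U →ₗ[ℚ] U} {s' : V →ₗ[ℚ] V} {α : U →ₗ[ℚ] ℚ} {β : V →ₗ[ℚ] ℚ}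
    {γ : W →ₗ[ℚ] ℚ} (hα : ∀ a, α (s a) = α a) (t : U ⊗[ℚ] (V ⊗[ℚ] W)) :
    (LinearMap.mul' ℚ ℚ ∘ₗ TensorProduct.map β (LinearMap.mul' ℚ ℚ ∘ₗ TensorProduct.map α γ))
      (signedSwap s s' t) =
    (LinearMap.mul' ℚ ℚ ∘ₗ TensorProduct.map α
      (LinearMap.mul' ℚ ℚ ∘ₗ TensorProduct.map β γ)) t := by
  induction t using ten_induction with
  | hadd x y hx hy => rw [map_add, map_add, map_add, hx, hy]
  | h a u =>
    induction u using ten_induction with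
    | hadd x y hx hy => simp only [tmul_add, map_add, hx, hy]
    | h b w =>
      simp only [signedSwap_tmul, map_add, LinearMap.comp_apply, TensorProduct.map_tmul,
        LinearMap.mul'_apply, map_smul, map_sub, hα, smul_eq_mul]
      ring

lemma signedSwap_of_eigen {s : U →ₗ[ℚ] U} {s' : V →ₗ[ℚ] V} {a : U} {b : V} (w : W) {p q : ℕ}
    (ha : s a = (-1 : ℚ) ^ p • a) (hb : s' b = (-1 : ℚ) ^ q • b) :
    signedSwap s s' (a ⊗ₜ (b ⊗ₜ w)) = (-1 : ℚ) ^ (p * q) • (b ⊗ₜ[ℚ] (a ⊗ₜ[ℚ] w)) := by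
  rw [signedSwap_tmul, ha, hb]
  rcases Nat.even_or_odd p with hp | hp
  · rw [hp.neg_one_pow, (hp.mul_right q).neg_one_pow, one_smul, sub_self, smul_zero, zero_tmul,
      tmul_zero, add_zero, ← two_smul ℚ, smul_smul, one_smul]
    norm_num
  · rw [hp.neg_one_pow, pow_mul, hp.neg_one_pow, neg_one_smul, add_neg_cancel, smul_zero,
      zero_tmul, tmul_zero, zero_add, sub_neg_eq_add, ← two_smul ℚ, smul_smul, ← smul_tmul']
    norm_num

end Abstract

variable {A B A' B' W W' : Type} [TopologicalSpace A] [TopologicalSpace B] [TopologicalSpace A']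
  [TopologicalSpace B'] [TopologicalSpace W] [TopologicalSpace W']

variable (A B W) in
/-- The triple cross product. -/
noncomputable def cross₃ : Ch A ⊗[ℚ] (Ch B ⊗[ℚ] Ch W) →ₗ[ℚ] Ch (A × (B × W)) :=
  cross A (B × W) ∘ₗ TensorProduct.map LinearMap.id (cross B W)

lemma cross₃_tmul (a : Ch A) (b : Ch B) (w : Ch W) :
    cross₃ A B W (a ⊗ₜ (b ⊗ₜ w)) = cross A (B × W) (a ⊗ₜ cross B W (b ⊗ₜ w)) := rfl

lemma bdy_cross₃ (t : Ch A ⊗[ℚ] (Ch B ⊗[ℚ] Ch W)) :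
    bdy (cross₃ A B W t) = cross₃ A B W (triD A B W t) := by
  induction t using ten_induction with
  | hadd x y hx hy => simp only [map_add, hx, hy]
  | h a u => simp [cross₃, bdy_cross, tenD_tmul, triD_tmul]

lemma cross₃_map (f : C(A, A')) (g : C(B, B')) (h : C(W, W')) (t : Ch A ⊗[ℚ] (Ch B ⊗[ℚ] Ch W)) :
    cross₃ A' B' W' (TensorProduct.map (push f) (TensorProduct.map (push g) (push h)) t) =
      push (f.prodMap (g.prodMap h)) (cross₃ A B W t) := by
  induction t using ten_induction with
  | hadd x y hx hy => simp only [map_add, hx, hy]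
  | h a u =>
    refine (?_ : cross A' (B' × W') (push f a ⊗ₜ
      cross B' W' (TensorProduct.map (push g) (push h) u))
      = push _ (cross A (B × W) (a ⊗ₜ cross B W u)))
    rw [cross_map, cross_push]

lemma aug_cross₃ (t : Ch A ⊗[ℚ] (Ch B ⊗[ℚ] Ch W)) : aug (cross₃ A B W t) =
    (LinearMap.mul' ℚ ℚ ∘ₗ TensorProduct.map aug (tenAug B W)) t := by
  induction t using ten_induction with
  | hadd x y hx hy => simp only [map_add, hx, hy]
  | h a u => simp [cross₃, aug_cross, tenAug_tmul]

variable (A B W) in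
/-- The swap of the first two factors of a triple product. -/
def swapLeft : C(B × (A × W), A × (B × W)) where
  toFun x := (x.2.1, (x.1, x.2.2))

variable (A B W) in
theorem exists_cross_swap : ∃ h : Ch A ⊗[ℚ] (Ch B ⊗[ℚ] Ch W) →ₗ[ℚ] Ch (A × (B × W)), ∀ t,
    bdy (h t) + h (triD A B W t) = cross₃ A B W t -
      push (swapLeft A B W) (cross₃ B A W (signedSwap sgn sgn t)) := by
  refine chTriModels.exists_homotopy (G := chTriProd) (fun X => cross₃ X.A X.B X.W)
    (fun X => push (swapLeft X.A X.B X.W) ∘ₗ cross₃ X.B X.A X.W ∘ₗ signedSwap sgn sgn)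
    (fun f x => ?_) (fun {X Y} f x => ?_) (fun X x => ?_) (fun X x => ?_)
    (fun X x => ?_) (fun i => ?_) ⟨A, B, W⟩
  · exact cross₃_map _ _ _ _
  · refine (congrArg (fun t => push _ (cross₃ _ _ _ t))
      (signedSwap_map (sgn_push _) (sgn_push _) x)).trans
      ((congrArg (push _) (cross₃_map _ _ _ _)).trans ?_)
    refine (push_push _ _ _).trans (Eq.trans ?_ (push_push _ _ _).symm)
    rfl
  · exact bdy_cross₃ _
  · refine (bdy_push _ _).trans (congrArg (push _) ((bdy_cross₃ _).trans
      (congrArg (cross₃ _ _ _) ?_)))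
    exact signedSwap_d sgn_sgn sgn_sgn (fun a => by rw [sgn_bdy, neg_neg])
      (fun a => by rw [sgn_bdy, neg_neg]) x
  · refine (aug_cross₃ _).trans (Eq.trans ?_ (aug_push _ _).symm)
    refine Eq.trans ?_ (aug_cross₃ _).symm
    exact (signedSwap_aug aug_sgn x).symm
  · obtain ⟨κ, a, h, h', -⟩ := exists_contraction (Dl i.1 × (Dl i.2.1 × Dl i.2.2))
    exact ⟨κ, _, h, h'⟩

lemma tenD_of_cycles {a : Ch A} {b : Ch B} (ha : bdy a = 0) (hb : bdy b = 0) :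
    tenD A B (a ⊗ₜ b) = 0 := by
  rw [tenD_tmul, ha, hb, zero_tmul, tmul_zero, add_zero]

/-- Graded commutativity of iterated cross products of cycles. -/
theorem exists_bdy_swap {p q : ℕ} {a : Ch A} {b : Ch B} {w : Ch W} (ha : a ∈ dgs {p})
    (hb : b ∈ dgs {q}) (ha' : bdy a = 0) (hb' : bdy b = 0) (hw' : bdy w = 0) :
    ∃ u, bdy u = cross A (B × W) (a ⊗ₜ cross B W (b ⊗ₜ w)) -
      (-1 : ℚ) ^ (p * q) • push (swapLeft A B W) (cross B (A × W) (b ⊗ₜ cross A W (a ⊗ₜ w))) := by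
  obtain ⟨h, hh⟩ := exists_cross_swap A B W
  refine ⟨h (a ⊗ₜ (b ⊗ₜ w)), ?_⟩
  have := hh (a ⊗ₜ (b ⊗ₜ w))
  rw [triD_tmul, tenD_of_cycles hb' hw', ha', zero_tmul, tmul_zero, zero_add, map_zero, add_zero,
    signedSwap_of_eigen w (sgn_of_mem ha) (sgn_of_mem hb),
    map_smul, map_smul, cross₃_tmul, cross₃_tmul] at this
  exact this

open TensorProduct

section Abstract

variable {U V : Type} [AddCommGroup U] [Module ℚ U] [AddCommGroup V] [Module ℚ V]

lemma exists_pseudoinverse (d : V →ₗ[ℚ] V) : ∃ g : V →ₗ[ℚ] V, ∀ x, d (g (d x)) = d x := by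
  obtain ⟨s, hs⟩ :=
    LinearMap.exists_rightInverse_of_surjective d.rangeRestrict d.range_rangeRestrict
  obtain ⟨g, hg⟩ := LinearMap.exists_extend s
  refine ⟨g, fun x => ?_⟩
  have h1 : g (d x) = s (d.rangeRestrict x) := LinearMap.congr_fun hg (d.rangeRestrict x)
  have h2 := congrArg Subtype.val (LinearMap.congr_fun hs (d.rangeRestrict x))
  rw [h1]
  exact h2

/-- The total differential of a tensor product. -/
noncomputable def tensorD (d s : U →ₗ[ℚ] U) (d' : V →ₗ[ℚ] V) : U ⊗[ℚ] V →ₗ[ℚ] U ⊗[ℚ] V :=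
  TensorProduct.map d LinearMap.id + TensorProduct.map s d'

/-- Cycles of a tensor product of complexes are homologous to sums of tensors of cycles. -/
lemma exists_tensor_cycles {d s : U →ₗ[ℚ] U} {d' : V →ₗ[ℚ] V} (hd : ∀ x, d (d x) = 0)
    (hd' : ∀ x, d' (d' x) = 0) (hs : ∀ x, s (s x) = x) (hsd : ∀ x, d (s x) = - s (d x))
    {t : U ⊗[ℚ] V} (ht : tensorD d s d' t = 0) :
    ∃ u, t - tensorD d s d' u ∈
      Submodule.span ℚ {x | ∃ a b, d a = 0 ∧ d' b = 0 ∧ x = a ⊗ₜ[ℚ] b} := by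
  obtain ⟨g, hg⟩ := exists_pseudoinverse d
  obtain ⟨g', hg'⟩ := exists_pseudoinverse d'
  let p : U →ₗ[ℚ] U := LinearMap.id - d ∘ₗ g - g ∘ₗ d
  let p' : V →ₗ[ℚ] V := LinearMap.id - d' ∘ₗ g' - g' ∘ₗ d'
  have hp : ∀ x, d (p x) = 0 := fun x => by simp [p, hd, hg]
  have hp' : ∀ x, d' (p' x) = 0 := fun x => by simp [p', hd', hg']
  have hp'd : ∀ x, p' (d' x) = 0 := fun x => by simp [p', hd', hg']
  set D : U ⊗[ℚ] V →ₗ[ℚ] U ⊗[ℚ] V := tensorD d s d' with hD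
  have e1 : ∀ t, D (TensorProduct.map s g' t) + TensorProduct.map s g' (D t) =
      t - TensorProduct.map LinearMap.id p' t := fun t => by
    induction t using ten_induction with
    | hadd x y hx hy =>
      simp only [map_add]
      rw [add_sub_add_comm, ← hx, ← hy]
      module
    | h a b =>
      simp only [hD, tensorD, p', LinearMap.add_apply, TensorProduct.map_tmul, LinearMap.id_apply,
        LinearMap.sub_apply, LinearMap.comp_apply, hs, hsd, tmul_sub, map_add, neg_tmul]
      module
  have e2 : D (TensorProduct.map LinearMap.id p' t) = 0 := by
    have : ∀ t, D (TensorProduct.map LinearMap.id p' t) =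
        TensorProduct.map LinearMap.id p' (D t) := fun t => by
      induction t using ten_induction with
      | hadd x y hx hy => simp only [map_add, hx, hy]
      | h a b => simp [hD, tensorD, hp', hp'd]
    rw [this, ht, map_zero]
  have e3 : ∀ t, D (TensorProduct.map g LinearMap.id (TensorProduct.map LinearMap.id p' t)) +
      TensorProduct.map g LinearMap.id (D (TensorProduct.map LinearMap.id p' t)) =
      TensorProduct.map LinearMap.id p' t - TensorProduct.map p p' t := fun t => by
    induction t using ten_induction with
    | hadd x y hx hy =>
      simp only [map_add]
      rw [add_sub_add_comm, ← hx, ← hy]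
      module
    | h a b =>
      simp only [hD, tensorD, p, LinearMap.add_apply, TensorProduct.map_tmul, LinearMap.id_apply,
        LinearMap.sub_apply, LinearMap.comp_apply, hp', sub_tmul, tmul_zero, add_zero]
      module
  refine ⟨TensorProduct.map s g' t +
    TensorProduct.map g LinearMap.id (TensorProduct.map LinearMap.id p' t), ?_⟩
  have h1 := e1 t
  have h3 := e3 t
  rw [ht, map_zero, add_zero] at h1
  rw [e2, map_zero, add_zero] at h3
  have : t - D (TensorProduct.map s g' t + TensorProduct.map g LinearMap.id
      (TensorProduct.map LinearMap.id p' t)) = TensorProduct.map p p' t := by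
    rw [map_add, h1, h3]
    module
  rw [this]
  clear_value D
  clear this h1 h3 e1 e2 e3 ht
  induction t using ten_induction with
  | hadd x y hx hy => rw [map_add]; exact add_mem hx hy
  | h a b => exact Submodule.subset_span ⟨p a, p' b, hp a, hp' b, rfl⟩

lemma tensor_not_boundary {d s : U →ₗ[ℚ] U} {d' : V →ₗ[ℚ] V} {a : U} {b : V}
    (ha : a ∉ LinearMap.range d) (hb : b ∉ LinearMap.range d') (t : U ⊗[ℚ] V) :
    tensorD d s d' t ≠ a ⊗ₜ b := by
  intro h
  obtain ⟨f, hf, hf'⟩ := Submodule.exists_le_ker_of_notMem ha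
  obtain ⟨g, hg, hg'⟩ := Submodule.exists_le_ker_of_notMem hb
  have : ∀ t, LinearMap.mul' ℚ ℚ (TensorProduct.map f g
      ((tensorD d s d') t)) = 0 := fun t => by
    induction t using ten_induction with
    | hadd x y hx hy => simp only [map_add, hx, hy, add_zero]
    | h a b =>
      have h1 : f (d a) = 0 := hf' ⟨a, rfl⟩
      have h2 : g (d' b) = 0 := hg' ⟨b, rfl⟩
      simp [tensorD, h1, h2]
  have h2 := this t
  rw [h] at h2
  simp at h2
  tauto

end Abstract

variable {A B : Type} [TopologicalSpace A] [TopologicalSpace B]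

/-- Cycles of a product are homologous to sums of cross products of cycles. -/
theorem kunneth_span {z : Ch (A × B)} (hz : bdy z = 0) : ∃ u, z - bdy u ∈
    Submodule.span ℚ {x | ∃ a b, bdy a = 0 ∧ bdy b = 0 ∧ x = cross A B (a ⊗ₜ b)} := by
  obtain ⟨h, hh⟩ := exists_cross_aw A B
  have e : tenD A B (aw A B z) = 0 := by rw [tenD_aw, hz, map_zero]
  obtain ⟨u, hu⟩ := exists_tensor_cycles (d := bdy) (s := sgn) (d' := bdy) bdy_bdy bdy_bdy sgn_sgn
    (fun a => by rw [sgn_bdy, neg_neg]) e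
  refine ⟨cross A B u - h z, ?_⟩
  have h1 := hh z
  rw [hz, map_zero, add_zero] at h1
  have h2 : z - bdy (cross A B u - h z) = cross A B (aw A B z - tenD A B u) := by
    rw [map_sub, h1, bdy_cross, map_sub]
    abel
  rw [h2]
  have h3 := Submodule.mem_map_of_mem (f := cross A B) hu
  rw [Submodule.map_span] at h3
  refine Submodule.span_mono ?_ h3
  rintro _ ⟨_, ⟨a, b, ha, hb, rfl⟩, rfl⟩
  exact ⟨a, b, ha, hb, rfl⟩

/-- The cross product of nontrivial homology classes is nontrivial. -/
theorem cross_not_boundary {a : Ch A} {b : Ch B} (ha : bdy a = 0) (hb : bdy b = 0)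
    (ha' : a ∉ LinearMap.range (bdy (X := A))) (hb' : b ∉ LinearMap.range (bdy (X := B))) :
    cross A B (a ⊗ₜ b) ∉ LinearMap.range (bdy (X := A × B)) := by
  rintro ⟨u, hu⟩
  obtain ⟨h, hh⟩ := exists_aw_cross A B
  have h1 := hh (a ⊗ₜ b)
  rw [tenD_of_cycles ha hb, map_zero, add_zero, ← hu, ← tenD_aw] at h1
  refine tensor_not_boundary (s := sgn) ha' hb' (aw A B u - h (a ⊗ₜ b)) ?_
  refine ((tenD A B).map_sub _ _).trans ?_
  rw [h1, sub_sub_cancel]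

open TensorProduct

section Juxtaposition

variable {M : Type} [TopologicalSpace M] {k : ℕ}

/-- Prepend a point to a tuple. -/
def consC : C(M × (Fin k → M), Fin (k + 1) → M) where
  toFun p := Fin.cons p.1 p.2
  continuous_toFun := Continuous.finCons continuous_fst continuous_snd

/-- Forget the first point of a tuple. -/
def tailC : C(Fin (k + 1) → M, Fin k → M) where
  toFun f i := f i.succ

/-- Split off the first point of a tuple. -/
def unconsC : C(Fin (k + 1) → M, M × (Fin k → M)) where
  toFun f := (f 0, fun i => f i.succ)

/-- The product of a chain on `M` and a chain on `M ^ k`, as a chain on `M ^ (k + 1)`. -/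
noncomputable def juxt : Ch M →ₗ[ℚ] Ch (Fin k → M) →ₗ[ℚ] Ch (Fin (k + 1) → M) :=
  TensorProduct.curry (push consC ∘ₗ cross M (Fin k → M))

lemma juxt_apply (x : Ch M) (w : Ch (Fin k → M)) :
    juxt x w = push consC (cross M (Fin k → M) (x ⊗ₜ w)) := rfl

lemma push_consC_unconsC (c : Ch (Fin (k + 1) → M)) : push consC (push unconsC c) = c := by
  rw [← push_eq_push_push (h := ContinuousMap.id _), push_id]
  exact fun x => (Fin.cons_self_tail x).symm

lemma push_unconsC_consC (c : Ch (M × (Fin k → M))) : push unconsC (push consC c) = c := by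
  rw [← push_eq_push_push (h := ContinuousMap.id _), push_id]
  exact fun x => rfl

lemma bdy_juxt (x : Ch M) (w : Ch (Fin k → M)) :
    bdy (juxt x w) = juxt (bdy x) w + juxt (sgn x) (bdy w) := by
  simp only [juxt_apply, bdy_push, bdy_cross, tenD_tmul, map_add]

lemma bdy_juxt_of_cycle {x : Ch M} (hx : bdy x = 0) {w : Ch (Fin k → M)} (hw : bdy w = 0) :
    bdy (juxt x w) = 0 := by
  rw [bdy_juxt, hx, hw, map_zero, map_zero, LinearMap.zero_apply, add_zero]

lemma juxt_bdy_right {x : Ch M} (hx : bdy x = 0) (u : Ch (Fin k → M)) :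
    juxt x (bdy u) ∈ LinearMap.range (bdy (X := Fin (k + 1) → M)) := by
  refine ⟨juxt (sgn x) u, ?_⟩
  rw [bdy_juxt, sgn_sgn, ← neg_eq_iff_eq_neg.mpr (sgn_bdy x), hx]
  simp

lemma juxt_bdy_left (x : Ch M) {w : Ch (Fin k → M)} (hw : bdy w = 0) :
    juxt (bdy x) w ∈ LinearMap.range (bdy (X := Fin (k + 1) → M)) := by
  refine ⟨juxt x w, ?_⟩
  rw [bdy_juxt, hw, map_zero, add_zero]

lemma juxt_mem_dgs {p q : ℕ} {x : Ch M} {w : Ch (Fin k → M)} (hx : x ∈ dgs {p})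
    (hw : w ∈ dgs {q}) : juxt x w ∈ dgs {p + q} :=
  push_dgs _ (cross_mem_dgs hx hw)

/-- Extend a permutation of the last `k` indices. -/
def extendPerm (τ : Equiv.Perm (Fin k)) : Equiv.Perm (Fin (k + 1)) :=
  Equiv.Perm.decomposeFin.symm (0, τ)

lemma juxt_push (τ : Equiv.Perm (Fin k)) (x : Ch M) (w : Ch (Fin k → M)) :
    juxt x (push (permC τ) w) = push (permC (extendPerm τ)) (juxt x w) := by
  have h := cross_push (ContinuousMap.id M) (permC (M := M) τ) x w
  rw [push_id] at h
  rw [juxt_apply, h, juxt_apply, push_push, push_push]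
  congr 2
  ext y i
  refine Fin.cases ?_ (fun i => ?_) i
  · simp [consC, permC, extendPerm]
  · simp [consC, permC, extendPerm]

lemma symE_juxt_symE (x : Ch M) (w : Ch (Fin k → M)) :
    symE (juxt x (symE w)) = (k.factorial : ℚ) • symE (juxt x w) := by
  rw [symE_apply w]
  simp [juxt_push, symE_push, Fintype.card_perm, Nat.cast_smul_eq_nsmul]

/-- Chains whose symmetrization bounds. -/
noncomputable def symBdy (M : Type) [TopologicalSpace M] (k : ℕ) :
    Submodule ℚ (Ch (Fin k → M)) :=
  (LinearMap.range (bdy (X := Fin k → M))).comap symE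

lemma mem_symBdy {c : Ch (Fin k → M)} :
    c ∈ symBdy M k ↔ symE c ∈ LinearMap.range (bdy (X := Fin k → M)) := Iff.rfl

lemma range_bdy_le_symBdy : LinearMap.range (bdy (X := Fin k → M)) ≤ symBdy M k := by
  rintro _ ⟨u, rfl⟩
  exact ⟨symE u, symE_bdy u⟩

lemma factorial_ne_zero_rat (k : ℕ) : (k.factorial : ℚ) ≠ 0 :=
  Nat.cast_ne_zero.mpr k.factorial_ne_zero

lemma symE_sub_smul_mem_symBdy (c : Ch (Fin k → M)) :
    symE c - (k.factorial : ℚ) • c ∈ symBdy M k := by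
  rw [mem_symBdy, map_sub, symE_symE, map_smul, sub_self]
  exact zero_mem _

lemma push_sub_mem_symBdy (τ : Equiv.Perm (Fin k)) (c : Ch (Fin k → M)) :
    push (permC τ) c - c ∈ symBdy M k := by
  rw [mem_symBdy, map_sub, symE_push, sub_self]
  exact zero_mem _

lemma juxt_mem_symBdy {x : Ch M} (hx : bdy x = 0) {w : Ch (Fin k → M)} (hw : w ∈ symBdy M k) :
    juxt x w ∈ symBdy M (k + 1) := by
  obtain ⟨u, hu⟩ := hw
  rw [mem_symBdy, ← Submodule.smul_mem_iff _ (factorial_ne_zero_rat k), ← symE_juxt_symE, ← hu]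
  exact range_bdy_le_symBdy (juxt_bdy_right hx u)

lemma exists_bdy_juxt_swap {p q : ℕ} {x y : Ch M} (hx : x ∈ dgs {p}) (hy : y ∈ dgs {q})
    (hx' : bdy x = 0) (hy' : bdy y = 0) {w : Ch (Fin k → M)} (hw : bdy w = 0) :
    ∃ u, bdy u = juxt x (juxt y w) -
      (-1 : ℚ) ^ (p * q) • push (permC (Equiv.swap 0 1)) (juxt y (juxt x w)) := by
  obtain ⟨u, hu⟩ := exists_bdy_swap hx hy hx' hy' hw
  refine ⟨push (consC.comp ((ContinuousMap.id M).prodMap consC)) u, ?_⟩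
  have key : ∀ (a b : Ch M), juxt a (juxt b w) =
      push (consC.comp ((ContinuousMap.id M).prodMap consC))
        (cross M (M × (Fin k → M)) (a ⊗ₜ cross M (Fin k → M) (b ⊗ₜ w))) := by
    intro a b
    rw [← push_push, ← cross_push, push_id]
    rfl
  rw [bdy_push, hu, map_sub, map_smul, key x y, key y x, push_push, push_push]
  congr 4
  ext ⟨b, a, z⟩ i
  refine Fin.cases ?_ (fun i => ?_) i
  · simp [consC, permC, swapLeft]
  · refine i.cases ?_ fun i => ?_
    · simp [consC, permC, swapLeft]
    · have h1 : (Equiv.swap (0 : Fin (k + 2)) 1) i.succ.succ = i.succ.succ :=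
        Equiv.swap_apply_of_ne_of_ne (Fin.succ_ne_zero _)
          (by
            rw [← Fin.succ_zero_eq_one]
            exact fun h => Fin.succ_ne_zero _ (Fin.succ_injective _ h))
      simp [consC, permC, swapLeft, h1]

lemma juxt_swap_mem_symBdy {p q : ℕ} {x y : Ch M} (hx : x ∈ dgs {p}) (hy : y ∈ dgs {q})
    (hx' : bdy x = 0) (hy' : bdy y = 0) {w : Ch (Fin k → M)} (hw : bdy w = 0) :
    juxt x (juxt y w) - (-1 : ℚ) ^ (p * q) • juxt y (juxt x w) ∈ symBdy M (k + 2) := by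
  obtain ⟨u, hu⟩ := exists_bdy_juxt_swap hx hy hx' hy' hw
  have h1 := range_bdy_le_symBdy ⟨u, hu⟩
  have h2 := (symBdy M (k + 2)).smul_mem ((-1 : ℚ) ^ (p * q))
    (push_sub_mem_symBdy (Equiv.swap 0 1) (juxt y (juxt x w)))
  convert add_mem h1 h2 using 1
  module

lemma juxt_self_mem_symBdy {p : ℕ} (hp : Odd p) {x : Ch M} (hx : x ∈ dgs {p})
    (hx' : bdy x = 0) {w : Ch (Fin k → M)} (hw : bdy w = 0) :
    juxt x (juxt x w) ∈ symBdy M (k + 2) := by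
  have h := juxt_swap_mem_symBdy hx hx hx' hx' hw
  rw [(hp.mul hp).neg_one_pow, neg_smul, one_smul, sub_neg_eq_add, ← two_smul ℚ] at h
  exact (Submodule.smul_mem_iff _ two_ne_zero).mp h

end Juxtaposition

open TensorProduct

section Words

variable {M : Type} [TopologicalSpace M] {k : ℕ}

/-- The span of the products of `k` chains from `S`. -/
noncomputable def wordSpan (S : Set (Ch M)) : (k : ℕ) → Submodule ℚ (Ch (Fin k → M))
  | 0 => LinearMap.ker bdy ⊓ dgs {0}
  | k + 1 => ⨆ x ∈ S, (wordSpan S k).map (juxt x)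

lemma juxt_mem_wordSpan {S : Set (Ch M)} {x : Ch M} (hx : x ∈ S) {w : Ch (Fin k → M)}
    (hw : w ∈ wordSpan S k) : juxt x w ∈ wordSpan S (k + 1) :=
  Submodule.mem_iSup_of_mem x (Submodule.mem_iSup_of_mem hx (Submodule.mem_map_of_mem hw))

lemma wordSpan_succ_le {S : Set (Ch M)} {N : Submodule ℚ (Ch (Fin (k + 1) → M))}
    (h : ∀ x ∈ S, ∀ w ∈ wordSpan S k, juxt x w ∈ N) : wordSpan S (k + 1) ≤ N :=
  iSup₂_le fun x hx => Submodule.map_le_iff_le_comap.mpr fun w hw => h x hx w hw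

lemma bdy_eq_zero_of_mem_wordSpan {S : Set (Ch M)} (hS : ∀ x ∈ S, bdy x = 0) {w : Ch (Fin k → M)}
    (hw : w ∈ wordSpan S k) : bdy w = 0 := by
  suffices h : wordSpan S k ≤ LinearMap.ker bdy from h hw
  induction k with
  | zero => exact inf_le_left
  | succ k ih => exact wordSpan_succ_le fun x hx w hw => bdy_juxt_of_cycle (hS x hx) (ih hw hw)

lemma wordSpan_le_dgs {n : ℕ} {S : Set (Ch M)} (hS : ∀ x ∈ S, ∃ p ≤ n, x ∈ dgs {p}) :
    wordSpan S k ≤ dgs {j | j ≤ n * k} := by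
  induction k with
  | zero => exact inf_le_right.trans (Finsupp.supported_mono fun s (hs : s.1 = 0) => hs.le)
  | succ k ih =>
    refine wordSpan_succ_le fun x hx w hw => ?_
    obtain ⟨p, hp, hxp⟩ := hS x hx
    refine map_mem_of_gen (juxt x) _ (fun q σ (hq : q ≤ n * k) => ?_) (ih hw)
    refine Finsupp.supported_mono ?_ (juxt_mem_dgs hxp
      (gen_mem_spt (R := {s | s.1 ∈ ({q} : Set ℕ)}) rfl))
    rintro s (hs : s.1 = p + q)
    change s.1 ≤ n * (k + 1)
    rw [hs, mul_add]
    lia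

lemma wordSpan_insert_le {S : Set (Ch M)} (hS : ∀ x ∈ S, bdy x = 0 ∧ ∃ p, x ∈ dgs {p})
    {y : Ch M} (hy : bdy y = 0) {q : ℕ} (hyq : y ∈ dgs {q}) :
    wordSpan (insert y S) (k + 1) ≤
      wordSpan S (k + 1) ⊔ (wordSpan (insert y S) k).map (juxt y) ⊔ symBdy M (k + 1) := by
  have hins : ∀ x ∈ insert y S, bdy x = 0 := by
    rintro x (rfl | hx)
    · exact hy
    · exact (hS x hx).1
  induction k with
  | zero =>
    refine wordSpan_succ_le fun x hx w hw => ?_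
    rcases hx with rfl | hx
    · exact Submodule.mem_sup_left (Submodule.mem_sup_right (Submodule.mem_map_of_mem hw))
    · exact Submodule.mem_sup_left (Submodule.mem_sup_left (juxt_mem_wordSpan hx hw))
  | succ k ih =>
    refine wordSpan_succ_le fun x hx w hw => ?_
    rcases hx with rfl | hx
    · exact Submodule.mem_sup_left (Submodule.mem_sup_right (Submodule.mem_map_of_mem hw))
    · obtain ⟨v, hv, s, hs, rfl⟩ := Submodule.mem_sup.mp (ih hw)
      obtain ⟨a, ha, _, ⟨b, hb, rfl⟩, rfl⟩ := Submodule.mem_sup.mp hv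
      obtain ⟨hx', p, hxp⟩ := hS x hx
      rw [map_add, map_add]
      refine add_mem (add_mem ?_ ?_) (Submodule.mem_sup_right (juxt_mem_symBdy hx' hs))
      · exact Submodule.mem_sup_left (Submodule.mem_sup_left (juxt_mem_wordSpan hx ha))
      · have h := juxt_swap_mem_symBdy hxp hyq hx' hy (bdy_eq_zero_of_mem_wordSpan hins hb)
        rw [← sub_add_cancel (juxt x (juxt y b)) ((-1 : ℚ) ^ (p * q) • juxt y (juxt x b))]
        refine add_mem (Submodule.mem_sup_right h) (Submodule.smul_mem _ _ ?_)
        exact Submodule.mem_sup_left (Submodule.mem_sup_right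
          (Submodule.mem_map_of_mem (juxt_mem_wordSpan (Set.mem_insert_of_mem y hx) hb)))

/-- Products of more than `S.card` odd classes from `S` vanish after symmetrization. -/
lemma wordSpan_le_symBdy {S : Finset (Ch M)}
    (hS : ∀ x ∈ S, bdy x = 0 ∧ ∃ p, Odd p ∧ x ∈ dgs {p}) (hk : S.card < k) :
    wordSpan (S : Set (Ch M)) k ≤ symBdy M k := by
  classical
  induction S using Finset.induction_on generalizing k with
  | empty =>
    cases k with
    | zero => exact absurd hk (by simp)
    | succ k => exact wordSpan_succ_le fun x hx => by simp at hx
  | insert y S hyS ih =>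
    rw [Finset.card_insert_of_notMem hyS] at hk
    obtain ⟨k, rfl⟩ : ∃ k', k = k' + 2 := ⟨k - 2, by lia⟩
    obtain ⟨hy, q, hq, hyq⟩ := hS y (Finset.mem_insert_self y S)
    have hS' : ∀ x ∈ S, bdy x = 0 ∧ ∃ p, Odd p ∧ x ∈ dgs {p} := fun x hx =>
      hS x (Finset.mem_insert_of_mem hx)
    have hS'' : ∀ x ∈ (S : Set (Ch M)), bdy x = 0 ∧ ∃ p, x ∈ dgs {p} := fun x hx =>
      ⟨(hS' x hx).1, (hS' x hx).2.imp fun p hp => hp.2⟩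
    have hins : ∀ x ∈ insert y (S : Set (Ch M)), bdy x = 0 := by
      rintro x (rfl | hx)
      · exact hy
      · exact (hS'' x hx).1
    rw [Finset.coe_insert]
    refine (wordSpan_insert_le hS'' hy hyq).trans
      (sup_le (sup_le (ih hS' (by lia)) ?_) le_rfl)
    rw [Submodule.map_le_iff_le_comap]
    intro w hw
    obtain ⟨v, hv, s, hs, rfl⟩ := Submodule.mem_sup.mp (wordSpan_insert_le hS'' hy hyq hw)
    obtain ⟨a, ha, _, ⟨b, hb, rfl⟩, rfl⟩ := Submodule.mem_sup.mp hv
    rw [Submodule.mem_comap, map_add, map_add]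
    exact add_mem (add_mem (juxt_mem_symBdy hy (ih hS' (by lia) ha))
      (juxt_self_mem_symBdy hq hyq hy (bdy_eq_zero_of_mem_wordSpan hins hb)))
      (juxt_mem_symBdy hy hs)

lemma cycle_mem_wordSpan_sup [Nonempty M] {S : Set (Ch M)} (hS : ∀ x ∈ S, bdy x = 0)
    (hgen : ∀ z : Ch M, bdy z = 0 → z ∈ Submodule.span ℚ S ⊔ LinearMap.range (bdy (X := M)))
    {z : Ch (Fin k → M)} (hz : bdy z = 0) :
    z ∈ wordSpan S k ⊔ LinearMap.range (bdy (X := Fin k → M)) := by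
  induction k with
  | zero =>
    have a : Fin 0 → M := Fin.elim0
    have h := constOp_eq a z
    rw [hz, map_zero, add_zero, push_eq_self fun x => Subsingleton.elim _ _] at h
    rw [← sub_add_cancel z (aug z • gen (ContinuousMap.const (Dl 0) a)), ← h]
    refine add_mem (Submodule.mem_sup_right ⟨_, rfl⟩) (Submodule.mem_sup_left ?_)
    exact Submodule.smul_mem _ _ ⟨bdy_gen_zero _, gen_mem_spt rfl⟩
  | succ k ih =>
    obtain ⟨u, hu⟩ := kunneth_span (A := M) (B := Fin k → M) (z := push unconsC z)
      (by rw [bdy_push, hz, map_zero])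
    rw [← push_consC_unconsC z, ← sub_add_cancel (push unconsC z) (bdy u), map_add, ← bdy_push]
    refine add_mem ?_ (Submodule.mem_sup_right ⟨_, rfl⟩)
    refine Submodule.span_induction (p := fun c _ => push consC c ∈ wordSpan S (k + 1) ⊔
      LinearMap.range (bdy (X := Fin (k + 1) → M))) ?_ ?_ ?_ ?_ hu
    · rintro _ ⟨a, b, ha, hb, rfl⟩
      rw [← juxt_apply]
      obtain ⟨x, hx, _, ⟨a', rfl⟩, rfl⟩ := Submodule.mem_sup.mp (hgen a ha)
      obtain ⟨w, hw, _, ⟨b', rfl⟩, rfl⟩ := Submodule.mem_sup.mp (ih hb)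
      have hw' := bdy_eq_zero_of_mem_wordSpan hS hw
      rw [map_add _ w, map_add _ x, LinearMap.add_apply]
      refine add_mem (add_mem ?_ (Submodule.mem_sup_right (juxt_bdy_left a' hw')))
        (Submodule.mem_sup_right (by rw [← map_add]; exact juxt_bdy_right ha b'))
      refine Submodule.mem_sup_left ?_
      refine Submodule.span_induction (p := fun x _ => juxt x w ∈ wordSpan S (k + 1))
        (fun x hx => juxt_mem_wordSpan hx hw) (by simp) (fun x y _ _ hx hy => ?_)
        (fun r x _ hx => ?_) hx
      · rw [map_add, LinearMap.add_apply]
        exact add_mem hx hy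
      · rw [map_smul, LinearMap.smul_apply]
        exact Submodule.smul_mem _ _ hx
    · rw [map_zero]; exact zero_mem _
    · intro x y _ _ hx hy
      rw [map_add]
      exact add_mem hx hy
    · intro r x _ hx
      rw [map_smul]
      exact Submodule.smul_mem _ _ hx

end Words

section Vanishing

variable {X : Type} [TopologicalSpace X]

lemma bdy_degPart_of_cycle {z : Ch X} (hz : bdy z = 0) (i : ℕ) : bdy (degPart i z) = 0 := by
  cases i with
  | zero => exact bdy_degPart_zero z
  | succ i => rw [← degPart_bdy, hz, map_zero]

lemma sub_sum_degPart_mem (n : ℕ) (z : Ch X) :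
    z - ∑ i ∈ Finset.range n, degPart i z ∈ dgs {j | n ≤ j} := by
  have := map_mem_of_gen (R := Set.univ) (LinearMap.id - ∑ i ∈ Finset.range n, degPart (X := X) i)
    (dgs {j | n ≤ j}) (fun p σ _ => ?_) (c := z) (by simp [spt])
  · simpa using this
  · simp only [LinearMap.sub_apply, LinearMap.id_apply, LinearMap.sum_apply, degPart_gen,
      Finset.sum_ite_eq, Finset.mem_range]
    split_ifs with h
    · rw [sub_self]; exact zero_mem _
    · rw [sub_zero]; exact gen_mem_spt (not_lt.mp h)

lemma dgs_bdy_of_high {n : ℕ} (hn : 1 ≤ n) {M : Type} [TopologicalSpace M]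
    [ChartedSpace (EuclideanSpace ℝ (Fin n)) M] {z : Ch M} (hz : bdy z = 0)
    (hd : z ∈ dgs {j | n + 1 ≤ j}) : z ∈ LinearMap.range (bdy (X := M)) := by
  obtain ⟨w, -, hw⟩ := vanishesFrom_manifold (M := M) hn z (mem_CA_univ z) hd hz
  exact ⟨w, hw⟩

/-- The homology of `M ^ k` vanishes above dimension `n * k`. -/
theorem mem_range_bdy_of_large {n k i : ℕ} (hn : 1 ≤ n) {M : Type} [TopologicalSpace M] [Nonempty M]
    [ChartedSpace (EuclideanSpace ℝ (Fin n)) M] {z : Ch (Fin k → M)} (hz : bdy z = 0)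
    (hd : z ∈ dgs {i}) (hi : n * k < i) : z ∈ LinearMap.range (bdy (X := Fin k → M)) := by
  let S : Set (Ch M) := {x | bdy x = 0 ∧ ∃ p ≤ n, x ∈ dgs {p}}
  have hgen : ∀ z : Ch M, bdy z = 0 →
      z ∈ Submodule.span ℚ S ⊔ LinearMap.range (bdy (X := M)) := by
    intro z hz
    rw [← add_sub_cancel (∑ i ∈ Finset.range (n + 1), degPart i z) z]
    refine add_mem (Submodule.mem_sup_left (sum_mem fun p hp => Submodule.subset_span ?_))
      (Submodule.mem_sup_right (dgs_bdy_of_high hn ?_ (sub_sum_degPart_mem _ z)))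
    · exact ⟨bdy_degPart_of_cycle hz p, p, Nat.lt_succ_iff.mp (Finset.mem_range.mp hp),
        degPart_mem p z⟩
    · rw [map_sub, map_sum, hz, Finset.sum_eq_zero fun p _ => bdy_degPart_of_cycle hz p, sub_zero]
  obtain ⟨w, hw, _, ⟨u, rfl⟩, h⟩ := Submodule.mem_sup.mp
    (cycle_mem_wordSpan_sup (S := S) (fun x hx => hx.1) hgen hz)
  have hw0 : degPart i w ∈ (⊥ : Submodule ℚ _) := by
    refine map_mem_of_gen (degPart i) ⊥ (fun p σ (hp : p ≤ n * k) => ?_)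
      (wordSpan_le_dgs (fun x hx => hx.2) hw)
    rw [degPart_gen, if_neg (by lia)]
    exact zero_mem _
  rw [← degPart_of_mem hd, ← h, map_add, (Submodule.mem_bot ℚ).mp hw0, zero_add, degPart_bdy]
  exact ⟨_, rfl⟩

end Vanishing

section Descent

variable {V : ℕ → Type} [∀ k, AddCommGroup (V k)] [∀ k, Module ℚ (V k)]
  (N : ∀ k, Submodule ℚ (V k)) (μ : ∀ k, V k →ₗ[ℚ] V (k + 1))

/-- The vectors sent to `N` by `j` successive applications of `μ`. -/
def eventuallyIn : ℕ → ∀ k, Submodule ℚ (V k)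
  | 0 => N
  | j + 1 => fun k => (eventuallyIn j (k + 1)).comap (μ k)

variable {N μ}

lemma le_eventuallyIn (hμ : ∀ k, ∀ x ∈ N k, μ k x ∈ N (k + 1)) (j k : ℕ) :
    N k ≤ eventuallyIn N μ j k := by
  induction j generalizing k with
  | zero => exact le_rfl
  | succ j ih => exact fun x hx => ih (k + 1) (hμ k x hx)

lemma eventuallyIn_le_succ (hμ : ∀ k, ∀ x ∈ N k, μ k x ∈ N (k + 1)) (j k : ℕ) :
    eventuallyIn N μ j k ≤ eventuallyIn N μ (j + 1) k := by
  induction j generalizing k with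
  | zero => exact fun x hx => hμ k x hx
  | succ j ih => exact fun x hx => ih (k + 1) hx

/-- An operator `D` with `D μ = α + β μ D`, for positive `α` and `β`, makes `μ`
injective modulo `N`. -/
lemma mem_of_lowering (D : ∀ k, V (k + 1) →ₗ[ℚ] V k)
    (hμ : ∀ k, ∀ x ∈ N k, μ k x ∈ N (k + 1)) (hD : ∀ k, ∀ x ∈ N (k + 1), D k x ∈ N k)
    (h0 : ∀ x, D 0 (μ 0 x) - x ∈ N 0) (α β : ℕ → ℚ) (hα : ∀ k, 0 < α k) (hβ : ∀ k, 0 < β k)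
    (h : ∀ k x, D (k + 1) (μ (k + 1) x) - (α k • x + β k • μ k (D k x)) ∈ N (k + 1))
    {k : ℕ} {x : V k} (hx : μ k x ∈ N (k + 1)) : x ∈ N k := by
  have c1 : ∀ j k (x : V (k + 1)), x ∈ eventuallyIn N μ j (k + 1) →
      D k x ∈ eventuallyIn N μ (j + 1) k := by
    intro j
    induction j with
    | zero => exact fun k x hx => hμ _ _ (hD k x hx)
    | succ j ih =>
      intro k x hx
      have e1 := ih (k + 1) (μ (k + 1) x) hx
      have e2 := le_eventuallyIn hμ (j + 1) (k + 1) (h k x)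
      have e3 := sub_mem (sub_mem e1 e2) (Submodule.smul_mem _ (α k) hx)
      rw [sub_sub_cancel, add_sub_cancel_left] at e3
      exact (Submodule.smul_mem_iff (eventuallyIn N μ (j + 1) (k + 1)) (hβ k).ne').mp e3
  have c2 : ∀ j k (y : V (k + 1)) (γ : ℚ), 0 ≤ γ → y ∈ eventuallyIn N μ j (k + 1) →
      μ k (D k y) - γ • y ∈ N (k + 1) → y ∈ N (k + 1) := by
    intro j
    induction j with
    | zero => exact fun k y γ _ hy _ => hy
    | succ j ih =>
      intro k y γ hγ hy hyγ
      have hc : 0 < α k + β k * γ := add_pos_of_pos_of_nonneg (hα k) (mul_nonneg (hβ k).le hγ)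
      have e1 : D (k + 1) (μ (k + 1) y) - (α k + β k * γ) • y ∈ N (k + 1) := by
        convert add_mem (h k y) (Submodule.smul_mem _ (β k) hyγ) using 1
        module
      have e2 : μ (k + 1) y ∈ N (k + 1 + 1) := by
        refine ih (k + 1) (μ (k + 1) y) (α k + β k * γ) hc.le hy ?_
        have := hμ _ _ e1
        rwa [map_sub, map_smul] at this
      have e3 := sub_mem (hD _ _ e2) e1
      rw [sub_sub_cancel] at e3
      exact (Submodule.smul_mem_iff _ hc.ne').mp e3
  have c3 : ∀ k j, eventuallyIn N μ j k ≤ N k := by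
    intro k
    induction k with
    | zero =>
      intro j y hy
      have hy' := eventuallyIn_le_succ hμ j 0 hy
      have e : μ 0 y ∈ N 1 := by
        refine c2 j 0 (μ 0 y) 1 zero_le_one hy' ?_
        have := hμ _ _ (h0 y)
        rw [one_smul]
        rwa [map_sub] at this
      have e3 := sub_mem (hD _ _ e) (h0 y)
      rwa [sub_sub_cancel] at e3
    | succ k ih =>
      intro j x hx
      refine c2 j k x 0 le_rfl hx ?_
      rw [zero_smul, sub_zero]
      exact hμ _ _ (ih _ (c1 j k x hx))
  exact c3 k 1 hx

end Descent

section Stabilization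

variable {M : Type} [TopologicalSpace M] {k : ℕ}

/-- Prepend the point `a`. -/
def addPt (k : ℕ) (a : M) : C(Fin k → M, Fin (k + 1) → M) where
  toFun f := Fin.cons a f
  continuous_toFun := Continuous.finCons continuous_const continuous_id

lemma juxt_point (a : M) (w : Ch (Fin k → M)) :
    juxt (gen (ContinuousMap.const (Dl 0) a)) w = push (addPt k a) w := by
  rw [juxt_apply, cross_gen_point, push_push]
  rfl

lemma push_addPt_mem_symBdy (a : M) {w : Ch (Fin k → M)} (hw : w ∈ symBdy M k) :
    push (addPt k a) w ∈ symBdy M (k + 1) := by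
  rw [← juxt_point]
  exact juxt_mem_symBdy (bdy_gen_zero _) hw

/-- Forget a point of a symmetrized chain. -/
noncomputable def forget (M : Type) [TopologicalSpace M] (k : ℕ) :
    Ch (Fin (k + 1) → M) →ₗ[ℚ] Ch (Fin k → M) :=
  push tailC ∘ₗ symE

lemma forget_mem_symBdy {w : Ch (Fin (k + 1) → M)} (hw : w ∈ symBdy M (k + 1)) :
    forget M k w ∈ symBdy M k := by
  obtain ⟨u, hu⟩ := hw
  refine range_bdy_le_symBdy ⟨push tailC u, ?_⟩
  rw [bdy_push, hu]
  rfl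

/-- Replace the `q`-th point of a tuple by `a`. -/
def replaceC (a : M) (q : Fin k) : C(Fin k → M, Fin k → M) where
  toFun f := Function.update f q a
  continuous_toFun := continuous_id.update q continuous_const

lemma forget_push_addPt (a : M) (y : Ch (Fin k → M)) :
    forget M k (push (addPt k a) y) = symE y + ∑ q, symE (push (replaceC a q) y) := by
  rw [forget, LinearMap.comp_apply, symE_apply, map_sum,
    ← Equiv.sum_comp Equiv.Perm.decomposeFin.symm, Fintype.sum_prod_type, Fin.sum_univ_succ]
  simp only [symE_apply]
  congr 1
  · refine Finset.sum_congr rfl fun τ _ => ?_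
    rw [push_push, push_push]
    congr 2
  · refine Finset.sum_congr rfl fun q _ => Finset.sum_congr rfl fun τ _ => ?_
    rw [push_push, push_push, push_push]
    congr 2
    ext f i
    by_cases hi : τ i = q
    · simp [tailC, permC, addPt, replaceC, hi]
    · have h1 : Equiv.swap (0 : Fin (k + 1)) q.succ (τ i).succ = (τ i).succ :=
        Equiv.swap_apply_of_ne_of_ne (Fin.succ_ne_zero _) fun h => hi (Fin.succ_injective _ h)
      simp [tailC, permC, addPt, replaceC, hi, h1]

lemma symE_push_replaceC (a : M) (q : Fin (k + 1)) (z : Ch (Fin (k + 1) → M)) :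
    symE (push (replaceC a q) (symE z)) =
      symE (push (addPt k a) (forget M k z)) := by
  have h : push (replaceC a q) (symE z) =
      push (permC (Equiv.swap 0 q)) (push ((addPt k a).comp tailC)
        (push (permC (Equiv.swap 0 q)) (symE z))) := by
    rw [push_push, push_push]
    congr 2
    ext f i
    by_cases hi : i = q
    · simp [tailC, permC, addPt, replaceC, hi]
    · have h1 : Equiv.swap 0 q i ≠ 0 := fun h => hi (by
        rw [← Equiv.swap_apply_self 0 q i, h, Equiv.swap_apply_left])
      obtain ⟨j, hj⟩ := Fin.exists_succ_eq.mpr h1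
      have h2 : Equiv.swap 0 q j.succ = i := by rw [hj, Equiv.swap_apply_self]
      simp [tailC, permC, addPt, replaceC, hi, ← hj, h2]
  rw [h, symE_push, push_symE, ← push_push]
  rfl

lemma forget_addPt_sub_mem (a : M) (z : Ch (Fin (k + 1) → M)) :
    forget M (k + 1) (push (addPt (k + 1) a) z) - (((k + 1).factorial : ℚ) • z +
      ((k + 1 : ℕ) : ℚ) • push (addPt k a) (forget M k z)) ∈ symBdy M (k + 1) := by
  have hf := factorial_ne_zero_rat (k + 1)
  have e1 := forget_mem_symBdy (push_addPt_mem_symBdy a (symE_sub_smul_mem_symBdy z))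
  have e2 := symE_sub_smul_mem_symBdy (symE z)
  have e2' := (symBdy M (k + 1)).smul_mem ((k + 1).factorial : ℚ) (symE_sub_smul_mem_symBdy z)
  have e3 := (symBdy M (k + 1)).smul_mem ((k + 1 : ℕ) : ℚ)
    (symE_sub_smul_mem_symBdy (push (addPt k a) (forget M k z)))
  rw [map_sub, map_sub, map_smul, map_smul, forget_push_addPt] at e1
  simp only [symE_push_replaceC, Finset.sum_const, Finset.card_univ, Fintype.card_fin,
    ← Nat.cast_smul_eq_nsmul ℚ] at e1
  rw [← Submodule.smul_mem_iff _ hf]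
  convert sub_mem (add_mem (add_mem e2 e2') e3) e1 using 1
  module

lemma forget_addPt_zero (a : M) (z : Ch (Fin 0 → M)) :
    forget M 0 (push (addPt 0 a) z) - z ∈ symBdy M 0 := by
  rw [forget_push_addPt]
  simpa using symE_sub_smul_mem_symBdy z

/-- Adding a point is injective on symmetrized homology. -/
theorem mem_symBdy_of_push_addPt (a : M) {z : Ch (Fin k → M)}
    (h : push (addPt k a) z ∈ symBdy M (k + 1)) : z ∈ symBdy M k :=
  mem_of_lowering (V := fun k => Ch (Fin k → M)) (N := symBdy M) (μ := fun k => push (addPt k a))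
    (forget M) (fun _ _ hx => push_addPt_mem_symBdy a hx) (fun _ _ hx => forget_mem_symBdy hx)
    (forget_addPt_zero a) (fun k => ((k + 1).factorial : ℚ)) (fun k => ((k + 1 : ℕ) : ℚ))
    (fun k => Nat.cast_pos.mpr (k + 1).factorial_pos) (fun k => Nat.cast_pos.mpr k.succ_pos)
    (fun _ z => forget_addPt_sub_mem a z) h

lemma exists_juxt_sub_mem [Nonempty M] {y : Ch M} (hy : bdy y = 0) {q : ℕ} (hyq : y ∈ dgs {q})
    {S : Finset (Ch M)} (hS : ∀ x ∈ S, bdy x = 0 ∧ ∃ p, Odd p ∧ x ∈ dgs {p})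
    (hgen : ∀ z : Ch M, bdy z = 0 →
      z ∈ Submodule.span ℚ (insert y (S : Set (Ch M))) ⊔ LinearMap.range (bdy (X := M)))
    (hk : S.card ≤ k) {z : Ch (Fin (k + 1) → M)} (hz : bdy z = 0) :
    ∃ w, bdy w = 0 ∧ z - juxt y w ∈ symBdy M (k + 1) := by
  have hS' : ∀ x ∈ (S : Set (Ch M)), bdy x = 0 ∧ ∃ p, x ∈ dgs {p} := fun x hx =>
    ⟨(hS x hx).1, (hS x hx).2.imp fun p hp => hp.2⟩
  have hins : ∀ x ∈ insert y (S : Set (Ch M)), bdy x = 0 := by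
    rintro x (rfl | hx)
    · exact hy
    · exact (hS' x hx).1
  obtain ⟨v, hv, t, ht, h1⟩ := Submodule.mem_sup.mp (cycle_mem_wordSpan_sup hins hgen hz)
  obtain ⟨v', hv', s, hs, h2⟩ := Submodule.mem_sup.mp (wordSpan_insert_le hS' hy hyq hv)
  obtain ⟨b, hb, v'', ⟨w, hw, h4⟩, h3⟩ := Submodule.mem_sup.mp hv'
  refine ⟨w, bdy_eq_zero_of_mem_wordSpan hins hw, ?_⟩
  have e := add_mem (add_mem (wordSpan_le_symBdy hS (Nat.lt_succ_of_le hk) hb) hs)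
    (range_bdy_le_symBdy ht)
  have h5 : z - juxt y w = b + s + t := by
    rw [← h1, ← h2, ← h3, ← h4]
    abel
  rw [h5]
  exact e

/-- Adding a point is surjective on symmetrized homology of more than `S.card` points if the
homology is spanned by the class of a point and the odd classes in `S`. -/
theorem exists_push_addPt_sub_mem (a : M) {S : Finset (Ch M)}
    (hS : ∀ x ∈ S, bdy x = 0 ∧ ∃ p, Odd p ∧ x ∈ dgs {p})
    (hgen : ∀ z : Ch M, bdy z = 0 →
      z ∈ Submodule.span ℚ (insert (gen (ContinuousMap.const (Dl 0) a)) (S : Set (Ch M))) ⊔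
        LinearMap.range (bdy (X := M)))
    (hk : S.card ≤ k) {z : Ch (Fin (k + 1) → M)} (hz : bdy z = 0) :
    ∃ w, bdy w = 0 ∧ z - push (addPt k a) w ∈ symBdy M (k + 1) := by
  have : Nonempty M := ⟨a⟩
  obtain ⟨w, hw, h⟩ := exists_juxt_sub_mem (q := 0) (bdy_gen_zero _) (gen_mem_dgs _) hS hgen hk hz
  rw [juxt_point] at h
  exact ⟨w, hw, h⟩

end Stabilization

section Powers

variable {M : Type} [TopologicalSpace M]

/-- The `k`-fold product of a chain with itself. -/
noncomputable def chPow (b : Ch M) (a : M) : (k : ℕ) → Ch (Fin k → M)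
  | 0 => gen (ContinuousMap.const (Dl 0) fun _ => a)
  | k + 1 => juxt b (chPow b a k)

variable {b : Ch M} (a : M) {p : ℕ}

lemma chPow_mem_dgs (hb : b ∈ dgs {p}) (k : ℕ) : chPow b a k ∈ dgs {p * k} := by
  induction k with
  | zero => exact gen_mem_spt rfl
  | succ k ih =>
    rw [mul_add_one, add_comm (p * k)]
    exact juxt_mem_dgs hb ih

lemma bdy_chPow (hb : bdy b = 0) (k : ℕ) : bdy (chPow b a k) = 0 := by
  induction k with
  | zero => exact bdy_gen_zero _
  | succ k ih => exact bdy_juxt_of_cycle hb ih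

lemma chPow_not_boundary (hb : bdy b = 0) (hb' : b ∉ LinearMap.range (bdy (X := M))) (k : ℕ) :
    chPow b a k ∉ LinearMap.range (bdy (X := Fin k → M)) := by
  induction k with
  | zero =>
    rintro ⟨u, hu⟩
    have h := aug_bdy u
    rw [hu, chPow, aug_gen] at h
    simp at h
  | succ k ih =>
    rintro ⟨u, hu⟩
    refine cross_not_boundary hb (bdy_chPow a hb k) hb' ih ⟨push unconsC u, ?_⟩
    rw [bdy_push, hu, chPow, juxt_apply, push_unconsC_consC]

lemma extendPerm_swap {k : ℕ} (i j : Fin k) :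
    extendPerm (Equiv.swap i j) = Equiv.swap i.succ j.succ := by
  ext x
  refine Fin.cases ?_ (fun x => ?_) x
  · rw [Equiv.swap_apply_of_ne_of_ne (Fin.succ_ne_zero _).symm (Fin.succ_ne_zero _).symm]
    simp [extendPerm]
  · simp only [extendPerm, Equiv.Perm.decomposeFin_symm_apply_succ, Equiv.swap_self,
      Equiv.refl_apply, Equiv.swap_apply_def, Fin.succ_inj]
    split_ifs <;> rfl

lemma push_chPow (hb : bdy b = 0) (hp : Even p) (hbp : b ∈ dgs {p}) (k : ℕ)
    (σ : Equiv.Perm (Fin k)) :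
    push (permC σ) (chPow b a k) - chPow b a k ∈ LinearMap.range (bdy (X := Fin k → M)) := by
  induction k with
  | zero =>
    rw [push_eq_self fun x => Subsingleton.elim _ _, sub_self]
    exact zero_mem _
  | succ k ih =>
    have hσ : σ ∈ Submonoid.closure
        (Set.range fun i : Fin k => Equiv.swap i.castSucc i.succ) := by
      rw [Equiv.Perm.mclosure_swap_castSucc_succ]
      trivial
    induction hσ using Submonoid.closure_induction with
    | one =>
      rw [push_eq_self fun x => rfl, sub_self]
      exact zero_mem _
    | mul σ τ _ _ hσ hτ =>
      obtain ⟨u, hu⟩ := hσ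
      obtain ⟨v, hv⟩ := hτ
      refine ⟨push (permC τ) u + v, ?_⟩
      rw [map_add, bdy_push, hu, hv, map_sub, push_push, permC_comp, sub_add_sub_cancel]
    | mem σ hσ =>
      obtain ⟨i, rfl⟩ := hσ
      cases k with
      | zero => exact i.elim0
      | succ k =>
        refine Fin.cases ?_ (fun i => ?_) i
        · obtain ⟨u, hu⟩ := exists_bdy_juxt_swap hbp hbp hb hb (bdy_chPow a hb k)
          rw [(hp.mul_right p).neg_one_pow, one_smul] at hu
          refine ⟨-u, ?_⟩
          rw [map_neg, hu, neg_sub]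
          rfl
        · have h := ih (Equiv.swap i.castSucc i.succ)
          obtain ⟨u, hu⟩ := h
          have e : Equiv.swap i.succ.castSucc i.succ.succ =
              extendPerm (Equiv.swap i.castSucc i.succ) := by
            rw [extendPerm_swap, Fin.succ_castSucc]
          change push (permC (Equiv.swap i.succ.castSucc i.succ.succ)) _ - _ ∈ _
          rw [e, chPow, ← juxt_push, ← map_sub, ← hu]
          exact juxt_bdy_right hb u

/-- The symmetrized powers of an even class do not bound. -/
theorem chPow_not_mem_symBdy (hb : bdy b = 0) (hb' : b ∉ LinearMap.range (bdy (X := M)))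
    (hp : Even p) (hbp : b ∈ dgs {p}) (k : ℕ) : chPow b a k ∉ symBdy M k := by
  intro h
  refine chPow_not_boundary a hb hb' k ?_
  rw [← Submodule.smul_mem_iff _ (factorial_ne_zero_rat k)]
  have e : ∑ σ : Equiv.Perm (Fin k), (push (permC σ) (chPow b a k) - chPow b a k) ∈
      LinearMap.range (bdy (X := Fin k → M)) :=
    sum_mem fun σ _ => push_chPow a hb hp hbp k σ
  rw [Finset.sum_sub_distrib, ← symE_apply, Finset.sum_const, Finset.card_univ,
    Fintype.card_perm, Fintype.card_fin, ← Nat.cast_smul_eq_nsmul ℚ] at e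
  have := sub_mem (mem_symBdy.mp h) e
  rwa [sub_sub_cancel] at this

end Powers

lemma nonempty_quotient_equiv {V V' : Type} [AddCommGroup V] [Module ℚ V] [AddCommGroup V']
    [Module ℚ V'] {P N : Submodule ℚ V} {P' N' : Submodule ℚ V'} (f : V →ₗ[ℚ] V')
    (hf : ∀ x ∈ P, f x ∈ P') (hN : ∀ x ∈ P, f x ∈ N' ↔ x ∈ N)
    (hs : ∀ y ∈ P', ∃ x ∈ P, y - f x ∈ N') :
    Nonempty ((P ⧸ N.submoduleOf P) ≃ₗ[ℚ] (P' ⧸ N'.submoduleOf P')) := by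
  let F : P →ₗ[ℚ] P' ⧸ N'.submoduleOf P' := (N'.submoduleOf P').mkQ ∘ₗ f.restrict hf
  have hF : LinearMap.ker F = N.submoduleOf P := by
    ext x
    rw [LinearMap.mem_ker, LinearMap.comp_apply, Submodule.mkQ_apply, Submodule.Quotient.mk_eq_zero]
    exact hN x x.2
  have hF' : Function.Surjective F := by
    intro y
    obtain ⟨y, rfl⟩ := Submodule.mkQ_surjective _ y
    obtain ⟨x, hx, h⟩ := hs y y.2
    refine ⟨⟨x, hx⟩, ?_⟩
    symm
    rw [← sub_eq_zero, LinearMap.comp_apply, ← map_sub, Submodule.mkQ_apply,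
      Submodule.Quotient.mk_eq_zero]
    exact h
  exact ⟨(Submodule.quotEquivOfEq _ _ hF.symm).trans (F.quotKerEquivOfSurjective hF')⟩

section Homology

variable (X : Type) [TopologicalSpace X]

/-- The cycles of degree `i`. -/
noncomputable abbrev cyc (i : ℕ) : Submodule ℚ (Ch X) := LinearMap.ker bdy ⊓ dgs {i}

/-- The homology of the total chains in degree `i`. -/
abbrev chHom (i : ℕ) : Type := cyc X i ⧸ (LinearMap.range (bdy (X := X))).submoduleOf (cyc X i)

/-- The symmetrized homology of the `k`-th power in degree `i`. -/
abbrev symHom (k i : ℕ) : Type :=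
  cyc (Fin k → X) i ⧸ (symBdy X k).submoduleOf (cyc (Fin k → X) i)

end Homology

section Configurations

variable {M : Type} [TopologicalSpace M] {k i : ℕ}

lemma degPart_mem_symBdy {c : Ch (Fin k → M)} (hc : c ∈ symBdy M k) :
    degPart i c ∈ symBdy M k := by
  obtain ⟨u, hu⟩ := hc
  refine ⟨degPart (i + 1) u, ?_⟩
  rw [← degPart_bdy, hu, degPart_symE]

lemma degPart_mem_cyc {X : Type} [TopologicalSpace X] {z : Ch X} (hz : bdy z = 0) :
    degPart i z ∈ cyc X i :=
  ⟨bdy_degPart_of_cycle hz i, degPart_mem i z⟩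

theorem nonempty_chHom_equiv_symHom [T2Space M] {n : ℕ}
    [ChartedSpace (EuclideanSpace ℝ (Fin n)) M] (hn : Odd n) (k i : ℕ) :
    Nonempty (chHom (unorderedConfig M k) i ≃ₗ[ℚ] symHom M k i) := by
  have hf := factorial_ne_zero_rat k
  refine nonempty_quotient_equiv (transfer M k) (fun x hx => ⟨?_, ?_⟩) (fun x hx => ?_)
    (fun z hz => ?_)
  · refine LinearMap.mem_ker.mpr ?_
    rw [transfer_bdy, LinearMap.mem_ker.mp hx.1, map_zero]
  · rw [← degPart_of_mem hx.2, ← degPart_transfer]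
    exact degPart_mem i _
  · rw [mem_symBdy, symE_transfer, Submodule.smul_mem_iff _ hf]
    constructor
    · rintro ⟨w, hw⟩
      obtain ⟨u, hu⟩ := exists_bdy_of_transfer hn hw.symm
      exact ⟨u, hu.symm⟩
    · rintro ⟨u, rfl⟩
      exact ⟨transfer M k u, transfer_bdy u⟩
  · obtain ⟨y, w, hy, h⟩ := exists_transfer_rep hn (LinearMap.mem_ker.mp hz.1)
    refine ⟨(k.factorial : ℚ)⁻¹ • degPart i y, Submodule.smul_mem _ _ (degPart_mem_cyc hy), ?_⟩
    rw [map_smul, ← degPart_transfer, ← Submodule.smul_mem_iff _ hf, smul_sub,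
      smul_inv_smul₀ hf]
    nth_rewrite 1 [← degPart_of_mem hz.2]
    rw [← map_smul, ← map_sub]
    refine degPart_mem_symBdy ?_
    rw [← neg_mem_iff]
    convert sub_mem (symE_sub_smul_mem_symBdy z) (range_bdy_le_symBdy ⟨w, rfl⟩) using 1
    rw [h]
    abel

theorem nonempty_symHom_succ_equiv (a : M) {S : Finset (Ch M)}
    (hS : ∀ x ∈ S, bdy x = 0 ∧ ∃ p, Odd p ∧ x ∈ dgs {p})
    (hgen : ∀ z : Ch M, bdy z = 0 →
      z ∈ Submodule.span ℚ (insert (gen (ContinuousMap.const (Dl 0) a)) (S : Set (Ch M))) ⊔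
        LinearMap.range (bdy (X := M)))
    (hk : S.card ≤ k) (i : ℕ) : Nonempty (symHom M k i ≃ₗ[ℚ] symHom M (k + 1) i) := by
  refine nonempty_quotient_equiv (push (addPt k a)) (fun x hx => ⟨?_, push_dgs _ hx.2⟩)
    (fun x hx => ⟨mem_symBdy_of_push_addPt a, push_addPt_mem_symBdy a⟩) (fun z hz => ?_)
  · refine LinearMap.mem_ker.mpr ?_
    rw [bdy_push, LinearMap.mem_ker.mp hx.1, map_zero]
  · obtain ⟨w, hw, h⟩ := exists_push_addPt_sub_mem a hS hgen hk (LinearMap.mem_ker.mp hz.1)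
    refine ⟨degPart i w, degPart_mem_cyc hw, ?_⟩
    nth_rewrite 1 [← degPart_of_mem hz.2]
    rw [← degPart_push, ← map_sub]
    exact degPart_mem_symBdy h

theorem subsingleton_symHom_of_large {n : ℕ} (hn : 1 ≤ n) [Nonempty M]
    [ChartedSpace (EuclideanSpace ℝ (Fin n)) M] (hi : n * k < i) : Subsingleton (symHom M k i) := by
  rw [Submodule.Quotient.subsingleton_iff, eq_top_iff]
  rintro ⟨z, hz⟩ -
  exact range_bdy_le_symBdy (mem_range_bdy_of_large hn (LinearMap.mem_ker.mp hz.1) hz.2 hi)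

theorem not_subsingleton_symHom (a : M) {b : Ch M} (hb : bdy b = 0)
    (hb' : b ∉ LinearMap.range (bdy (X := M))) {p : ℕ} (hp : Even p) (hbp : b ∈ dgs {p}) (k : ℕ) :
    ¬ Subsingleton (symHom M k (p * k)) := by
  rw [Submodule.Quotient.subsingleton_iff, eq_top_iff]
  intro h
  exact chPow_not_mem_symBdy a hb hb' hp hbp k
    (h (x := ⟨chPow b a k, bdy_chPow a hb k, chPow_mem_dgs a hbp k⟩) trivial)

end Configurations

section Generators

variable {M : Type} [TopologicalSpace M]

lemma exists_cycle_generators (i : ℕ) [FiniteDimensional ℚ (chHom M i)] :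
    ∃ T : Finset (Ch M), (∀ x ∈ T, x ∈ cyc M i) ∧
      (∀ z ∈ cyc M i, z ∈ Submodule.span ℚ (T : Set (Ch M)) ⊔ LinearMap.range (bdy (X := M))) ∧
      T.card ≤ Module.finrank ℚ (chHom M i) := by
  classical
  let b := Module.finBasis ℚ (chHom M i)
  choose f hf using fun j => Submodule.mkQ_surjective _ (b j)
  refine ⟨Finset.univ.image fun j => (f j : Ch M), fun x hx => ?_, fun z hz => ?_,
    Finset.card_image_le.trans (by simp)⟩
  · obtain ⟨j, -, rfl⟩ := Finset.mem_image.mp hx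
    exact (f j).2
  · have h := b.sum_repr (Submodule.Quotient.mk ⟨z, hz⟩)
    generalize b.repr (Submodule.Quotient.mk ⟨z, hz⟩) = c at h
    simp only [← hf, ← map_smul, ← map_sum] at h
    rw [Submodule.mkQ_apply, eq_comm, Submodule.Quotient.eq] at h
    rw [← sub_add_cancel z (∑ j, c j • (f j : Ch M))]
    refine add_mem (Submodule.mem_sup_right ?_) (Submodule.mem_sup_left ?_)
    · have h' : ((⟨z, hz⟩ - ∑ j, c j • f j : cyc M i) : Ch M) ∈ LinearMap.range (bdy (X := M)) := h
      rwa [Submodule.coe_sub, Submodule.coe_sum] at h'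
    · exact sum_mem fun j _ => Submodule.smul_mem _ _ (Submodule.subset_span
        (Finset.mem_coe.mpr (Finset.mem_image_of_mem _ (Finset.mem_univ j))))

lemma mem_span_point [PathConnectedSpace M] (a : M) {z : Ch M} (hz : z ∈ dgs {0}) :
    z ∈ Submodule.span ℚ {gen (ContinuousMap.const (Dl 0) a)} ⊔ LinearMap.range (bdy (X := M)) := by
  refine map_mem_of_gen LinearMap.id _ (fun n σ (hσ : n = 0) => ?_) hz
  subst hσ
  let γ : Path (σ (stdSimplex.vertex 0)) a := PathConnectedSpace.somePath _ _
  let F : C(Dl 0 × unitInterval, M) := ⟨fun p => γ p.2, γ.continuous.comp continuous_snd⟩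
  have h := homOp_eq F σ (ContinuousMap.const _ a)
    (fun x => γ.source.trans (congrArg σ (Subsingleton.elim _ _))) (fun x => γ.target)
    (gen (ContinuousMap.id (Dl 0)))
  rw [bdy_gen_zero, map_zero, add_zero, push_gen, push_gen, ContinuousMap.comp_id,
    ContinuousMap.comp_id] at h
  rw [LinearMap.id_apply, ← sub_sub_cancel (gen (ContinuousMap.const (Dl 0) a)) (gen σ), ← h]
  exact sub_mem (Submodule.mem_sup_left (Submodule.mem_span_singleton_self _))
    (Submodule.mem_sup_right ⟨_, rfl⟩)

/-- A set of odd cycles generating the homology together with the class of a point, of cardinality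
at most the sum of the positive Betti numbers. -/
theorem exists_odd_generators {n : ℕ} (hn : 1 ≤ n) [PathConnectedSpace M]
    [ChartedSpace (EuclideanSpace ℝ (Fin n)) M] (a : M)
    (hfin : ∀ i, FiniteDimensional ℚ (chHom M i))
    (hodd : ∀ i, 1 ≤ i → Subsingleton (chHom M (2 * i))) :
    ∃ S : Finset (Ch M), (∀ x ∈ S, bdy x = 0 ∧ ∃ p, Odd p ∧ x ∈ dgs {p}) ∧
      (∀ z : Ch M, bdy z = 0 →
        z ∈ Submodule.span ℚ (insert (gen (ContinuousMap.const (Dl 0) a)) (S : Set (Ch M))) ⊔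
          LinearMap.range (bdy (X := M))) ∧
      S.card ≤ ∑ i ∈ Finset.range n, Module.finrank ℚ (chHom M (i + 1)) := by
  classical
  choose T hT hTgen hTcard using fun i => exists_cycle_generators (M := M) i
  refine ⟨(Finset.range n).biUnion fun i => T (i + 1), fun x hx => ?_, fun z hz => ?_,
    Finset.card_biUnion_le.trans (Finset.sum_le_sum fun i _ => hTcard (i + 1))⟩
  · obtain ⟨i, -, hx⟩ := Finset.mem_biUnion.mp hx
    refine ⟨(hT _ x hx).1, i + 1, ?_, (hT _ x hx).2⟩
    by_contra hodd'
    obtain ⟨j, hj⟩ := (Nat.not_odd_iff_even.mp hodd').two_dvd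
    have hs := hodd j (by lia)
    rw [← hj] at hs
    have h0 := hTcard (i + 1)
    rw [Module.finrank_zero_of_subsingleton, Nat.le_zero, Finset.card_eq_zero] at h0
    rw [h0] at hx
    exact absurd hx (Finset.notMem_empty x)
  · rw [← add_sub_cancel (∑ i ∈ Finset.range (n + 1), degPart i z) z]
    refine add_mem (sum_mem fun p hp => ?_)
      (Submodule.mem_sup_right (dgs_bdy_of_high hn ?_ (sub_sum_degPart_mem _ z)))
    · cases p with
      | zero =>
        refine SetLike.le_def.mp (sup_le_sup (Submodule.span_mono ?_) le_rfl)
          (mem_span_point a (degPart_mem 0 z))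
        exact Set.singleton_subset_iff.mpr (Set.mem_insert _ _)
      | succ p =>
        refine SetLike.le_def.mp (sup_le_sup (Submodule.span_mono ?_) le_rfl)
          (hTgen _ _ (degPart_mem_cyc hz))
        intro x hx
        exact Set.mem_insert_of_mem _ (Finset.mem_coe.mpr (Finset.mem_biUnion.mpr
          ⟨p, Finset.mem_range.mpr (Nat.succ_lt_succ_iff.mp (Finset.mem_range.mp hp)), hx⟩))
    · rw [map_sub, map_sum, hz, Finset.sum_eq_zero fun p _ => bdy_degPart_of_cycle hz p, sub_zero]

theorem one_le_finrank_chHom_zero (a : M) [FiniteDimensional ℚ (chHom M 0)] :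
    1 ≤ Module.finrank ℚ (chHom M 0) := by
  have hz : gen (ContinuousMap.const (Dl 0) a) ∈ cyc M 0 := ⟨bdy_gen_zero _, gen_mem_dgs _⟩
  have : Nontrivial (chHom M 0) := by
    refine ⟨⟨Submodule.Quotient.mk ⟨_, hz⟩, 0, fun h => ?_⟩⟩
    rw [Submodule.Quotient.mk_eq_zero] at h
    obtain ⟨u, hu⟩ := h
    have h := aug_bdy u
    rw [hu, Submodule.subtype_apply, aug_gen] at h
    simp at h
  exact Module.finrank_pos

end Generators

section Comparison

variable {X : Type} [TopologicalSpace X]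

theorem nonempty_homology_equiv_chHom (K : ChainComplex (ModuleCat.{0} ℚ) ℕ)
    (φ : ∀ n, K.X n →ₗ[ℚ] Ch X) (hinj : ∀ n, Function.Injective (φ n))
    (hrange : ∀ n, LinearMap.range (φ n) = dgs {n})
    (hd : ∀ n c, φ n ((K.d (n + 1) n).hom c) = bdy (φ (n + 1) c)) (n : ℕ) :
    Nonempty (K.homology n ≃ₗ[ℚ] chHom X n) := by
  have hmem : ∀ n c, φ n c ∈ dgs {n} := fun n c => hrange n ▸ LinearMap.mem_range_self _ c
  have hcyc : ∀ j, (ComplexShape.down ℕ).next n = j → ∀ c : K.X n,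
      (K.d n j).hom c = 0 ↔ bdy (φ n c) = 0 := by
    intro j hj c
    cases n with
    | zero =>
      have h0 : bdy (φ 0 c) = 0 := by
        rw [← degPart_of_mem (hmem 0 c)]
        exact bdy_degPart_zero _
      rw [ChainComplex.next_nat_zero] at hj
      subst hj
      rw [K.shape 0 0 (by simp)]
      simp [h0]
    | succ n =>
      rw [ChainComplex.next_nat_succ] at hj
      subst hj
      rw [← hd, (map_eq_zero_iff _ (hinj n))]
  have hbd : ∀ j, (ComplexShape.down ℕ).prev n = j → ∀ c : K.X n,
      φ n c ∈ LinearMap.range (bdy (X := X)) ↔ c ∈ LinearMap.range (K.d j n).hom := by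
    intro j hj c
    rw [ChainComplex.prev] at hj
    subst hj
    constructor
    · rintro ⟨u, hu⟩
      have hu' : degPart (n + 1) u ∈ LinearMap.range (φ (n + 1)) := by
        rw [hrange]
        exact degPart_mem _ u
      obtain ⟨v, hv⟩ := hu'
      refine ⟨v, hinj n ?_⟩
      rw [hd, hv, ← degPart_bdy, hu, degPart_of_mem (hmem n c)]
    · rintro ⟨v, rfl⟩
      exact ⟨φ (n + 1) v, (hd n v).symm⟩
  have hq : LinearMap.range (K.sc n).moduleCatToCycles =
      (LinearMap.range (K.sc n).f.hom).submoduleOf (LinearMap.ker (K.sc n).g.hom) :=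
    LinearMap.range_codRestrict _ _ _
  obtain ⟨e⟩ := nonempty_quotient_equiv (P := LinearMap.ker (K.sc n).g.hom)
    (N := LinearMap.range (K.sc n).f.hom) (P' := cyc X n) (N' := LinearMap.range (bdy (X := X)))
    (φ n) (fun c hc => ⟨LinearMap.mem_ker.mpr ((hcyc _ rfl c).mp hc), hmem n c⟩)
    (fun c _ => hbd _ rfl c) (fun y hy => by
      have hy' : y ∈ LinearMap.range (φ n) := by
        rw [hrange]
        exact hy.2
      obtain ⟨c, rfl⟩ := hy'
      exact ⟨c, (hcyc _ rfl c).mpr hy.1, (sub_self (φ n c)).symm ▸ zero_mem _⟩)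
  exact ⟨(K.sc n).moduleCatHomologyIso.toLinearEquiv.trans
    ((Submodule.quotEquivOfEq _ _ hq).trans e)⟩

/-- The set of singular simplices of dimension `n`. -/
abbrev singularSimplices (X : Type) [TopologicalSpace X] (n : ℕ) : Type :=
  (TopCat.toSSet.obj (TopCat.of X)).obj (Opposite.op (SimplexCategory.mk n))

/-- A singular simplex as a continuous map on the standard simplex. -/
noncomputable def simplexEquiv (X : Type) [TopologicalSpace X] (n : ℕ) :
    singularSimplices X n ≃ C(Dl n, X) :=
  TopCat.toSSetObjEquiv (TopCat.of X) (Opposite.op (SimplexCategory.mk n))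

lemma simplexEquiv_δ {n : ℕ} (i : Fin (n + 2)) (s : singularSimplices X (n + 1)) :
    simplexEquiv X n ((TopCat.toSSet.obj (TopCat.of X)).δ i s) =
      (simplexEquiv X (n + 1) s).comp (simplexMap i.succAbove) :=
  rfl

/-- Singular chains of degree `n` as total chains. -/
noncomputable def toCh (X : Type) [TopologicalSpace X] (n : ℕ) :
    (singularSimplices X n →₀ ℚ) →ₗ[ℚ] Ch X :=
  Finsupp.lmapDomain ℚ ℚ fun s => ⟨n, simplexEquiv X n s⟩

lemma toCh_single (n : ℕ) (s : singularSimplices X n) :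
    toCh X n (Finsupp.single s 1) = gen (simplexEquiv X n s) :=
  Finsupp.mapDomain_single

lemma toCh_injective (n : ℕ) : Function.Injective (toCh X n) :=
  Finsupp.mapDomain_injective fun _ _ h =>
    (simplexEquiv X n).injective (eq_of_heq (Sigma.mk.inj h).2)

lemma range_toCh (n : ℕ) : LinearMap.range (toCh X n) = dgs {n} := by
  apply le_antisymm
  · rintro _ ⟨c, rfl⟩
    suffices h : toCh X n = degPart n ∘ₗ toCh X n by
      rw [h]
      exact degPart_mem _ _
    refine Finsupp.lhom_ext' fun s => LinearMap.ext_ring ?_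
    rw [LinearMap.comp_apply, LinearMap.comp_apply, LinearMap.comp_apply, Finsupp.lsingle_apply,
      toCh_single, degPart_gen, if_pos rfl]
  · intro c hc
    refine map_mem_of_gen LinearMap.id _ (fun m σ (hm : m = n) => ?_) hc
    subst hm
    exact ⟨Finsupp.single ((simplexEquiv X m).symm σ) 1,
      by rw [toCh_single, Equiv.apply_symm_apply, LinearMap.id_apply]⟩

lemma hom_sum_zsmul_apply {ι : Type} [Fintype ι] {A B : ModuleCat.{0} ℚ} (a : ι → ℤ)
    (f : ι → (A ⟶ B)) (x : A) :
    (∑ i, a i • f i).hom x = ∑ i, (a i : ℚ) • (f i).hom x := by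
  rw [ModuleCat.hom_sum, LinearMap.sum_apply]
  refine Finset.sum_congr rfl fun i _ => ?_
  rw [ModuleCat.hom_zsmul, LinearMap.smul_apply, Int.cast_smul_eq_zsmul]

lemma singularChainComplexQ_d (n : ℕ) (s : singularSimplices X (n + 1)) :
    ((singularChainComplexQ X).d (n + 1) n).hom (ModuleCat.freeMk s) =
      (∑ i : Fin (n + 2), (((-1) ^ (i : ℕ) : ℤ) : ℚ) •
        Finsupp.single ((TopCat.toSSet.obj (TopCat.of X)).δ i s) 1 :
          singularSimplices X n →₀ ℚ) := by
  have hd : (singularChainComplexQ X).d (n + 1) n = ∑ i : Fin (n + 2), (-1 : ℤ) ^ (i : ℕ) •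
      (ModuleCat.free ℚ).map ((TopCat.toSSet.obj (TopCat.of X)).δ i) :=
    AlgebraicTopology.AlternatingFaceMapComplex.obj_d_eq _ n
  rw [hd]
  refine (hom_sum_zsmul_apply _ _ _).trans (Finset.sum_congr rfl fun i _ => ?_)
  exact congrArg _ (ModuleCat.free_map_apply ((TopCat.toSSet.obj (TopCat.of X)).δ i) s)

lemma toCh_d (n : ℕ) (c : singularSimplices X (n + 1) →₀ ℚ) :
    toCh X n (((singularChainComplexQ X).d (n + 1) n).hom c) = bdy (toCh X (n + 1) c) := by
  let D : (singularSimplices X (n + 1) →₀ ℚ) →ₗ[ℚ] (singularSimplices X n →₀ ℚ) :=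
    ((singularChainComplexQ X).d (n + 1) n).hom
  suffices h : toCh X n ∘ₗ D = bdy ∘ₗ toCh X (n + 1) from LinearMap.congr_fun h c
  refine Finsupp.lhom_ext' fun s => LinearMap.ext_ring ?_
  have hD : D (Finsupp.single s 1) = ∑ i : Fin (n + 2), (((-1) ^ (i : ℕ) : ℤ) : ℚ) •
      Finsupp.single ((TopCat.toSSet.obj (TopCat.of X)).δ i s) 1 := singularChainComplexQ_d n s
  rw [LinearMap.comp_apply, LinearMap.comp_apply, LinearMap.comp_apply, LinearMap.comp_apply,
    Finsupp.lsingle_apply, hD, toCh_single, bdy_gen_succ, map_sum]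
  refine Finset.sum_congr rfl fun i _ => ?_
  rw [map_smul, toCh_single, simplexEquiv_δ, Int.cast_pow, Int.cast_neg, Int.cast_one]

theorem nonempty_singularHomologyQ_equiv_chHom (X : Type) [TopologicalSpace X] (n : ℕ) :
    Nonempty (singularHomologyQ X n ≃ₗ[ℚ] chHom X n) :=
  nonempty_homology_equiv_chHom (singularChainComplexQ X) (toCh X) toCh_injective range_toCh
    toCh_d n

end Comparison

lemma subsingleton_dual_iff (V : Type) [AddCommGroup V] [Module ℚ V] :
    Subsingleton (Module.Dual ℚ V) ↔ Subsingleton V := by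
  refine ⟨fun h => ?_, fun h => inferInstance⟩
  by_contra hV
  rw [not_subsingleton_iff_nontrivial] at hV
  exact not_subsingleton (Module.Dual ℚ V) h

section Cohomology

variable (X : Type) [TopologicalSpace X] (i : ℕ)

theorem nonempty_singularCohomologyQ_equiv_dual :
    Nonempty (singularCohomologyQ X i ≃ₗ[ℚ] Module.Dual ℚ (chHom X i)) := by
  obtain ⟨e⟩ := nonempty_singularHomologyQ_equiv_chHom X i
  exact ⟨e.symm.dualMap⟩

lemma subsingleton_singularCohomologyQ_iff :
    Subsingleton (singularCohomologyQ X i) ↔ Subsingleton (chHom X i) := by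
  obtain ⟨e⟩ := nonempty_singularCohomologyQ_equiv_dual X i
  rw [e.toEquiv.subsingleton_congr, subsingleton_dual_iff]

lemma finiteDimensional_chHom [FiniteDimensional ℚ (singularCohomologyQ X i)] :
    FiniteDimensional ℚ (chHom X i) := by
  obtain ⟨e⟩ := nonempty_singularCohomologyQ_equiv_dual X i
  exact (Module.finite_dual_iff ℚ).mp (Module.Finite.equiv e)

lemma bettiQ_eq_finrank_chHom : bettiQ X i = Module.finrank ℚ (chHom X i) := by
  obtain ⟨e⟩ := nonempty_singularCohomologyQ_equiv_dual X i
  rw [bettiQ, e.finrank_eq, Subspace.dual_finrank_eq]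

end Cohomology

section Stability

variable {M : Type} [TopologicalSpace M]

lemma nonempty_equiv_of_strongStabilityRange {r : ℕ} (h : StrongStabilityRange M r) (i d : ℕ) :
    Nonempty (singularCohomologyQ (unorderedConfig M r) i ≃ₗ[ℚ]
      singularCohomologyQ (unorderedConfig M (r + d)) i) := by
  induction d with
  | zero => exact ⟨LinearEquiv.refl ℚ _⟩
  | succ d ih =>
    obtain ⟨e⟩ := ih
    obtain ⟨f⟩ := h (r + d) (Nat.le_add_right r d) i
    exact ⟨e.trans f⟩

variable {n : ℕ} [ChartedSpace (EuclideanSpace ℝ (Fin n)) M] [T2Space M]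

theorem strongStabilityRange_of_odd [ConnectedSpace M] (hn : Odd n)
    (hfin : ∀ i, FiniteDimensional ℚ (singularCohomologyQ M i))
    (hodd : ∀ i, 1 ≤ i → bettiQ M (2 * i) = 0) :
    StrongStabilityRange M (max 1 ((∑ i ∈ Finset.range (n + 1), bettiQ M i) - 1)) := by
  have := ChartedSpace.locallyPathConnectedSpace (EuclideanSpace ℝ (Fin n)) M
  have : PathConnectedSpace M := pathConnectedSpace_iff_connectedSpace.mpr inferInstance
  have hfin' : ∀ i, FiniteDimensional ℚ (chHom M i) := fun i =>
    have := hfin i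
    finiteDimensional_chHom M i
  obtain ⟨a⟩ : Nonempty M := inferInstance
  obtain ⟨S, hS, hgen, hcard⟩ := exists_odd_generators hn.pos a hfin' fun i hi => by
    have h := hodd i hi
    rw [bettiQ_eq_finrank_chHom] at h
    exact Module.finrank_zero_iff.mp h
  intro k hk i
  have h0 := one_le_finrank_chHom_zero a
  have hk' := (le_max_right _ _).trans hk
  rw [Finset.sum_range_succ'] at hk'
  simp only [bettiQ_eq_finrank_chHom] at hk'
  obtain ⟨e⟩ := nonempty_symHom_succ_equiv a hS hgen (k := k) (by lia) i
  obtain ⟨e₁⟩ := nonempty_chHom_equiv_symHom (M := M) hn k i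
  obtain ⟨e₂⟩ := nonempty_chHom_equiv_symHom (M := M) hn (k + 1) i
  obtain ⟨f₁⟩ := nonempty_singularCohomologyQ_equiv_dual (unorderedConfig M k) i
  obtain ⟨f₂⟩ := nonempty_singularCohomologyQ_equiv_dual (unorderedConfig M (k + 1)) i
  exact ⟨f₁.trans ((((e₁.trans e).trans e₂.symm).symm.dualMap).trans f₂.symm)⟩

theorem bettiQ_eq_zero_of_strongStability [Nonempty M] (hn : Odd n) (h : StrongStability M)
    {j : ℕ} (hj : 1 ≤ j) : bettiQ M (2 * j) = 0 := by
  obtain ⟨r, -, h⟩ := h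
  obtain ⟨a⟩ := ‹Nonempty M›
  have hsub : Subsingleton (chHom M (2 * j)) := by
    rw [Submodule.Quotient.subsingleton_iff, eq_top_iff]
    rintro ⟨b, hb⟩ -
    by_contra hb'
    refine not_subsingleton_symHom a (LinearMap.mem_ker.mp hb.1) hb' (even_two_mul j) hb.2
      (r + (n * r + 1)) ?_
    set i := 2 * j * (r + (n * r + 1)) with hi
    have hlt : n * r < i := by nlinarith
    have hr := subsingleton_symHom_of_large (M := M) hn.pos hlt
    obtain ⟨e⟩ := nonempty_equiv_of_strongStabilityRange h i (n * r + 1)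
    obtain ⟨e₁⟩ := nonempty_chHom_equiv_symHom (M := M) hn r i
    obtain ⟨e₂⟩ := nonempty_chHom_equiv_symHom (M := M) hn (r + (n * r + 1)) i
    rwa [← e₂.toEquiv.subsingleton_congr, ← subsingleton_singularCohomologyQ_iff,
      ← e.toEquiv.subsingleton_congr, subsingleton_singularCohomologyQ_iff,
      e₁.toEquiv.subsingleton_congr]
  rw [bettiQ_eq_finrank_chHom]
  exact Module.finrank_zero_of_subsingleton

end Stability

end TotalChains

/-- A connected manifold of odd dimension `2m+1` with finite-dimensional
total rational cohomology has the strong stability property for its unordered configuration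
spaces if and only if it has odd cohomology (all positive even Betti numbers vanish);
moreover, in that case the stability holds from range `max 1 (β(M) - 1)` on, where
`β(M) = ∑ᵢ βᵢ(M)` is the total Betti number. -/
theorem strong_stability_odd_dimensional (m : ℕ) (M : Type) [TopologicalSpace M]
    [ChartedSpace (EuclideanSpace ℝ (Fin (2 * m + 1))) M]
    [T2Space M] [SecondCountableTopology M] [ConnectedSpace M]
    (hfin : FiniteTotalCohomologyQ M) :
    (StrongStability M ↔ ∀ i : ℕ, 1 ≤ i → bettiQ M (2 * i) = 0) ∧
    ((∀ i : ℕ, 1 ≤ i → bettiQ M (2 * i) = 0) →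
      StrongStabilityRange M (max 1 ((∑ i ∈ Finset.range (2 * m + 2), bettiQ M i) - 1))) := by
  have hn : Odd (2 * m + 1) := odd_two_mul_add_one m
  have hstab := TotalChains.strongStabilityRange_of_odd (M := M) hn hfin.1
  exact ⟨⟨fun h _ hi => TotalChains.bettiQ_eq_zero_of_strongStability hn h hi,
    fun h => ⟨_, le_max_left _ _, hstab h⟩⟩, hstab⟩
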